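/- arXiv:2107.04460 — 6 statements merged into one kernel-verified Lean document; each statement's English description precedes it below -/
import Mathlib

section
/- (Goodman) Let G be a simple graph on a finite vertex set of size n, and let T(G) denote the number of triangles in G plus the number of triangles in the complement of G. Then 2·T(G) = 2·C(n,3) − Σ_{v} deg(v)·(n − 1 − deg(v)), where the sum is over all vertices v, deg(v) is the degree of v in G, and C(n,3) is the binomial coefficient. -/
open Finset

namespace SimpleGraph

variable {V : Type*} [Fintype V] [DecidableEq V] (G : SimpleGraph V) [DecidableRel G.Adj]

/-- The triples `(v, a, b)` for which `va` is an edge of `G` and `vb` is an edge of `Gᶜ`. -/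
def bichromaticCherries : Finset (V × V × V) :=
  {p | G.Adj p.1 p.2.1 ∧ Gᶜ.Adj p.1 p.2.2}

theorem card_bichromaticCherries :
    #G.bichromaticCherries = ∑ v, G.degree v * Gᶜ.degree v := by
  rw [bichromaticCherries, card_filter, Fintype.sum_prod_type]
  refine sum_congr rfl fun v _ => ?_
  rw [← card_filter, ← card_neighborFinset_eq_degree, ← card_neighborFinset_eq_degree,
    ← card_product]
  congr 1
  ext ⟨a, b⟩
  simp

theorem card_bichromaticCherries_fiber {s : Finset V} (hs : #s = 3) :
    #{p ∈ G.bichromaticCherries | {p.1, p.2.1, p.2.2} = s} +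
      ((if G.IsNClique 3 s then 2 else 0) + (if Gᶜ.IsNClique 3 s then 2 else 0)) = 2 := by
  obtain ⟨x, y, z, hxy, hxz, hyz, rfl⟩ := card_eq_three.1 hs
  have hfiber : {p ∈ G.bichromaticCherries | {p.1, p.2.1, p.2.2} = ({x, y, z} : Finset V)} =
      {p ∈ ({(x, y, z), (x, z, y), (y, x, z), (y, z, x), (z, x, y), (z, y, x)} :
        Finset (V × V × V)) | G.Adj p.1 p.2.1 ∧ Gᶜ.Adj p.1 p.2.2} := by
    ext ⟨v, a, b⟩
    simp only [bichromaticCherries, mem_filter, mem_univ, true_and, mem_insert, mem_singleton,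
      Prod.mk.injEq]
    constructor
    · rintro ⟨⟨hva, hvb⟩, h⟩
      refine ⟨?_, hva, hvb⟩
      have hv : v ∈ ({x, y, z} : Finset V) := by simp [← h]
      have ha : a ∈ ({x, y, z} : Finset V) := by simp [← h]
      have hb : b ∈ ({x, y, z} : Finset V) := by simp [← h]
      have hab : a ≠ b := by rintro rfl; exact hvb.2 hva
      have := hva.ne
      have := hvb.ne
      simp only [mem_insert, mem_singleton] at hv ha hb
      grind
    · rintro ⟨h, hva, hvb⟩
      refine ⟨⟨hva, hvb⟩, ?_⟩
      ext w
      simp only [mem_insert, mem_singleton]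
      grind
  rw [hfiber]
  clear hfiber
  simp only [is3Clique_triple_iff, compl_adj]
  have hyx := hxy.symm
  have hzx := hxz.symm
  have hzy := hyz.symm
  by_cases h₁ : G.Adj x y <;> by_cases h₂ : G.Adj x z <;> by_cases h₃ : G.Adj y z <;>
    simp [filter_insert, filter_singleton, *, G.adj_comm y x, G.adj_comm z x, G.adj_comm z y]

theorem sum_degree_mul_degree_compl_add_two_mul_card_cliqueFinset_three :
    ∑ v, G.degree v * Gᶜ.degree v + 2 * (#(G.cliqueFinset 3) + #(Gᶜ.cliqueFinset 3)) =
      2 * (Fintype.card V).choose 3 := by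
  have hmaps : ∀ p ∈ G.bichromaticCherries,
      ({p.1, p.2.1, p.2.2} : Finset V) ∈ powersetCard 3 univ := by
    rintro ⟨v, a, b⟩ h
    simp only [bichromaticCherries, mem_filter, mem_univ, true_and] at h
    refine mem_powersetCard.2 ⟨subset_univ _, card_eq_three.2 ⟨v, a, b, h.1.ne, h.2.ne, ?_, rfl⟩⟩
    rintro rfl
    exact h.2.2 h.1
  have hclique (H : SimpleGraph V) [DecidableRel H.Adj] :
      2 * #(H.cliqueFinset 3) =
        ∑ s ∈ powersetCard 3 univ, if H.IsNClique 3 s then 2 else 0 := by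
    rw [← sum_filter, sum_const, smul_eq_mul, mul_comm]
    congr 2
    ext s
    simp only [mem_cliqueFinset_iff, mem_filter, mem_powersetCard, subset_univ, true_and]
    exact ⟨fun h => ⟨h.card_eq, h⟩, fun h => h.2⟩
  rw [← card_bichromaticCherries, card_eq_sum_card_fiberwise hmaps, mul_add, hclique, hclique,
    ← sum_add_distrib, ← sum_add_distrib,
    sum_congr rfl fun s hs => G.card_bichromaticCherries_fiber (mem_powersetCard.1 hs).2,
    sum_const, card_powersetCard, card_univ, smul_eq_mul, mul_comm]

end SimpleGraph


/-- **Goodman's lemma.** For a simple graph `G` on `n` vertices, letting `T`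
be the number of monochromatic triangles (3-cliques of `G` plus 3-cliques of `Gᶜ`),
we have `2·T = 2·C(n,3) − Σ_v deg(v)·(n − 1 − deg(v))`. -/
theorem goodman_triangle_count {V : Type*} [Fintype V] [DecidableEq V]
    (G : SimpleGraph V) [DecidableRel G.Adj] :
    2 * (((G.cliqueFinset 3).card + (Gᶜ.cliqueFinset 3).card : ℤ)) =
      2 * ((Fintype.card V).choose 3 : ℤ) -
        ∑ v : V, (G.degree v : ℤ) * ((Fintype.card V : ℤ) - 1 - (G.degree v : ℤ)) := by
  have hdeg (v : V) : (Gᶜ.degree v : ℤ) = (Fintype.card V : ℤ) - 1 - G.degree v := by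
    have := G.degree_compl v
    have := G.degree_lt_card_verts v
    omega
  have h := G.sum_degree_mul_degree_compl_add_two_mul_card_cliqueFinset_three
  zify at h
  simp only [hdeg] at h
  linarith
end

section
/- R(K₃, J₁₂) ≥ 49. Equivalently: there exists a simple graph on 48 vertices that is triangle-free and whose complement contains no subgraph isomorphic to J₁₂. -/
/-- `H` is contained in `G` as a (not necessarily induced) subgraph:
there is an injective map of vertices carrying edges of `H` to edges of `G`. -/
def containsCopy {α β : Type*} (H : SimpleGraph α) (G : SimpleGraph β) : Prop :=
  ∃ f : α ↪ β, ∀ ⦃a b : α⦄, H.Adj a b → G.Adj (f a) (f b)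

/-- `J k` is the graph `K_k − e`: the complete graph on `k` vertices
with the edge between vertices `0` and `1` removed. -/
def J (k : ℕ) : SimpleGraph (Fin k) :=
  SimpleGraph.fromRel fun a b => ¬(a.val = 0 ∧ b.val = 1) ∧ ¬(a.val = 1 ∧ b.val = 0)

/-!
The vertex `2 * i + e` of the graph below is the element `(i, e)` of `ℤ/24 × ℤ/2`, and the graph is
the Cayley graph with connection set `{±1, ±4, ±6, ±11} × {0} ∪ {0, 8, 16} × {1}`.
Sets of vertices are stored as natural numbers, the vertex `x` being the bit `x`. As
`64 ≡ 1 [MOD 63]`, the number of bits of `P` at multiples of `6` is a residue modulo `63`.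
-/

namespace RamseyK3J12

/-- The set of all `48` vertices. -/
def allVertices : ℕ := 281474976710655

/-- The set of vertices `(i, 0)`. -/
def evenVertices : ℕ := 93824992236885

/-- The set of vertices `(i, 1)`. -/
def oddVertices : ℕ := 187649984473770

/-- The set of multiples of `6` below `48`. -/
def multiplesOfSix : ℕ := 4467856773185

/-- The first `48` bits are the set of non-neighbours of `x`, where `b = 2 ^ x`. The two factors are
the sets of non-neighbours of `(0, 0)` and `(0, 1)`, each written twice in succession. -/
def nonNeighbors (b : ℕ) : ℕ :=
  Nat.shiftRight (Nat.add
    (Nat.mul 59089856102946064963735514873 (Nat.mul 2 (Nat.land b evenVertices)))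
    (Nat.mul 38955176524427712880395083254 (Nat.land b oddVertices))) 49

/-- The number of multiples of `6` below `48` in `P`. -/
def sixCount (P : ℕ) : ℕ := Nat.mod (Nat.land P multiplesOfSix) 63

/-- The number of pairs `{(i, 0), (i, 1)}` that meet `P`. -/
def pairCount (P : ℕ) : ℕ :=
  (fun Q => Nat.add (sixCount Q)
    (Nat.add (sixCount (Nat.shiftRight Q 2)) (sixCount (Nat.shiftRight Q 4))))
    (Nat.lor P (Nat.shiftRight P 1))

/-- `f P`, arranged so that the kernel evaluates `P` before it unfolds `f`. -/
def force (f : ℕ → Bool) (P : ℕ) : Bool :=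
  Nat.rec (f 0) (fun n _ => f (Nat.succ n)) P

theorem force_eq (f : ℕ → Bool) (P : ℕ) : force f P = f P := by
  cases P <;> rfl

/-- Branch and bound on the least element of `P`: the value `true` certifies that no `k` vertices
of `P` are independent. The recursor and the functions on `ℕ` are spelled out to spare the kernel
the unfolding of the usual notation. -/
def noIndep (n : ℕ) : ℕ → ℕ → Bool :=
  Nat.rec (fun _ _ => false)
    (fun _ ih k P =>
      Bool.rec true
        (force (fun P' =>
          Bool.rec false (ih k P')
            (force (ih (Nat.sub k 1)) (Nat.land P' (nonNeighbors (Nat.sub P P')))))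
          (Nat.land P (Nat.sub P 1)))
        (Nat.ble k (pairCount P)))
    n

theorem noIndep_succ (n k P : ℕ) : noIndep (n + 1) k P =
    (!Nat.ble k (pairCount P) ||
      (noIndep n (k - 1) ((P &&& (P - 1)) &&& nonNeighbors (P - (P &&& (P - 1)))) &&
        noIndep n k (P &&& (P - 1)))) := by
  have hrec (c a b : Bool) : (Bool.rec a b c : Bool) = cond c b a := by cases c <;> rfl
  have : noIndep (n + 1) k P = Bool.rec true
      (force (fun P' =>
        Bool.rec false (noIndep n k P')
          (force (noIndep n (k - 1)) (P' &&& nonNeighbors (P - P'))))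
        (P &&& (P - 1))) (Nat.ble k (pairCount P)) := rfl
  rw [this]
  simp only [force_eq, hrec]
  cases Nat.ble k (pairCount P) <;>
    cases noIndep n (k - 1) ((P &&& (P - 1)) &&& nonNeighbors (P - (P &&& (P - 1)))) <;> rfl

theorem noIndep_zero_right (n P : ℕ) : noIndep n 0 P = false := by
  induction n generalizing P with
  | zero => rfl
  | succ n ih => simp [noIndep_succ, ih]

theorem exists_least_bit {P : ℕ} (hP : P ≠ 0) : ∃ v, P - (P &&& (P - 1)) = 2 ^ v ∧
    ∀ j, j ≠ v → P.testBit j → (P &&& (P - 1)).testBit j := by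
  obtain ⟨v, m, ⟨c, rfl⟩, hm⟩ := Nat.exists_eq_two_pow_mul_odd hP
  have hpos : 0 < 2 ^ v := by positivity
  have h₁ : P = 2 ^ (v + 1) * c + 2 ^ v := by rw [hm]; ring
  have h₂ : P - 1 = 2 ^ (v + 1) * c + (2 ^ v - 1) := by omega
  have hlt : 2 ^ v < 2 ^ (v + 1) := Nat.pow_lt_pow_right (by norm_num) (by omega)
  have hand : P &&& (P - 1) = 2 ^ (v + 1) * c := by
    refine Nat.eq_of_testBit_eq fun j => ?_
    rw [Nat.testBit_and, h₂, h₁, Nat.testBit_two_pow_mul_add _ hlt,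
      Nat.testBit_two_pow_mul_add _ (by omega), Nat.testBit_two_pow_mul]
    by_cases hj : j < v + 1
    · simp only [hj, if_true, Nat.testBit_two_pow, Nat.testBit_two_pow_sub_one]
      grind
    · simp [hj, not_lt.1 hj]
  refine ⟨v, by omega, fun j hj hb => ?_⟩
  rw [hand, Nat.testBit_two_pow_mul]
  rw [h₁, Nat.testBit_two_pow_mul_add _ hlt] at hb
  split at hb
  · exact absurd (by simpa [Nat.testBit_two_pow] using hb) hj.symm
  · simp [hb]
    omega

/-- The two vertices are not adjacent. -/
def Free (x y : Fin 48) : Prop := (nonNeighbors (2 ^ x.val)).testBit y = true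

instance : DecidableRel Free := fun _ _ => inferInstanceAs (Decidable (_ = _))

theorem free_self : ∀ x, Free x x := by decide +kernel

theorem free_symm : ∀ x y, Free x y → Free y x := by decide +kernel

theorem eq_of_free_of_pair : ∀ x y : Fin 48, x.val / 2 = y.val / 2 → Free x y → x = y := by
  decide +kernel

theorem testBit_multiplesOfSix (j : ℕ) :
    multiplesOfSix.testBit j = true ↔ j % 6 = 0 ∧ j < 48 := by
  by_cases hj : j < 48
  · have : ∀ j < 48, multiplesOfSix.testBit j = true ↔ j % 6 = 0 ∧ j < 48 := by decide +kernel
    exact this j hj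
  · have : multiplesOfSix.testBit j = false :=
      Nat.testBit_lt_two_pow (lt_of_lt_of_le (b := 2 ^ 48) (by decide +kernel)
        (Nat.pow_le_pow_right (by norm_num) (by omega)))
    simp [this, hj]

theorem card_le_sixCount {P : ℕ} {I : Finset ℕ}
    (hI : ∀ i ∈ I, P.testBit i ∧ i % 6 = 0 ∧ i < 48) : I.card ≤ sixCount P := by
  set Q := P &&& multiplesOfSix with hQdef
  have hmem : ∀ j, j ∈ Q.bitIndices.toFinset ↔ P.testBit j ∧ j % 6 = 0 ∧ j < 48 := fun j => by
    simp [hQdef, testBit_multiplesOfSix]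
  have hsum : Q = ∑ j ∈ Q.bitIndices.toFinset, 2 ^ j := by
    rw [List.sum_toFinset _ Q.bitIndices_sorted.nodup]
    exact Q.sum_map_two_pow_bitIndices.symm
  have hmod : Q ≡ Q.bitIndices.toFinset.card [MOD 63] := by
    conv_lhs => rw [hsum]
    rw [Finset.card_eq_sum_ones]
    refine Nat.ModEq.sum fun j hj => ?_
    obtain ⟨i, rfl⟩ := Nat.dvd_of_mod_eq_zero ((hmem j).1 hj).2.1
    rw [pow_mul]
    simpa using (show 2 ^ 6 ≡ 1 [MOD 63] by decide).pow i
  have hle : Q.bitIndices.toFinset.card ≤ 48 := by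
    refine (Finset.card_le_card (t := Finset.range 48) fun j hj => ?_).trans_eq (by simp)
    exact Finset.mem_range.2 ((hmem j).1 hj).2.2
  have hcard : sixCount P = Q.bitIndices.toFinset.card := by
    change Q % 63 = _
    rw [hmod, Nat.mod_eq_of_lt (by omega)]
  rw [hcard]
  exact Finset.card_le_card fun i hi => (hmem i).2 (hI i hi)

theorem card_le_pairCount {P : ℕ} {T : Finset (Fin 48)} (hP : ∀ x ∈ T, P.testBit x)
    (hT : ∀ x ∈ T, ∀ y ∈ T, Free x y) : T.card ≤ pairCount P := by
  set Q := P ||| P >>> 1 with hQ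
  have hclass : ∀ r < 3, (T.filter fun x => x.val / 2 % 3 = r).card ≤ sixCount (Q >>> (2 * r)) := by
    intro r hr
    have hinj : Set.InjOn (fun x : Fin 48 => 2 * (x.val / 2) - 2 * r)
        (T.filter fun x => x.val / 2 % 3 = r) := by
      intro x hx y hy h
      simp only [Finset.coe_filter, Set.mem_ofPred_eq] at hx hy h
      exact eq_of_free_of_pair x y (by omega) (hT x hx.1 y hy.1)
    rw [← Finset.card_image_of_injOn hinj]
    refine card_le_sixCount fun i hi => ?_
    obtain ⟨x, hx, rfl⟩ := Finset.mem_image.1 hi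
    obtain ⟨hxT, hxr⟩ := Finset.mem_filter.1 hx
    refine ⟨?_, by omega, by omega⟩
    rw [Nat.testBit_shiftRight, hQ, Nat.testBit_or, Nat.testBit_shiftRight, Bool.or_eq_true]
    have hb := hP x hxT
    rcases Nat.mod_two_eq_zero_or_one x.val with h | h
    · left
      rwa [show 2 * r + (2 * (x.val / 2) - 2 * r) = x.val by omega]
    · right
      rwa [show 1 + (2 * r + (2 * (x.val / 2) - 2 * r)) = x.val by omega]
  have hcount : pairCount P = ∑ r ∈ Finset.range 3, sixCount (Q >>> (2 * r)) := by
    rw [Finset.sum_range_succ, Finset.sum_range_succ, Finset.sum_range_one, add_assoc]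
    rfl
  rw [hcount, Finset.card_eq_sum_card_fiberwise (f := fun x : Fin 48 => x.val / 2 % 3)
    (t := Finset.range 3) fun x _ => by simp [Nat.mod_lt]]
  exact Finset.sum_le_sum fun r hr => hclass r (Finset.mem_range.1 hr)

theorem card_lt_of_noIndep : ∀ {n k P : ℕ}, noIndep n k P = true → ∀ {T : Finset (Fin 48)},
    (∀ x ∈ T, P.testBit x) → (∀ x ∈ T, ∀ y ∈ T, Free x y) → T.card < k
  | 0, _, _, h, _, _, _ => absurd h Bool.false_ne_true
  | n + 1, k, P, h, T, hP, hT => by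
    rcases eq_or_ne P 0 with rfl | hP0
    · obtain rfl : T = ∅ := Finset.eq_empty_of_forall_notMem fun x hx => by simpa using hP x hx
      rw [Finset.card_empty, Nat.pos_iff_ne_zero]
      rintro rfl
      simp [noIndep_zero_right] at h
    rw [noIndep_succ, Bool.or_eq_true, Bool.and_eq_true, Bool.not_eq_true'] at h
    rcases h with h | ⟨hk, h⟩
    · have := card_le_pairCount hP hT
      have : ¬ k ≤ pairCount P := fun hle => by simp [Nat.ble_eq_true_of_le hle] at h
      omega
    obtain ⟨v, hv, hrest⟩ := exists_least_bit hP0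
    by_cases hx : ∃ x ∈ T, x.val = v
    · obtain ⟨x, hx, rfl⟩ := hx
      have := card_lt_of_noIndep hk (T := T.erase x) (fun y hy => ?_) fun y hy z hz =>
        hT y (Finset.mem_of_mem_erase hy) z (Finset.mem_of_mem_erase hz)
      · rw [Finset.card_erase_of_mem hx] at this
        omega
      · have hyT := Finset.mem_of_mem_erase hy
        rw [Nat.testBit_and, Bool.and_eq_true, hv]
        exact ⟨hrest y (fun he => Finset.ne_of_mem_erase hy (Fin.ext he)) (hP y hyT), hT x hx y hyT⟩
    · exact card_lt_of_noIndep h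
        (fun y hy => hrest y (fun he => hx ⟨y, hy, he⟩) (hP y hy)) hT

/-- The non-neighbours of the vertex `0`, without `0` itself. -/
def farVertices : ℕ := (allVertices &&& nonNeighbors 1) ^^^ 1

theorem testBit_farVertices : ∀ x : Fin 48, x ≠ 0 → Free 0 x → farVertices.testBit x := by
  decide +kernel

theorem noIndep_farVertices : noIndep 48 11 farVertices = true := by
  decide +kernel

theorem noIndep_farVertices_inter : ∀ y : Fin 48, ¬ Free 0 y →
    noIndep 48 10 (farVertices &&& nonNeighbors (2 ^ y.val)) = true := by
  decide +kernel

/-- The Cayley graph. -/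
def graph : SimpleGraph (Fin 48) where
  Adj x y := ¬ Free x y
  symm := ⟨fun x y h h' => h (free_symm y x h')⟩
  loopless := ⟨fun x h => h (free_self x)⟩

theorem nonNeighbors_or : ∀ x y : Fin 48, ¬ Free x y →
    allVertices &&& (nonNeighbors (2 ^ x.val) ||| nonNeighbors (2 ^ y.val)) = allVertices := by
  decide +kernel

theorem graph_cliqueFree : graph.CliqueFree 3 := by
  intro s hs
  obtain ⟨x, y, z, hxy, hxz, hyz, -⟩ := SimpleGraph.is3Clique_iff.1 hs
  have hz : ∀ z : Fin 48, allVertices.testBit z := by decide +kernel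
  have h := hz z
  rw [← nonNeighbors_or x y hxy, Nat.testBit_and, Nat.testBit_or, Bool.and_eq_true,
    Bool.or_eq_true] at h
  exact h.2.elim hxz hyz

/-- Every two of the vertices `f i` except possibly `f 0` and `f 1` are non-adjacent. -/
def IsBad (f : Fin 12 → Fin 48) : Prop :=
  f.Injective ∧ ∀ i j, ¬ (i = 0 ∧ j = 1) → ¬ (i = 1 ∧ j = 0) → Free (f i) (f j)

theorem IsBad.comp {f : Fin 12 → Fin 48} (hf : IsBad f) {φ : Fin 48 → Fin 48}
    (hφ : φ.Injective) (h : ∀ x y, Free x y → Free (φ x) (φ y)) : IsBad (φ ∘ f) :=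
  ⟨hφ.comp hf.1, fun i j h₁ h₂ => h _ _ (hf.2 i j h₁ h₂)⟩

theorem IsBad.ne_zero {f : Fin 12 → Fin 48} (hf : IsBad f) : f 0 ≠ 0 := by
  intro h0
  have hfar : ∀ i, i ≠ 0 → Free 0 (f i) → farVertices.testBit (f i) := fun i hi =>
    testBit_farVertices _ fun h => hi (hf.1 (h.trans h0.symm))
  by_cases h1 : Free 0 (f 1)
  · have hfree : ∀ i, Free 0 (f i) := fun i => by
      by_cases hi : i = 1
      · rwa [hi]
      · rw [← h0]
        exact hf.2 0 i (by simp [hi]) (by simp)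
    have := card_lt_of_noIndep noIndep_farVertices (T := ({0}ᶜ : Finset (Fin 12)).image f)
      (by simpa using fun i hi => hfar i hi (hfree i))
      (by
        simp only [Finset.mem_image, Finset.mem_compl, Finset.mem_singleton]
        rintro _ ⟨i, hi, rfl⟩ _ ⟨j, hj, rfl⟩
        exact hf.2 i j (by simp [hi]) (by simp [hj]))
    rw [Finset.card_image_of_injective _ hf.1] at this
    exact absurd this (by decide)
  · have := card_lt_of_noIndep (noIndep_farVertices_inter _ h1)
      (T := ({0, 1}ᶜ : Finset (Fin 12)).image f)
      (by
        simp only [Finset.mem_image, Finset.mem_compl, Finset.mem_insert, Finset.mem_singleton,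
          not_or]
        rintro _ ⟨i, hi, rfl⟩
        rw [Nat.testBit_and, Bool.and_eq_true]
        refine ⟨hfar i hi.1 ?_, hf.2 1 i (by simp) (by simp [hi.1])⟩
        rw [← h0]
        exact hf.2 0 i (by simp [hi.2]) (by simp))
      (by
        simp only [Finset.mem_image, Finset.mem_compl, Finset.mem_insert, Finset.mem_singleton,
          not_or]
        rintro _ ⟨i, hi, rfl⟩ _ ⟨j, hj, rfl⟩
        exact hf.2 i j (by simp [hi.1]) (by simp [hi.2]))
    rw [Finset.card_image_of_injective _ hf.1] at this
    exact absurd this (by decide)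

theorem free_add_two : ∀ x y : Fin 48, Free x y → Free (x + 2) (y + 2) := by decide +kernel

/-- The translation by `(0, 1)`. -/
def swap (x : Fin 48) : Fin 48 := if x.val % 2 = 0 then x + 1 else x - 1

theorem swap_injective : Function.Injective swap := by
  have : ∀ x, swap (swap x) = x := by decide +kernel
  exact Function.LeftInverse.injective this

theorem free_swap : ∀ x y : Fin 48, Free x y → Free (swap x) (swap y) := by decide +kernel

theorem IsBad.add_ne_zero {f : Fin 12 → Fin 48} (hf : IsBad f) (n : ℕ) : f 0 + n • 2 ≠ 0 := by
  induction n generalizing f with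
  | zero => simpa using hf.ne_zero
  | succ n ih =>
    have := ih (hf.comp (add_left_injective 2) free_add_two)
    rwa [Function.comp_apply, add_assoc, ← succ_nsmul'] at this

theorem not_isBad (f : Fin 12 → Fin 48) : ¬ IsBad f := by
  intro hf
  have h : ∀ x : Fin 48, (∃ n < 24, x + n • 2 = 0) ∨ ∃ n < 24, swap x + n • 2 = 0 := by
    decide +kernel
  rcases h (f 0) with ⟨n, -, h⟩ | ⟨n, -, h⟩
  · exact hf.add_ne_zero n h
  · exact (hf.comp swap_injective free_swap).add_ne_zero n h

end RamseyK3J12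

open RamseyK3J12 in
/-- R(K₃, J₁₂) ≥ 49: there is a triangle-free graph on 48 vertices whose
complement contains no subgraph isomorphic to `J 12`. -/
theorem ramsey_K3_J12_ge_49 :
    ∃ G : SimpleGraph (Fin 48), G.CliqueFree 3 ∧ ¬ containsCopy (J 12) Gᶜ := by
  refine ⟨graph, graph_cliqueFree, fun ⟨f, hf⟩ => not_isBad f ⟨f.injective, fun i j h₁ h₂ => ?_⟩⟩
  by_cases hij : i = j
  · exact hij ▸ free_self _
  · have hJ : (J 12).Adj i j := by
      simp only [J, SimpleGraph.fromRel_adj]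
      exact ⟨hij, .inl ⟨fun h => h₁ ⟨Fin.ext h.1, Fin.ext h.2⟩,
        fun h => h₂ ⟨Fin.ext h.1, Fin.ext h.2⟩⟩⟩
    exact not_not.1 ((SimpleGraph.compl_adj _ _ _).1 (hf hJ)).2
end

section
/- R(J₄, K₈) ≥ 36. Equivalently: there exists a simple graph on 35 vertices containing no subgraph isomorphic to J₄, whose complement contains no clique of size 8. -/
/-- Whether `l` has no sublist of length `k` whose entries are pairwise unrelated by `r`. -/
def noIndepSublist {α : Type*} (r : α → α → Bool) : ℕ → List α → Bool
  | 0, _ => false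
  | k + 1, l => decide (l.length ≤ k) || l.tails.all fun
    | [] => true
    | a :: t => noIndepSublist r k (t.filter fun b => !r a b)

theorem not_pairwise_of_noIndepSublist {α : Type*} {r : α → α → Bool} {k : ℕ} {l s : List α}
    (h : noIndepSublist r k l = true) (hs : s.Sublist l) (hk : s.length = k) :
    ¬ s.Pairwise fun a b => r a b = false := by
  induction k generalizing l s with
  | zero => simp [noIndepSublist] at h
  | succ k ih =>
    intro hp
    rw [noIndepSublist, Bool.or_eq_true, decide_eq_true_eq] at h
    rcases h with h | h
    · have := hs.length_le
      omega
    · match s, hk with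
      | a :: s, hk =>
        obtain ⟨u, t, rfl, hu, ht⟩ := List.append_sublist_iff.1 (show ([a] ++ s).Sublist l from hs)
        obtain ⟨u₁, u₂, rfl⟩ := List.append_of_mem (List.singleton_sublist.1 hu)
        have h' := List.all_eq_true.1 h (a :: (u₂ ++ t)) (by
          rw [List.mem_tails]
          exact ⟨u₁, by simp⟩)
        rw [List.pairwise_cons] at hp
        refine ih h' (s := s) ?_ (by simpa using hk) hp.2
        have hf : s.filter (fun b => !r a b) = s :=
          List.filter_eq_self.2 fun b hb => by simp [hp.1 b hb]
        rw [← hf]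
        exact (ht.trans (List.sublist_append_right _ _)).filter _

theorem compl_cliqueFree_of_noIndepSublist {n k : ℕ} {G : SimpleGraph (Fin n)}
    {r : Fin n → Fin n → Bool} (hr : ∀ a b, G.Adj a b ↔ r a b = true)
    (h : noIndepSublist r k (List.finRange n) = true) : Gᶜ.CliqueFree k := by
  intro s hs
  have hsort : (s.sort (· ≤ ·)).Sublist (List.finRange n) := by
    refine List.sublist_of_subperm_of_pairwise (r := (· ≤ ·)) ?_ (s.pairwise_sort _)
      (List.pairwise_le_finRange n)
    exact (s.sort_nodup _).subperm fun a _ => List.mem_finRange a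
  refine not_pairwise_of_noIndepSublist h hsort (by simpa using hs.card_eq) ?_
  refine (s.sort_nodup (· ≤ ·)).imp_of_mem fun {a b} ha hb hab => ?_
  have := hs.isClique (by simpa using ha) (by simpa using hb) hab
  rw [SimpleGraph.compl_adj, hr] at this
  simpa using this.2

/-- A graph in which the endpoints of each edge have at most one common neighbour
contains no `K₄ - e`. -/
theorem not_containsCopy_J_four {V : Type*} {G : SimpleGraph V}
    (h : ∀ a b, G.Adj a b → ∀ c, G.Adj a c → G.Adj b c → ∀ d, G.Adj a d → G.Adj b d → c = d) :
    ¬ containsCopy (J 4) G := by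
  rintro ⟨f, hf⟩
  have hJ : ∀ i j : Fin 4, i ≠ j → 2 ≤ i → G.Adj (f i) (f j) := fun i j hij hi =>
    hf (by
      rw [J, SimpleGraph.fromRel_adj]
      exact ⟨hij, by have : 2 ≤ i.val := hi; omega⟩)
  have := h _ _ (hJ 2 3 (by decide) (by decide)) _ (hJ 2 0 (by decide) (by decide))
    (hJ 3 0 (by decide) (by decide)) _ (hJ 2 1 (by decide) (by decide))
    (hJ 3 1 (by decide) (by decide))
  exact absurd (f.injective this) (by decide)

/-- The rows, read as binary numbers, of the adjacency matrix of a graph on 35 vertices made of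
seven circulant blocks of order 5. -/
def blockCirculantRows : List ℕ :=
  [168478898, 335910213, 671820426, 302436660, 604841545,
    11280650825, 21521113266, 9756229957, 19479922314, 5640325428,
    14506150162, 27972081157, 22625658922, 11964305492, 23896073353,
    30614233611, 26902282294, 20486030413, 7653558426, 15307116821,
    9173357312, 17306494496, 1293469792, 2553386176, 5106772352,
    5975902281, 10911617170, 21823234309, 10360472074, 19647202356,
    306656896, 613312800, 185390656, 337226912, 673438016]

/-- The adjacency test of the graph with adjacency matrix `blockCirculantRows`. -/
def blockCirculantAdj (a b : Fin 35) : Bool :=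
  (blockCirculantRows.getD a 0).testBit b

/-- The graph with adjacency matrix `blockCirculantRows`. -/
def blockCirculantGraph : SimpleGraph (Fin 35) where
  Adj a b := blockCirculantAdj a b = true
  symm := ⟨by decide +kernel⟩
  loopless := ⟨by decide +kernel⟩

/-- R(J₄, K₈) ≥ 36: there is a graph on 35 vertices containing no subgraph
isomorphic to `J 4` whose complement contains no clique of size 8. -/
theorem ramsey_J4_K8_ge_36 :
    ∃ G : SimpleGraph (Fin 35), ¬ containsCopy (J 4) G ∧ Gᶜ.CliqueFree 8 := by
  refine ⟨blockCirculantGraph, not_containsCopy_J_four ?_,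
    compl_cliqueFree_of_noIndepSublist (r := blockCirculantAdj) (fun _ _ => Iff.rfl) ?_⟩
  · change ∀ a b, blockCirculantAdj a b = true → ∀ c, blockCirculantAdj a c = true →
      blockCirculantAdj b c = true → ∀ d, blockCirculantAdj a d = true →
      blockCirculantAdj b d = true → c = d
    decide +kernel
  · decide +kernel
end

section
/- R(J₄, J₁₀) ≥ 43. Equivalently: there exists a simple graph on 42 vertices containing no subgraph isomorphic to J₄, whose complement contains no subgraph isomorphic to J₁₀. -/
/-- The adjacency data of the graph: bit `42 * a + b` is set iff `a` and `b` are not adjacent. -/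
def nonAdjTable : ℕ :=
  767086216036984841465467454677150252284575548313434750714703854284819472929228087883295175182757901324000662446108437911850702729218315357684388652674853754996818572112977935434829931288867248895170266665283065795953735762268340166131009870582623380639175374865910433067960450980228352557610723898362153813765939448411321213586127757629379620409640675603360515254261689144247452249867279343877723273059912389853988677996995566615264422803515587200854480394015938425317675360327894684170099439301479305880004422381096626930970508007

/-- The bitmask of the vertices that are not adjacent to `v` (including `v` itself). -/
def nonAdjMask (v : ℕ) : ℕ := nonAdjTable >>> (42 * v)

/-- A block-circulant graph on 42 vertices: six blocks of seven vertices,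
with simultaneous rotation of the blocks as an automorphism. -/
def blockCirculant : SimpleGraph (Fin 42) where
  Adj a b := (nonAdjMask a).testBit b = false
  symm := ⟨by decide +kernel⟩
  loopless := ⟨by decide +kernel⟩

instance : DecidableRel blockCirculant.Adj := fun a b =>
  inferInstanceAs (Decidable ((nonAdjMask a).testBit b = false))

theorem testBit_nonAdjMask {a b : Fin 42} (h : ¬ blockCirculant.Adj a b) :
    (nonAdjMask a).testBit b = true := by
  simpa [blockCirculant] using h

/-- Rotation of each of the six blocks by `k`. -/
def rotate (k : Fin 7) (a : Fin 42) : Fin 42 :=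
  ⟨7 * (a / 7) + (a + k) % 7, by omega⟩

theorem rotate_injective (k : Fin 7) : Function.Injective (rotate k) := by
  intro a b h
  simp only [rotate, Fin.mk.injEq] at h
  omega

theorem adj_rotate : ∀ (k : Fin 7) (a b : Fin 42),
    blockCirculant.Adj (rotate k a) (rotate k b) → blockCirculant.Adj a b := by
  decide +kernel

theorem exists_rotate_mod_eq_zero (a : Fin 42) : ∃ k, (rotate k a : ℕ) % 7 = 0 :=
  ⟨⟨(7 - a % 7) % 7, by omega⟩, by simp only [rotate]; omega⟩

/-- Branching search certifying that the set with bitmask `c` has no subset of size `k` any two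
elements `a`, `b` of which satisfy `(M a).testBit b`. The first argument bounds the depth. -/
def noIndep (M : ℕ → ℕ) : ℕ → ℕ → ℕ → Bool
  | 0, _, _ => false
  | _ + 1, 0, _ => false
  | _ + 1, _ + 1, 0 => true
  | t + 1, k + 1, c + 1 =>
    let v := Nat.log2 (c + 1)
    let d := (c + 1) ^^^ (1 <<< v)
    noIndep M t k (d &&& M v) && noIndep M t (k + 1) d

theorem not_pairwise_of_noIndep {M : ℕ → ℕ} {t k c : ℕ} (h : noIndep M t k c = true)
    {S : Finset ℕ} (hk : S.card = k) (hc : ∀ a ∈ S, c.testBit a = true) :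
    ¬ (S : Set ℕ).Pairwise fun a b => (M a).testBit b = true := by
  fun_induction noIndep M t k c generalizing S with
  | case1 => simp at h
  | case2 => simp at h
  | case3 t k =>
    obtain ⟨a, ha⟩ := Finset.card_pos.1 (hk ▸ k.succ_pos)
    simpa using hc a ha
  | case4 t k c v d ih₁ =>
    rename_i ih₂
    rw [Bool.and_eq_true] at h
    intro hS
    have hd : ∀ a ∈ S, a ≠ v → d.testBit a = true := fun a ha hav => by
      simp [d, Nat.testBit_xor, hc a ha, Nat.one_shiftLeft, hav.symm]
    by_cases hv : v ∈ S
    · refine ih₁ h.1 (S := S.erase v) (by simp [Finset.card_erase_of_mem hv, hk]) ?_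
        (hS.mono (by simp))
      intro a ha
      obtain ⟨hav, ha⟩ := Finset.mem_erase.1 ha
      rw [Nat.testBit_and, hd a ha hav, hS hv ha hav.symm, Bool.and_self]
    · exact ih₂ h.2 hk (fun a ha => hd a ha (by rintro rfl; exact hv ha)) hS

theorem exists_adj_of_noIndep {ι : Type*} {t c : ℕ} (f : ι ↪ Fin 42) (s : Finset ι)
    (h : noIndep nonAdjMask t s.card c = true) (hc : ∀ i ∈ s, c.testBit (f i) = true) :
    ∃ i ∈ s, ∃ j ∈ s, i ≠ j ∧ blockCirculant.Adj (f i) (f j) := by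
  by_contra! hs
  refine not_pairwise_of_noIndep h (S := s.map (f.trans Fin.valEmbedding)) (by simp) ?_ ?_
  · simpa using hc
  · rintro _ ha _ hb hab
    obtain ⟨i, hi, rfl⟩ := Finset.mem_map.1 (Finset.mem_coe.1 ha)
    obtain ⟨j, hj, rfl⟩ := Finset.mem_map.1 (Finset.mem_coe.1 hb)
    exact testBit_nonAdjMask (hs i hi j hj (by rintro rfl; exact hab rfl))

theorem commonNeighbors_subsingleton : ∀ a b : Fin 42, blockCirculant.Adj a b →
    ∀ c, blockCirculant.Adj a c → blockCirculant.Adj b c →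
    ∀ d, blockCirculant.Adj a d → blockCirculant.Adj b d → c = d := by
  decide +kernel

theorem noIndep_ten : noIndep nonAdjMask 43 10 (2 ^ 42 - 1) = true := by
  decide +kernel

theorem noIndep_eight : ∀ a : Fin 42, (a : ℕ) % 7 = 0 → ∀ b : Fin 42, blockCirculant.Adj a b →
    noIndep nonAdjMask 43 8 ((2 ^ 42 - 1) &&& (nonAdjMask a &&& nonAdjMask b)) = true := by
  decide +kernel

theorem J_adj {k : ℕ} {a b : Fin k} (hab : a ≠ b) (hb : 2 ≤ b.val) : (J k).Adj a b := by
  simp only [J, SimpleGraph.fromRel_adj]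
  exact ⟨hab, Or.inl (by omega)⟩

theorem not_containsCopy_J_four_s12 : ¬ containsCopy (J 4) blockCirculant := by
  rintro ⟨f, hf⟩
  have h (i j : Fin 4) (hij : i ≠ j) (hj : 2 ≤ j.val) : blockCirculant.Adj (f i) (f j) :=
    hf (J_adj hij hj)
  have := commonNeighbors_subsingleton _ _ (h 2 3 (by decide) (by decide))
    _ (h 0 2 (by decide) (by decide)).symm (h 0 3 (by decide) (by decide)).symm
    _ (h 1 2 (by decide) (by decide)).symm (h 1 3 (by decide) (by decide)).symm
  exact absurd (f.injective this) (by decide)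

theorem not_containsCopy_J_ten_compl : ¬ containsCopy (J 10) blockCirculantᶜ := by
  rintro ⟨f, hf⟩
  obtain ⟨k, hk⟩ := exists_rotate_mod_eq_zero (f 0)
  let g : Fin 10 ↪ Fin 42 := f.trans ⟨rotate k, rotate_injective k⟩
  have hg (i j : Fin 10) (hij : i ≠ j) (hj : 2 ≤ j.val) : ¬ blockCirculant.Adj (g i) (g j) :=
    fun h => (hf (J_adj hij hj)).2 (adj_rotate k _ _ h)
  have hfull (i : Fin 10) : (2 ^ 42 - 1 : ℕ).testBit (g i) = true := by
    rw [Nat.testBit_two_pow_sub_one]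
    simp
  by_cases h01 : blockCirculant.Adj (g 0) (g 1)
  · obtain ⟨i, -, j, hj, hij, h⟩ := exists_adj_of_noIndep g {i | 2 ≤ i.val}
      (noIndep_eight (g 0) hk (g 1) h01) (fun i hi => by
        have hi : 2 ≤ i.val := by simpa using hi
        rw [Nat.testBit_and, Nat.testBit_and, hfull,
          testBit_nonAdjMask (hg 0 i (by rintro rfl; simp at hi) hi),
          testBit_nonAdjMask (hg 1 i (by rintro rfl; simp at hi) hi)]
        rfl)
    exact hg i j hij (by simpa using hj) h
  · obtain ⟨i, -, j, -, hij, h⟩ :=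
      exists_adj_of_noIndep g Finset.univ noIndep_ten fun i _ => hfull i
    by_cases hj : 2 ≤ j.val
    · exact hg i j hij hj h
    by_cases hi : 2 ≤ i.val
    · exact hg j i hij.symm hi h.symm
    obtain ⟨rfl, rfl⟩ | ⟨rfl, rfl⟩ : i = 0 ∧ j = 1 ∨ i = 1 ∧ j = 0 := by omega
    · exact h01 h
    · exact h01 h.symm

/-- R(J₄, J₁₀) ≥ 43. -/
theorem ramsey_J4_J10_ge_43 :
    ∃ G : SimpleGraph (Fin 42), ¬ containsCopy (J 4) G ∧ ¬ containsCopy (J 10) Gᶜ :=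
  ⟨blockCirculant, not_containsCopy_J_four_s12, not_containsCopy_J_ten_compl⟩
end

section
/- R(J₅, K₆) ≥ 43. Equivalently: there exists a simple graph on 42 vertices containing no subgraph isomorphic to J₅, whose complement contains no clique of size 6. -/
/-- Bit `42 * i + j` of this number records the adjacency of the vertices `i` and `j`
of `ramseyGraph`. -/
def adjacencyCode : ℕ :=
  243596170079088824075666825323364660376615948549114980867445220363603100716776982245749410257618640665810542230744656707854442395852161258119502525901994147497936030637698032936008722664010713846215988478634793401045263521602076992769275732204235625012298839920977165340421436743992555879290551082677462936717649470584586356364112654300304246065571236558754149994045957565566625761605893091309653260533751826626113868784794655476478196388977978708266202658349885154878920837519669627832795014084662604922309242545998980968390650696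

/-- Adjacency in `ramseyGraph`, as a Boolean function. -/
def adjacent (i j : Fin 42) : Bool := adjacencyCode.testBit (42 * i.val + j.val)

/-- A graph on 42 vertices with no `J 5` and no independent set of size 6. It has an automorphism
of order 6, which acts on the first 36 vertices as six 6-cycles and on the last 6 as three
transpositions. -/
def ramseyGraph : SimpleGraph (Fin 42) where
  Adj i j := adjacent i j = true
  symm := ⟨by decide +kernel⟩
  loopless := ⟨by decide +kernel⟩

/-- `p a l'` holds for every suffix `a :: l'` of the list. -/
def allSuffixes {α : Type*} (p : α → List α → Bool) : List α → Bool
  | [] => true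
  | a :: l => p a l && allSuffixes p l

/-- Exhaustive search certifying that a list has no sublist of length `k` whose members are
pairwise related by `r`. -/
def noPairwiseSublist {α : Type*} (r : α → α → Bool) : ℕ → List α → Bool
  | 0, _ => false
  | k + 1, l => allSuffixes (fun a l' => noPairwiseSublist r k (l'.filter (r a))) l

theorem allSuffixes_of_append {α : Type*} {p : α → List α → Bool} (l₁ : List α) {a : α}
    {l₂ : List α} (h : allSuffixes p (l₁ ++ a :: l₂) = true) : p a l₂ = true := by
  induction l₁ with
  | nil => simp_all [allSuffixes]
  | cons b l ih => simp_all [allSuffixes]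

theorem not_pairwise_of_noPairwiseSublist {α : Type*} {r : α → α → Bool} {k : ℕ}
    {l s : List α} (h : noPairwiseSublist r k l = true) (hs : s.Sublist l) (hk : s.length = k) :
    ¬ s.Pairwise (fun a b => r a b = true) := by
  induction k generalizing l s with
  | zero => simp [noPairwiseSublist] at h
  | succ k ih =>
    cases s with
    | nil => simp at hk
    | cons a s =>
      rw [List.pairwise_cons]
      rintro ⟨ha, hp⟩
      obtain ⟨l₁, l₂, rfl, ha₁, hs₂⟩ := List.cons_sublist_iff.1 hs
      obtain ⟨l₃, l₄, rfl⟩ := List.append_of_mem ha₁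
      rw [List.append_assoc, List.cons_append] at h
      refine ih (allSuffixes_of_append l₃ h) ?_ (by simpa using hk) hp
      rw [← List.filter_eq_self.2 ha]
      exact (hs₂.trans (List.sublist_append_right _ _)).filter _

theorem SimpleGraph.cliqueFree_of_noPairwiseSublist {n k : ℕ} {G : SimpleGraph (Fin n)}
    {r : Fin n → Fin n → Bool} (hr : ∀ a b, G.Adj a b → r a b = true)
    (h : noPairwiseSublist r k (List.finRange n) = true) : G.CliqueFree k := by
  intro s hs
  refine not_pairwise_of_noPairwiseSublist h
    (List.filter_sublist (p := fun a => decide (a ∈ s))) ?_ ?_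
  · rw [← hs.card_eq, ← List.toFinset_card_of_nodup ((List.nodup_finRange n).filter _)]
    congr 1
    ext a
    simp
  · refine ((List.nodup_finRange n).filter _).imp_of_mem ?_
    intro a b ha hb hab
    simp only [List.mem_filter, decide_eq_true_eq] at ha hb
    exact hr a b (hs.isClique ha.2 hb.2 hab)

theorem ramseyGraph_compl_cliqueFree : ramseyGraphᶜ.CliqueFree 6 := by
  refine SimpleGraph.cliqueFree_of_noPairwiseSublist (r := fun a b => !adjacent a b) ?_
    (by decide +kernel)
  intro a b h
  simpa [ramseyGraph] using ((SimpleGraph.compl_adj _ _ _).1 h).2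

theorem List.eq_of_mem_of_length_le_one {α : Type*} {l : List α} (h : l.length ≤ 1) {a b : α}
    (ha : a ∈ l) (hb : b ∈ l) : a = b := by
  obtain ⟨c, hc⟩ | rfl := (Nat.le_one_iff_eq_zero_or_eq_one.1 h).symm.imp
    List.length_eq_one_iff.1 List.length_eq_zero_iff.1
  · simp_all
  · simp at ha

/-- For all pairwise related `a`, `b`, `c` in the list, at most one member of the list is related
to all three. -/
def triplesHaveAtMostOneCommon {α : Type*} (r : α → α → Bool) (l : List α) : Bool :=
  l.all fun a => (l.filter (r a)).all fun b => ((l.filter (r a)).filter (r b)).all fun c =>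
    (((l.filter (r a)).filter (r b)).filter (r c)).length.ble 1

/-- In `ramseyGraph` the vertices of a triangle have at most one common neighbour. -/
theorem ramseyGraph_common_neighbour_unique :
    ∀ a b, ramseyGraph.Adj a b → ∀ c, ramseyGraph.Adj a c → ramseyGraph.Adj b c →
      ∀ d, ramseyGraph.Adj a d → ramseyGraph.Adj b d → ramseyGraph.Adj c d →
        ∀ e, ramseyGraph.Adj a e → ramseyGraph.Adj b e → ramseyGraph.Adj c e → d = e := by
  have h : triplesHaveAtMostOneCommon adjacent (List.finRange 42) = true := by decide +kernel
  simp only [triplesHaveAtMostOneCommon, List.all_eq_true, List.mem_filter, List.mem_finRange,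
    true_and, forall_const, Nat.ble_eq, and_imp] at h
  intro a b hab c hac hbc d had hbd hcd e hae hbe hce
  refine List.eq_of_mem_of_length_le_one (h a b hab c hac hbc) ?_ ?_ <;>
    simp only [List.mem_filter, List.mem_finRange, true_and]
  · exact ⟨⟨had, hbd⟩, hcd⟩
  · exact ⟨⟨hae, hbe⟩, hce⟩

theorem not_containsCopy_J_five {V : Type*} {G : SimpleGraph V}
    (h : ∀ a b, G.Adj a b → ∀ c, G.Adj a c → G.Adj b c →
      ∀ d, G.Adj a d → G.Adj b d → G.Adj c d →
        ∀ e, G.Adj a e → G.Adj b e → G.Adj c e → d = e) :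
    ¬ containsCopy (J 5) G := by
  rintro ⟨f, hf⟩
  have hJ : ∀ i j : Fin 5, i ≠ j → 2 ≤ i.val → G.Adj (f i) (f j) := by
    intro i j hij hi
    refine hf ((SimpleGraph.fromRel_adj _ _ _).2 ⟨hij, Or.inl ⟨?_, ?_⟩⟩) <;> omega
  have h01 : f 0 = f 1 := by
    apply h (f 2) (f 3) _ (f 4) <;> exact hJ _ _ (by decide) (by decide)
  exact absurd (f.injective h01) (by decide)

/-- R(J₅, K₆) ≥ 43: there is a graph on 42 vertices containing no subgraph
isomorphic to `J 5` whose complement contains no clique of size 6. -/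
theorem ramsey_J5_K6_ge_43 :
    ∃ G : SimpleGraph (Fin 42), ¬ containsCopy (J 5) G ∧ Gᶜ.CliqueFree 6 := by
  exact ⟨ramseyGraph, not_containsCopy_J_five ramseyGraph_common_neighbour_unique,
    ramseyGraph_compl_cliqueFree⟩
end

section
/- R(K_{3,4}, K_{3,4}) = 25. That is: every simple graph on 25 vertices contains a subgraph isomorphic to the complete bipartite graph K_{3,4} or its complement contains a subgraph isomorphic to K_{3,4}, and there exists a simple graph on 24 vertices containing no subgraph isomorphic to K_{3,4} whose complement contains no subgraph isomorphic to K_{3,4}. -/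
namespace RamseyK34

open Finset

/-! ### Arithmetic written for evaluation by the kernel -/

def nsum (n : ℕ) (f : ℕ → ℕ) : ℕ :=
  Nat.rec (nat_lit 0) (fun k s => Nat.add s (f k)) n

def nall (n : ℕ) (f : ℕ → Bool) : Bool :=
  Nat.rec true (fun k s => cond (f k) s false) n

def lsum {α : Type} (l : List α) (f : α → ℕ) : ℕ :=
  List.rec (nat_lit 0) (fun a _ s => Nat.add (f a) s) l

def lall {α : Type} (l : List α) (f : α → Bool) : Bool :=
  List.rec true (fun a _ s => cond (f a) s false) l

def lany {α : Type} (l : List α) (f : α → Bool) : Bool :=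
  List.rec false (fun a _ s => cond (f a) true s) l

def lget (l : List ℕ) : ℕ → ℕ :=
  List.rec (fun _ => nat_lit 0) (fun a _ ih i => Nat.rec a (fun k _ => ih k) i) l

def bit (c k : ℕ) : Bool :=
  Nat.beq (Nat.land (nat_lit 1) (Nat.shiftRight c k)) (nat_lit 1)

def digit (w N i : ℕ) : ℕ :=
  Nat.mod (Nat.shiftRight N (Nat.mul w i)) (Nat.pow (nat_lit 2) w)

def beqBool (a b : Bool) : Bool := cond a b (cond b false true)

/-- `f n`, arranged so that the kernel evaluates `n` first. -/
def force {α : Type} (n : ℕ) (f : ℕ → α) : α :=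
  Nat.rec (f (nat_lit 0)) (fun k _ => f (Nat.succ k)) n

theorem force_eq {α : Type} (n : ℕ) (f : ℕ → α) : force n f = f n := by
  cases n <;> rfl

theorem nsum_eq (n : ℕ) (f : ℕ → ℕ) : nsum n f = ∑ i ∈ range n, f i := by
  induction n with
  | zero => rfl
  | succ n ih => rw [sum_range_succ, ← ih]; rfl

theorem nall_eq_true {n : ℕ} {f : ℕ → Bool} : nall n f = true ↔ ∀ i < n, f i = true := by
  induction n with
  | zero => simp [nall]
  | succ n ih =>
    have : nall (n + 1) f = cond (f n) (nall n f) false := rfl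
    rw [this, Nat.forall_lt_succ_right, ← ih]
    cases f n <;> simp

theorem lall_eq_true {α : Type} {l : List α} {f : α → Bool} :
    lall l f = true ↔ ∀ a ∈ l, f a = true := by
  induction l with
  | nil => simp [lall]
  | cons a l ih =>
    have : lall (a :: l) f = cond (f a) (lall l f) false := rfl
    rw [this, List.forall_mem_cons, ← ih]
    cases f a <;> simp

theorem lany_eq_true {α : Type} {l : List α} {f : α → Bool} :
    lany l f = true ↔ ∃ a ∈ l, f a = true := by
  induction l with
  | nil => simp [lany]
  | cons a l ih =>
    have : lany (a :: l) f = cond (f a) true (lany l f) := rfl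
    rw [this, List.exists_mem_cons_iff, ← ih]
    cases f a <;> simp

theorem lsum_cons {α : Type} (a : α) (l : List α) (f : α → ℕ) :
    lsum (a :: l) f = f a + lsum l f := rfl

theorem bit_eq (c k : ℕ) : bit c k = c.testBit k := by
  have h : Nat.land 1 (c >>> k) = (c >>> k) % 2 := Nat.one_and_eq_mod_two _
  have h' : (1 &&& c >>> k) = (c >>> k) % 2 := Nat.one_and_eq_mod_two _
  change Nat.beq (Nat.land 1 (c >>> k)) 1 = (1 &&& c >>> k != 0)
  rw [h, h']
  rcases Nat.mod_two_eq_zero_or_one (c >>> k) with h | h <;> rw [h] <;> rfl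

theorem digit_eq (w N i : ℕ) : digit w N i = N / (2 ^ w) ^ i % 2 ^ w := by
  change (N >>> (w * i)) % 2 ^ w = _
  rw [Nat.shiftRight_eq_div_pow, pow_mul]

theorem digit_lt (w N i : ℕ) : digit w N i < 2 ^ w := by
  rw [digit_eq]; exact Nat.mod_lt _ (by positivity)

theorem beqBool_eq_true {a b : Bool} : beqBool a b = true ↔ a = b := by
  cases a <;> cases b <;> simp [beqBool]

/-! ### Coloured patterns -/

/-- The pair `{i, j}` of the graph whose edges `i < j` are the bits `j (j - 1) / 2 + i` of `c`. -/
def pairBit (c i j : ℕ) : Bool :=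
  cond (Nat.blt i j) (bit c (Nat.add (Nat.div (Nat.mul j (Nat.sub j (nat_lit 1))) (nat_lit 2)) i))
    (bit c (Nat.add (Nat.div (Nat.mul i (Nat.sub i (nat_lit 1))) (nat_lit 2)) j))

/-- Add a vertex `n` to `g`, joined to the earlier vertices according to the bits of `P`. -/
def extend (n : ℕ) (g : ℕ → ℕ → Bool) (P i j : ℕ) : Bool :=
  cond (Nat.beq j n) (bit P i) (cond (Nat.beq i n) (bit P j) (g i j))

def Symmetric (g : ℕ → ℕ → Bool) : Prop := ∀ i j, i ≠ j → g i j = g j i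

theorem symmetric_pairBit (c : ℕ) : Symmetric (pairBit c) := by
  intro i j hij
  unfold pairBit
  rcases lt_or_gt_of_ne hij with h | h
  · have h1 : Nat.blt i j = true := by simpa using h
    have h2 : Nat.blt j i = false := by
      rw [Bool.eq_false_iff]; simpa using h.le
    rw [h1, h2]; rfl
  · have h1 : Nat.blt j i = true := by simpa using h
    have h2 : Nat.blt i j = false := by
      rw [Bool.eq_false_iff]; simpa using h.le
    rw [h1, h2]; rfl

theorem extend_last {n : ℕ} (g : ℕ → ℕ → Bool) (P i : ℕ) :
    extend n g P i n = P.testBit i := by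
  simp [extend, bit_eq]

theorem extend_of_lt {n i j : ℕ} (g : ℕ → ℕ → Bool) (P : ℕ) (hi : i < n) (hj : j < n) :
    extend n g P i j = g i j := by
  have h1 : Nat.beq j n = false := by simpa [Bool.eq_false_iff] using hj.ne
  have h2 : Nat.beq i n = false := by simpa [Bool.eq_false_iff] using hi.ne
  simp [extend, h1, h2]

theorem Symmetric.extend {g : ℕ → ℕ → Bool} (hg : Symmetric g) (n P : ℕ) :
    Symmetric (extend n g P) := by
  intro i j hij
  unfold RamseyK34.extend
  by_cases hj : j = n
  · subst hj
    have h1 : Nat.beq i j = false := by simpa [Bool.eq_false_iff] using hij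
    simp [h1]
  · have h1 : Nat.beq j n = false := by simpa [Bool.eq_false_iff] using hj
    by_cases hi : i = n
    · subst hi; simp [h1]
    · have h2 : Nat.beq i n = false := by simpa [Bool.eq_false_iff] using hi
      simp [h1, h2, hg i j hij]

/-- `g'` is `g` with its vertices renamed by `σ` and, if `b` is set, its colours exchanged. -/
structure Renames (n : ℕ) (σ : ℕ → ℕ) (b : Bool) (g g' : ℕ → ℕ → Bool) : Prop where
  lt : ∀ i < n, σ i < n
  pair : ∀ i < n, ∀ j < i, σ j ≠ σ i ∧ g' j i = (b ^^ g (σ j) (σ i))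

theorem Renames.ne {n : ℕ} {σ : ℕ → ℕ} {b : Bool} {g g' : ℕ → ℕ → Bool}
    (h : Renames n σ b g g') {i j : ℕ} (hi : i < n) (hj : j < n) (hij : i ≠ j) : σ i ≠ σ j := by
  rcases lt_or_gt_of_ne hij with h' | h'
  · exact (h.pair j hj i h').1
  · exact (h.pair i hi j h').1.symm

theorem Renames.eq {n : ℕ} {σ : ℕ → ℕ} {b : Bool} {g g' : ℕ → ℕ → Bool}
    (h : Renames n σ b g g') (hg : Symmetric g) (hg' : Symmetric g') {i j : ℕ}
    (hi : i < n) (hj : j < n) (hij : i ≠ j) : g' i j = (b ^^ g (σ i) (σ j)) := by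
  rcases lt_or_gt_of_ne hij with h' | h'
  · exact (h.pair j hj i h').2
  · rw [hg' i j hij, hg _ _ (h.ne hi hj hij)]
    exact (h.pair i hi j h').2

theorem Renames.extend {n : ℕ} {σ : ℕ → ℕ} {b : Bool} {g g' : ℕ → ℕ → Bool}
    (h : Renames n σ b g g') {P P' : ℕ}
    (hP : ∀ i < n, P'.testBit i = (b ^^ P.testBit (σ i))) :
    Renames (n + 1) (fun i => if i = n then n else σ i) b
      (extend n g P) (extend n g' P') := by
  constructor
  · intro i hi
    show (if i = n then n else σ i) < n + 1
    split_ifs with h1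
    · omega
    · exact (h.lt i (by omega)).trans (by omega)
  · intro i hi j hj
    have hj' : j ≠ n := by omega
    have hjn : j < n := by omega
    have := h.lt j hjn
    by_cases h1 : i = n
    · subst h1
      simp only [hj', if_true, if_false, extend_last]
      exact ⟨this.ne, hP j hjn⟩
    · have hin : i < n := by omega
      simp only [h1, hj', if_false]
      rw [extend_of_lt _ _ hjn hin, extend_of_lt _ _ this (h.lt i hin)]
      exact h.pair i hin j hj

def renameCheck (n : ℕ) (σ : ℕ → ℕ) (b : Bool) (g g' : ℕ → ℕ → Bool) : Bool :=
  nall n fun i => force (σ i) fun s => cond (Nat.blt s n)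
    (nall i fun j => force (σ j) fun t => cond (Nat.beq t s) false
      (beqBool (g' j i) (cond b (not (g t s)) (g t s)))) false

theorem renames_of_check {n : ℕ} {σ : ℕ → ℕ} {b : Bool} {g g' : ℕ → ℕ → Bool}
    (h : renameCheck n σ b g g' = true) : Renames n σ b g g' := by
  simp only [renameCheck, force_eq] at h
  have h : ∀ i < n, Nat.blt (σ i) n = true ∧ ∀ j < i, Nat.beq (σ j) (σ i) = false ∧
      beqBool (g' j i) (cond b (not (g (σ j) (σ i))) (g (σ j) (σ i))) = true := by
    intro i hi
    have h1 := nall_eq_true.1 h i hi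
    cases h2 : Nat.blt (σ i) n <;> simp only [h2, cond_true, cond_false] at h1
    · simp at h1
    refine ⟨rfl, fun j hj => ?_⟩
    have h3 := nall_eq_true.1 h1 j hj
    cases h4 : Nat.beq (σ j) (σ i) <;> simp only [h4, cond_true, cond_false] at h3
    · exact ⟨rfl, h3⟩
    · simp at h3
  refine ⟨fun i hi => by simpa using (h i hi).1, fun i hi j hj => ?_⟩
  obtain ⟨h1, h2⟩ := (h i hi).2 j hj
  refine ⟨by simpa [Bool.eq_false_iff] using h1, ?_⟩
  rw [beqBool_eq_true.1 h2]
  cases b <;> simp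

/-! ### Counting copies -/

section Copies

variable {V : Type}

/-- `x` is a copy of the pattern `g` on `n` vertices in the colouring `e`. -/
structure IsCopy (e : V → V → Bool) (n : ℕ) (g : ℕ → ℕ → Bool) (x : Fin n → V) : Prop where
  injective : Function.Injective x
  eq : ∀ i j : Fin n, i ≠ j → e (x i) (x j) = g i j

/-- The colours of the pairs formed by `u` and the vertices of `x`, as bits. -/
def profile (e : V → V → Bool) {n : ℕ} (x : Fin n → V) (u : V) : ℕ :=
  Nat.ofBits fun i => e (x i) u

theorem isCopy_snoc {e : V → V → Bool} (he : ∀ u v, e u v = e v u) {n : ℕ}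
    {g : ℕ → ℕ → Bool} {P : ℕ} (hP : P < 2 ^ n) {x : Fin n → V} {u : V} :
    IsCopy e (n + 1) (extend n g P) (Fin.snoc x u : Fin (n + 1) → V) ↔
      IsCopy e n g x ∧ u ∉ Set.range x ∧ profile e x u = P := by
  constructor
  · intro h
    obtain ⟨h1, h2⟩ := Fin.snoc_injective_iff.1 h.injective
    refine ⟨⟨h1, fun i j hij => ?_⟩, h2, ?_⟩
    · have := h.eq i.castSucc j.castSucc (by simpa using hij)
      simpa [extend_of_lt g P i.2 j.2] using this
    · refine Nat.eq_of_testBit_eq fun i => ?_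
      by_cases hi : i < n
      · have := h.eq (Fin.castSucc ⟨i, hi⟩) (Fin.last n) (Fin.castSucc_lt_last _).ne
        simp only [Fin.snoc_castSucc, Fin.snoc_last, Fin.val_castSucc, Fin.val_last,
          extend_last] at this
        rw [profile, Nat.testBit_ofBits_lt _ _ hi, this]
      · have hn : n ≤ i := not_lt.1 hi
        rw [profile, Nat.testBit_ofBits_ge _ _ hn, Nat.testBit_lt_two_pow]
        exact hP.trans_le (Nat.pow_le_pow_right two_pos hn)
  · rintro ⟨h1, h2, rfl⟩
    refine ⟨Fin.snoc_injective_iff.2 ⟨h1.injective, h2⟩, ?_⟩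
    have key : ∀ i : Fin n, e (x i) u = extend n g (profile e x u) i n := fun i => by
      rw [extend_last, profile, Nat.testBit_ofBits_lt _ _ i.2]
    intro i j
    induction i using Fin.lastCases with
    | last =>
      induction j using Fin.lastCases with
      | last => simp
      | cast j =>
        intro _
        rw [Fin.snoc_castSucc, Fin.snoc_last, he, key]
        have hj : Nat.beq j n = false := by simpa [Bool.eq_false_iff] using j.2.ne
        simp [extend, hj]
    | cast i =>
      induction j using Fin.lastCases with
      | last => intro _; rw [Fin.snoc_castSucc, Fin.snoc_last, key]; rfl
      | cast j =>
        intro hij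
        rw [Fin.snoc_castSucc, Fin.snoc_castSucc, h1.eq i j (by simpa using hij)]
        exact (extend_of_lt g _ i.2 j.2).symm

theorem profile_snoc_mod (e : V → V → Bool) {n : ℕ} (x : Fin n → V) (u v : V) :
    profile e (Fin.snoc x u : Fin (n + 1) → V) v % 2 ^ n = profile e x v := by
  refine Nat.eq_of_testBit_eq fun i => ?_
  rw [Nat.testBit_mod_two_pow]
  by_cases hi : i < n
  · rw [profile, profile, Nat.testBit_ofBits_lt _ _ hi, Nat.testBit_ofBits_lt _ _ (by omega)]
    simp only [hi, decide_true, Bool.true_and]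
    exact congrArg (fun a => e a v) (Fin.snoc_castSucc (α := fun _ => V) u x ⟨i, hi⟩)
  · rw [profile, profile, Nat.testBit_ofBits_ge _ _ (not_lt.1 hi)]
    simp [hi]

variable [Fintype V]

open Classical in
noncomputable def copies (e : V → V → Bool) (n : ℕ) (g : ℕ → ℕ → Bool) : Finset (Fin n → V) :=
  {x | IsCopy e n g x}

open Classical in
noncomputable def outside {n : ℕ} (x : Fin n → V) : Finset V := {u | u ∉ Set.range x}

theorem mem_outside {n : ℕ} {x : Fin n → V} {u : V} : u ∈ outside x ↔ u ∉ Set.range x := by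
  simp [outside]

theorem mem_copies {e : V → V → Bool} {n : ℕ} {g : ℕ → ℕ → Bool} {x : Fin n → V} :
    x ∈ copies e n g ↔ IsCopy e n g x := by
  simp [copies]

/-- The copies of `g` in the colouring and in the opposite colouring. -/
noncomputable def total (e : V → V → Bool) (n : ℕ) (g : ℕ → ℕ → Bool) : ℕ :=
  (copies e n g).card + (copies (fun a b => !e a b) n g).card

theorem Renames.card_copies {n : ℕ} {σ : ℕ → ℕ} {b : Bool} {g g' : ℕ → ℕ → Bool}
    (h : Renames n σ b g g') (hg : Symmetric g) (hg' : Symmetric g') (e : V → V → Bool) :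
    (copies (fun u v => (b ^^ e u v)) n g).card = (copies e n g').card := by
  let τ : Fin n → Fin n := fun i => ⟨σ i, h.lt i i.2⟩
  have hτ : Function.Injective τ := by
    intro i j hij
    by_contra hne
    exact h.ne i.2 j.2 (Fin.val_ne_of_ne hne) (Fin.mk.inj_iff.1 hij)
  let E : Equiv.Perm (Fin n) := Equiv.ofBijective τ (Finite.injective_iff_bijective.1 hτ)
  refine Finset.card_equiv (Equiv.arrowCongr E.symm (Equiv.refl V)) fun z => ?_
  have hE : (Equiv.arrowCongr E.symm (Equiv.refl V)) z = z ∘ τ := by ext i; rfl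
  rw [hE, mem_copies, mem_copies]
  constructor
  · intro hz
    refine ⟨hz.injective.comp hτ, fun i j hij => ?_⟩
    have h1 := hz.eq (τ i) (τ j) (hτ.ne hij)
    have h2 := h.eq hg hg' i.2 j.2 (Fin.val_ne_of_ne hij)
    rw [h2, Function.comp, Function.comp]
    change _ = (b ^^ g (τ i) (τ j))
    rw [← h1]; cases b <;> simp
  · intro hz
    have hz' : Function.Injective z := by
      have := hz.injective.comp E.symm.injective
      convert this using 1
      ext i
      exact congrArg z (E.apply_symm_apply i).symm
    refine ⟨hz', fun i j hij => ?_⟩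
    obtain ⟨i, rfl⟩ := E.surjective i
    obtain ⟨j, rfl⟩ := E.surjective j
    have hij' : i ≠ j := fun h => hij (h ▸ rfl)
    have h1 := hz.eq i j hij'
    have h2 := h.eq hg hg' i.2 j.2 (Fin.val_ne_of_ne hij')
    change (b ^^ e (z (τ i)) (z (τ j))) = g (σ i) (σ j)
    change e (z (τ i)) (z (τ j)) = g' i j at h1
    rw [h1, h2]; cases b <;> simp

theorem Renames.total {n : ℕ} {σ : ℕ → ℕ} {b : Bool} {g g' : ℕ → ℕ → Bool}
    (h : Renames n σ b g g') (hg : Symmetric g) (hg' : Symmetric g') (e : V → V → Bool) :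
    total e n g = total e n g' := by
  have h1 := h.card_copies hg hg' e
  have h2 := h.card_copies hg hg' (fun a b => !e a b)
  unfold RamseyK34.total
  rw [← h1, ← h2]
  cases b
  · simp
  · simp [add_comm]

open Classical in
theorem sum_copies_extend {e : V → V → Bool} (he : ∀ u v, e u v = e v u) (n : ℕ)
    (g : ℕ → ℕ → Bool) (f : ℕ → (Fin (n + 1) → V) → ℤ) :
    ∑ P ∈ range (2 ^ n), ∑ z ∈ copies e (n + 1) (extend n g P), f P z =
      ∑ x ∈ copies e n g, ∑ u ∈ outside x, f (profile e x u) (Fin.snoc x u) := by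
  calc
    _ = ∑ P ∈ range (2 ^ n), ∑ x : Fin n → V, ∑ u : V,
        if IsCopy e n g x ∧ u ∉ Set.range x ∧ profile e x u = P then
          f P (Fin.snoc x u) else 0 := by
      refine sum_congr rfl fun P hP => ?_
      rw [copies, sum_filter, ← (Fin.snocEquiv fun _ => V).sum_comp, Fintype.sum_prod_type_right]
      refine sum_congr rfl fun x _ => sum_congr rfl fun u _ => ?_
      exact if_congr (isCopy_snoc he (mem_range.1 hP)) rfl rfl
    _ = ∑ x : Fin n → V, ∑ u : V, ∑ P ∈ range (2 ^ n),
        if IsCopy e n g x ∧ u ∉ Set.range x ∧ profile e x u = P then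
          f P (Fin.snoc x u) else 0 := by
      rw [sum_comm]
      exact sum_congr rfl fun x _ => sum_comm
    _ = _ := by
      rw [copies, sum_filter]
      refine sum_congr rfl fun x _ => ?_
      by_cases hx : IsCopy e n g x
      · rw [if_pos hx, outside, sum_filter]
        refine sum_congr rfl fun u _ => ?_
        by_cases hu : u ∉ Set.range x
        · simp only [hx, hu, true_and, not_false_eq_true, if_true]
          rw [sum_ite_eq, if_pos (mem_range.2 (by exact Nat.ofBits_lt_two_pow _))]
        · simp only [hu, false_and, and_false, if_false, sum_const_zero]
      · simp [hx]

open Classical in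
theorem card_outside (hV : Fintype.card V = 25) {e : V → V → Bool} {g : ℕ → ℕ → Bool}
    {x : Fin 5 → V} (hx : IsCopy e 5 g x) : (outside x).card = 20 := by
  have : outside x = (univ.image x)ᶜ := by ext; simp [mem_outside]
  rw [this, card_compl, card_image_of_injective _ hx.injective, hV]
  rfl

open Classical in
/-- A quadratic form in the profiles over five roots, as a combination of counts of copies. -/
theorem sum_card_copies (hV : Fintype.card V = 25) {e : V → V → Bool} (he : ∀ u v, e u v = e v u)
    (g : ℕ → ℕ → Bool) (Q : ℕ → ℕ → ℤ) :
    ∑ p ∈ range 32, ∑ P ∈ range 64, (19 * Q p (P % 32) + Q p p) *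
        ((copies e 7 (extend 6 (extend 5 g p) P)).card : ℤ) =
      19 * ∑ x ∈ copies e 5 g, ∑ u ∈ outside x, ∑ v ∈ outside x,
        Q (profile e x u) (profile e x v) := by
  have h1 : ∀ p, ∑ P ∈ range 64, (19 * Q p (P % 32) + Q p p) *
      ((copies e 7 (extend 6 (extend 5 g p) P)).card : ℤ) =
      ∑ z ∈ copies e 6 (extend 5 g p), ∑ v ∈ outside z,
        (19 * Q p (profile e z v % 32) + Q p p) := by
    intro p
    rw [← sum_copies_extend he 6 (extend 5 g p) fun P _ => 19 * Q p (P % 32) + Q p p]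
    exact sum_congr rfl fun P _ => by rw [sum_const, nsmul_eq_mul, mul_comm]
  rw [sum_congr rfl fun p _ => h1 p]
  refine (sum_copies_extend he 5 g fun p z => ∑ v ∈ outside z,
      (19 * Q p (profile e z v % 32) + Q p p)).trans ?_
  rw [mul_sum]
  refine sum_congr rfl fun x hx => ?_
  have hx := mem_copies.1 hx
  rw [mul_sum]
  refine sum_congr rfl fun u hu => ?_
  have hset : outside (Fin.snoc x u : Fin 6 → V) =
      (outside x).erase u := by
    ext v
    rw [mem_erase, mem_outside, mem_outside, Fin.range_snoc]
    simp
  have hsum : ∀ v, 19 * Q (profile e x u) (profile e (Fin.snoc x u : Fin 6 → V) v % 32) =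
      19 * Q (profile e x u) (profile e x v) := fun v => by
    rw [← profile_snoc_mod e x u v]; rfl
  rw [hset, sum_add_distrib, sum_const, card_erase_of_mem hu, card_outside hV hx,
    sum_congr rfl fun v _ => hsum v, ← mul_sum, ← sum_erase_add _ _ hu]
  simp only [nsmul_eq_mul]; push_cast; ring

end Copies

/-! ### Certificates of nonnegativity -/

/-- A triple of roots with a colour, and how many more common neighbours it may have. -/
structure Cut where
  i : ℕ
  j : ℕ
  k : ℕ
  color : Bool
  slack : ℕ

/-- A quadratic form in profiles over the five roots of the pattern `pairBit code`: a sum of squares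
and of products of nonnegative linear forms. `classes` lists the representatives of the patterns
on six vertices that extend `pairBit code`. -/
structure Cert where
  code : ℕ
  classes : ℕ
  squares : List ℕ
  products : List (Cut × List (ℕ × Cut) × List (ℕ × ℕ))

def Cut.hit (c : Cut) (p x : ℕ) : ℕ :=
  cond (beqBool (bit p c.i) c.color)
    (cond (beqBool (bit p c.j) c.color)
      (cond (beqBool (bit p c.k) c.color) x (nat_lit 0)) (nat_lit 0)) (nat_lit 0)

def multPos (l : List (ℕ × Cut)) (m : List (ℕ × ℕ)) (q : ℕ) : ℕ :=
  Nat.add (lsum l fun a => Nat.mul a.1 a.2.slack)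
    (lsum m fun a => cond (Nat.beq q a.2) a.1 (nat_lit 0))

def multNeg (l : List (ℕ × Cut)) (q : ℕ) : ℕ :=
  lsum l fun a => a.2.hit q (Nat.mul (nat_lit 20) a.1)

def squareWeight (v p : ℕ) : ℕ := digit (nat_lit 17) v p

def Cert.formPos (F : Cert) (p q : ℕ) : ℕ :=
  Nat.add
    (lsum F.squares fun v =>
      Nat.add (Nat.mul (squareWeight v p) (squareWeight v q)) (nat_lit 4294967296))
    (lsum F.products fun a =>
      Nat.add (Nat.mul a.1.slack (multPos a.2.1 a.2.2 q))
        (a.1.hit p (Nat.mul (nat_lit 20) (multNeg a.2.1 q))))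

def Cert.formNeg (F : Cert) (p q : ℕ) : ℕ :=
  Nat.add
    (lsum F.squares fun v =>
      Nat.mul (nat_lit 65536) (Nat.add (squareWeight v p) (squareWeight v q)))
    (lsum F.products fun a =>
      Nat.add (Nat.mul a.1.slack (multNeg a.2.1 q))
        (a.1.hit p (Nat.mul (nat_lit 20) (multPos a.2.1 a.2.2 q))))

/-- The quadratic form of a certificate. -/
def Cert.form (F : Cert) (p q : ℕ) : ℤ := F.formPos p q - F.formNeg p q

def Cut.weight (c : Cut) (p : ℕ) : ℤ := c.slack - c.hit p 20

def multiplier (l : List (ℕ × Cut)) (m : List (ℕ × ℕ)) (q : ℕ) : ℤ :=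
  (l.map fun a => (a.1 : ℤ) * a.2.weight q).sum +
    (m.map fun a => if q = a.2 then (a.1 : ℤ) else 0).sum

theorem lsum_eq {α : Type} (l : List α) (f : α → ℕ) :
    (lsum l f : ℤ) = (l.map fun a => (f a : ℤ)).sum := by
  induction l with
  | nil => rfl
  | cons a l ih => rw [lsum_cons, List.map_cons, List.sum_cons, ← ih]; push_cast; rfl

theorem lsum_sub_lsum {α : Type} (l : List α) (f g : α → ℕ) :
    (lsum l f : ℤ) - lsum l g = (l.map fun a => (f a : ℤ) - g a).sum := by
  induction l with
  | nil => rfl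
  | cons a l ih => rw [lsum_cons, lsum_cons, List.map_cons, List.sum_cons, ← ih]; push_cast; ring

theorem Cut.hit_eq (c : Cut) (p x : ℕ) :
    c.hit p x = if p.testBit c.i = c.color ∧ p.testBit c.j = c.color ∧ p.testBit c.k = c.color
      then x else 0 := by
  simp only [Cut.hit, Bool.cond_eq_ite, beqBool_eq_true, bit_eq, ite_and]

theorem Cut.hit_mul (c : Cut) (p x : ℕ) : (c.hit p (20 * x) : ℤ) = c.hit p 20 * x := by
  rw [c.hit_eq, c.hit_eq]; split_ifs <;> simp

theorem mult_sub (l : List (ℕ × Cut)) (m : List (ℕ × ℕ)) (q : ℕ) :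
    (multPos l m q : ℤ) - multNeg l q = multiplier l m q := by
  have h1 : multPos l m q = lsum l (fun a => a.1 * a.2.slack) +
    lsum m fun a => cond (Nat.beq q a.2) a.1 0 := rfl
  have h2 : multNeg l q = lsum l fun a => a.2.hit q (20 * a.1) := rfl
  rw [h1, h2, Nat.cast_add, add_sub_right_comm, lsum_sub_lsum, lsum_eq, multiplier]
  congr 3
  · ext a
    rw [Cut.hit_mul, Cut.weight]; push_cast; ring
  · ext a
    simp [Bool.cond_eq_ite]

theorem Cert.form_eq (F : Cert) (p q : ℕ) :
    F.form p q =
      (F.squares.map fun v =>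
        ((squareWeight v p : ℤ) - 65536) * ((squareWeight v q : ℤ) - 65536)).sum +
      (F.products.map fun a => a.1.weight p * multiplier a.2.1 a.2.2 q).sum := by
  have h1 : F.formPos p q =
      lsum F.squares (fun v => squareWeight v p * squareWeight v q + 4294967296) +
      lsum F.products fun a => a.1.slack * multPos a.2.1 a.2.2 q +
        a.1.hit p (20 * multNeg a.2.1 q) := rfl
  have h2 : F.formNeg p q =
      lsum F.squares (fun v => 65536 * (squareWeight v p + squareWeight v q)) +
      lsum F.products fun a => a.1.slack * multNeg a.2.1 q +
        a.1.hit p (20 * multPos a.2.1 a.2.2 q) := rfl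
  rw [Cert.form, h1, h2, Nat.cast_add, Nat.cast_add, add_sub_add_comm, lsum_sub_lsum,
    lsum_sub_lsum]
  congr 3
  · ext v; push_cast; ring
  · ext a
    rw [← mult_sub, Cut.weight]
    push_cast [Cut.hit_mul]; ring

theorem sum_list_nonneg {α ι : Type*} (s : Finset ι) (l : List α) (f : α → ι → ℤ)
    (h : ∀ a ∈ l, 0 ≤ ∑ i ∈ s, f a i) : 0 ≤ ∑ i ∈ s, (l.map fun a => f a i).sum := by
  induction l with
  | nil => simp
  | cons a l ih =>
    simp only [List.map_cons, List.sum_cons, sum_add_distrib]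
    exact add_nonneg (h a List.mem_cons_self) (ih fun b hb => h b (List.mem_cons_of_mem a hb))

theorem sum_form_nonneg {ι : Type*} (s : Finset ι) (π : ι → ℕ) (F : Cert)
    (h : ∀ a ∈ F.products, 0 ≤ ∑ u ∈ s, a.1.weight (π u) ∧
      ∀ b ∈ a.2.1, 0 ≤ ∑ u ∈ s, b.2.weight (π u)) :
    0 ≤ ∑ u ∈ s, ∑ v ∈ s, F.form (π u) (π v) := by
  rw [← sum_product']
  simp only [Cert.form_eq, sum_add_distrib]
  refine add_nonneg (sum_list_nonneg _ _ _ fun v _ => ?_) (sum_list_nonneg _ _ _ fun a ha => ?_)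
  · rw [sum_product]
    dsimp only
    rw [← sum_mul_sum]
    exact mul_self_nonneg _
  · rw [sum_product]
    dsimp only
    rw [← sum_mul_sum]
    refine mul_nonneg (h a ha).1 ?_
    simp only [multiplier, sum_add_distrib]
    refine add_nonneg (sum_list_nonneg _ _ _ fun b hb => ?_)
      (sum_list_nonneg _ _ _ fun b _ => sum_nonneg fun u _ => by split_ifs <;> simp)
    rw [← mul_sum]
    exact mul_nonneg (Nat.cast_nonneg _) ((h a ha).2 b hb)

def cutCheck (g : ℕ → ℕ → Bool) (c : Cut) : Bool :=
  cond (Nat.blt c.i c.j) (cond (Nat.blt c.j c.k) (cond (Nat.blt c.k (nat_lit 5))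
    (Nat.ble (nat_lit 3) (Nat.add c.slack (nsum (nat_lit 5) fun v =>
      cond (Nat.beq v c.i) (nat_lit 0) (cond (Nat.beq v c.j) (nat_lit 0)
        (cond (Nat.beq v c.k) (nat_lit 0)
          (cond (beqBool (g c.i v) c.color) (cond (beqBool (g c.j v) c.color)
            (cond (beqBool (g c.k v) c.color) (nat_lit 1) (nat_lit 0)) (nat_lit 0))
              (nat_lit 0))))))) false) false) false

def Cert.valid (F : Cert) : Bool :=
  lall F.products fun a => cond (cutCheck (pairBit F.code) a.1)
    (lall a.2.1 fun b => cutCheck (pairBit F.code) b.2) false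

theorem cond_false_eq_true {a b : Bool} : cond a b false = true ↔ a = true ∧ b = true := by
  cases a <;> simp

/-- No three vertices have four common neighbours of the same colour. -/
def Sparse {V : Type} (e : V → V → Bool) : Prop :=
  ∀ (c : Bool) (a b d : V), a ≠ b → a ≠ d → b ≠ d → ∀ s : Finset V,
    (∀ u ∈ s, (u ≠ a ∧ u ≠ b ∧ u ≠ d) ∧ e a u = c ∧ e b u = c ∧ e d u = c) → s.card ≤ 3

theorem Sparse.not {V : Type} {e : V → V → Bool} (h : Sparse e) : Sparse fun a b => !e a b := by
  intro c a b d hab had hbd s hs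
  refine h (!c) a b d hab had hbd s fun u hu => ?_
  obtain ⟨h1, h2, h3, h4⟩ := hs u hu
  exact ⟨h1, by simp [← h2], by simp [← h3], by simp [← h4]⟩

section Copies

variable {V : Type} [Fintype V]

open Classical in
theorem sum_weight_nonneg (hV : Fintype.card V = 25) {e : V → V → Bool} (h : Sparse e)
    {g : ℕ → ℕ → Bool} {x : Fin 5 → V} (hx : IsCopy e 5 g x) {c : Cut}
    (hc : cutCheck g c = true) : 0 ≤ ∑ u ∈ outside x, c.weight (profile e x u) := by
  simp only [cutCheck, cond_false_eq_true, Nat.blt_eq, Nat.ble_eq] at hc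
  obtain ⟨hij, hjk, hk, hs⟩ := hc
  change 3 ≤ c.slack + nsum 5 _ at hs
  rw [nsum_eq] at hs
  have hj : c.j < 5 := by omega
  have hi : c.i < 5 := by omega
  let i : Fin 5 := ⟨c.i, hi⟩
  let j : Fin 5 := ⟨c.j, hj⟩
  let k : Fin 5 := ⟨c.k, hk⟩
  have hij' : i ≠ j := Fin.ne_of_val_ne hij.ne
  have hjk' : j ≠ k := Fin.ne_of_val_ne hjk.ne
  have hik' : i ≠ k := Fin.ne_of_val_ne (hij.trans hjk).ne
  let S : Finset V := {u ∈ outside x | e (x i) u = c.color ∧ e (x j) u = c.color ∧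
    e (x k) u = c.color}
  let R : Finset (Fin 5) := {v | (v ≠ i ∧ v ≠ j ∧ v ≠ k) ∧ g i v = c.color ∧ g j v = c.color ∧
    g k v = c.color}
  have hR : (R.card : ℕ) = ∑ v ∈ range 5, cond (Nat.beq v c.i) 0 (cond (Nat.beq v c.j) 0
      (cond (Nat.beq v c.k) 0 (cond (beqBool (g c.i v) c.color) (cond (beqBool (g c.j v) c.color)
        (cond (beqBool (g c.k v) c.color) 1 0) 0) 0))) := by
    rw [card_filter, ← Fin.sum_univ_eq_sum_range
      (fun v => cond (Nat.beq v c.i) 0 (cond (Nat.beq v c.j) 0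
      (cond (Nat.beq v c.k) 0 (cond (beqBool (g c.i v) c.color) (cond (beqBool (g c.j v) c.color)
        (cond (beqBool (g c.k v) c.color) 1 0) 0) 0)))) 5]
    refine sum_congr rfl fun v _ => ?_
    have : ∀ w : Fin 5, (v ≠ w) ↔ ¬ ((v : ℕ) = w) := fun w => by rw [Ne, Fin.ext_iff]
    simp only [this, Bool.cond_eq_ite, beqBool_eq_true, Nat.beq_eq, ite_and, ite_not]
    rfl
  have hcard : S.card + R.card ≤ 3 := by
    have hdisj : Disjoint S (R.image x) := by
      rw [Finset.disjoint_left]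
      intro u hu hu'
      obtain ⟨v, -, rfl⟩ := mem_image.1 hu'
      exact mem_outside.1 (mem_filter.1 hu).1 ⟨v, rfl⟩
    rw [← card_image_of_injective R hx.injective, ← card_union_of_disjoint hdisj]
    refine h c.color (x i) (x j) (x k) (hx.injective.ne hij') (hx.injective.ne hik')
      (hx.injective.ne hjk') _ fun u hu => ?_
    rcases mem_union.1 hu with hu | hu
    · obtain ⟨h1, h2⟩ := mem_filter.1 hu
      have h3 : ∀ v, u ≠ x v := fun v hv => mem_outside.1 h1 ⟨v, hv.symm⟩
      exact ⟨⟨h3 i, h3 j, h3 k⟩, h2⟩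
    · obtain ⟨v, hv, rfl⟩ := mem_image.1 hu
      obtain ⟨-, ⟨h1, h2, h3⟩, h4⟩ := mem_filter.1 hv
      refine ⟨⟨hx.injective.ne h1, hx.injective.ne h2, hx.injective.ne h3⟩, ?_⟩
      rw [hx.eq i v h1.symm, hx.eq j v h2.symm, hx.eq k v h3.symm]
      exact h4
  have hw : ∀ u, c.weight (profile e x u) = c.slack - 20 * (if e (x i) u = c.color ∧
      e (x j) u = c.color ∧ e (x k) u = c.color then 1 else 0) := fun u => by
    rw [Cut.weight, Cut.hit_eq, profile, Nat.testBit_ofBits_lt _ _ hi,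
      Nat.testBit_ofBits_lt _ _ hj, Nat.testBit_ofBits_lt _ _ hk]
    simp only [i, j, k]
    split_ifs <;> rfl
  have hsum : ∑ u ∈ outside x, c.weight (profile e x u) = 20 * c.slack - 20 * (S.card : ℤ) := by
    rw [sum_congr rfl fun u _ => hw u, sum_sub_distrib, sum_const, card_outside hV hx, ← mul_sum,
      sum_boole]
    rfl
  have : (R.card : ℤ) + c.slack ≥ 3 := by rw [hR]; exact_mod_cast (add_comm _ c.slack) ▸ hs
  rw [hsum]
  omega

theorem Cert.sum_nonneg (hV : Fintype.card V = 25) {e : V → V → Bool}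
    (he : ∀ u v, e u v = e v u) (h : Sparse e) {F : Cert} (hF : F.valid = true) :
    0 ≤ ∑ p ∈ range 32, ∑ P ∈ range 64, (19 * F.form p (P % 32) + F.form p p) *
      ((copies e 7 (extend 6 (extend 5 (pairBit F.code) p) P)).card : ℤ) := by
  rw [sum_card_copies hV he]
  refine mul_nonneg (by norm_num) (Finset.sum_nonneg fun x hx => ?_)
  refine sum_form_nonneg _ _ _ fun a ha => ?_
  have h1 := cond_false_eq_true.1 (lall_eq_true.1 hF a ha)
  refine ⟨sum_weight_nonneg hV h (mem_copies.1 hx) h1.1, fun b hb => ?_⟩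
  exact sum_weight_nonneg hV h (mem_copies.1 hx) (lall_eq_true.1 h1.2 b hb)

theorem Cert.sum_total_nonneg (hV : Fintype.card V = 25) {e : V → V → Bool}
    (he : ∀ u v, e u v = e v u) (h : Sparse e) {F : Cert} (hF : F.valid = true) :
    0 ≤ ∑ p ∈ range 32, ∑ P ∈ range 64, (19 * F.form p (P % 32) + F.form p p) *
      (total e 7 (extend 6 (extend 5 (pairBit F.code) p) P) : ℤ) := by
  have h1 := F.sum_nonneg hV he h hF
  have h2 := F.sum_nonneg hV (e := fun a b => !e a b) (fun u v => by rw [he]) h.not hF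
  refine (add_nonneg h1 h2).trans_eq ?_
  simp only [total, ← sum_add_distrib, ← mul_add, Nat.cast_add]

end Copies

/-! ### Comparing two weighted sums digit by digit -/

theorem sum_digits_lt {B : ℕ} {w : ℕ → ℕ} (N : ℕ) (h : ∀ k < N, w k < B) :
    ∑ k ∈ range N, w k * B ^ k < B ^ N := by
  induction N with
  | zero => simp
  | succ N ih =>
    have h1 := ih fun k hk => h k (by omega)
    have h2 : (w N + 1) * B ^ N ≤ B * B ^ N := Nat.mul_le_mul_right _ (h N (by omega))
    rw [sum_range_succ, pow_succ']
    linarith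

theorem sum_digits_split {B : ℕ} {w : ℕ → ℕ} {i N : ℕ} (hi : i < N) :
    ∃ y, ∑ k ∈ range N, w k * B ^ k = ∑ k ∈ range i, w k * B ^ k + B ^ i * (w i + B * y) := by
  induction N, hi using Nat.le_induction with
  | base => exact ⟨0, by rw [sum_range_succ]; ring⟩
  | succ N hN ih =>
    obtain ⟨y, hy⟩ := ih
    obtain ⟨d, rfl⟩ := Nat.exists_eq_add_of_le hN
    refine ⟨y + w (i + 1 + d) * B ^ d, ?_⟩
    rw [Nat.succ_eq_add_one] at hy ⊢
    rw [sum_range_succ, hy]; ring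

theorem sum_digits_div_mod {B : ℕ} {w : ℕ → ℕ} {i N : ℕ} (h : ∀ k < N, w k < B) (hi : i < N) :
    (∑ k ∈ range N, w k * B ^ k) / B ^ i % B = w i := by
  obtain ⟨y, hy⟩ := sum_digits_split (B := B) (w := w) hi
  have hlt := sum_digits_lt i fun k hk => h k (hk.trans hi)
  rw [hy, Nat.add_mul_div_left _ _ (by omega), Nat.div_eq_of_lt hlt, zero_add,
    Nat.add_mul_mod_self_left, Nat.mod_eq_of_lt (h i hi)]

/-- Digits can be read off a sum of `w k * (B ^ k + B ^ N)` whose leading part, the sum of all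
`w k`, shows that no overflow has occurred. -/
theorem sum_weights_div_mod {B : ℕ} {w : ℕ → ℕ} {i N : ℕ}
    (h : (∑ k ∈ range N, w k * (B ^ k + B ^ N)) / B ^ N < B) (hi : i < N) :
    (∑ k ∈ range N, w k * (B ^ k + B ^ N)) / B ^ i % B = w i := by
  have hB : 0 < B := (Nat.zero_le _).trans_lt h
  have hA : ∑ k ∈ range N, w k * (B ^ k + B ^ N) =
      ∑ k ∈ range (N + 1), (if k = N then ∑ j ∈ range N, w j else w k) * B ^ k := by
    rw [sum_range_succ, if_pos rfl, sum_mul, ← sum_add_distrib]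
    refine sum_congr rfl fun k hk => ?_
    rw [if_neg (mem_range.1 hk).ne]; ring
  have hw : ∑ j ∈ range N, w j < B := by
    refine lt_of_le_of_lt ((Nat.le_div_iff_mul_le (by positivity)).2 ?_) h
    rw [sum_mul]
    exact sum_le_sum fun k _ => Nat.mul_le_mul_left _ (Nat.le_add_left _ _)
  rw [hA, sum_digits_div_mod (N := N + 1) _ (by omega), if_neg hi.ne]
  intro k hk
  split_ifs with hkN
  · exact hw
  · exact (single_le_sum (fun j _ => Nat.zero_le (w j)) (mem_range.2 (by omega))).trans_lt hw

/-- `T` is the linear functional on functions of `k < N` given by its values at indicators. -/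
def IsFunctional (N : ℕ) (T : (ℕ → ℕ) → ℕ) : Prop :=
  ∀ β, T β = ∑ k ∈ range N, T (fun j => if j = k then 1 else 0) * β k

theorem IsFunctional.eval {N : ℕ} (a : ℕ) {k : ℕ} (hk : k < N) :
    IsFunctional N fun β => a * β k := by
  intro β
  simp [hk]

theorem IsFunctional.add {N : ℕ} {S T : (ℕ → ℕ) → ℕ} (hS : IsFunctional N S)
    (hT : IsFunctional N T) : IsFunctional N fun β => S β + T β := by
  intro β
  simp only [add_mul, sum_add_distrib]
  exact congrArg₂ _ (hS β) (hT β)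

theorem IsFunctional.nsum {N : ℕ} {T : ℕ → (ℕ → ℕ) → ℕ} (n : ℕ)
    (h : ∀ i < n, IsFunctional N (T i)) : IsFunctional N fun β => nsum n fun i => T i β := by
  intro β
  simp only [nsum_eq, sum_mul]
  rw [sum_comm]
  exact sum_congr rfl fun i hi => h i (mem_range.1 hi) β

theorem IsFunctional.lsum {N : ℕ} {α : Type} {T : α → (ℕ → ℕ) → ℕ} (l : List α)
    (h : ∀ a ∈ l, IsFunctional N (T a)) : IsFunctional N fun β => lsum l fun a => T a β := by
  induction l with
  | nil => intro β; simp [RamseyK34.lsum]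
  | cons a l ih =>
    intro β
    simp only [lsum_cons, add_mul, sum_add_distrib]
    rw [h a List.mem_cons_self β]
    exact congrArg _ (ih (fun b hb => h b (List.mem_cons_of_mem a hb)) β)

def binWeight (w N k : ℕ) : ℕ :=
  Nat.add (Nat.pow (nat_lit 2) (Nat.mul w k)) (Nat.pow (nat_lit 2) (Nat.mul w N))

/-- The digits of `A` below position `n` in base `2 ^ w` are less than those of `B`, and neither of
the two has overflowed. -/
def digitCheck (w N A B n : ℕ) : Bool :=
  cond (Nat.blt (Nat.shiftRight A (Nat.mul w N)) (Nat.pow (nat_lit 2) w))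
    (cond (Nat.blt (Nat.shiftRight B (Nat.mul w N)) (Nat.pow (nat_lit 2) w))
      (nall n fun i => Nat.blt (digit w A i) (digit w B i)) false) false

theorem IsFunctional.digit {w N : ℕ} {T : (ℕ → ℕ) → ℕ} (hT : IsFunctional N T)
    (h : T (binWeight w N) >>> (w * N) < 2 ^ w) {i : ℕ} (hi : i < N) :
    digit w (T (binWeight w N)) i = T fun j => if j = i then 1 else 0 := by
  have hpow : ∀ k, binWeight w N k = (2 ^ w) ^ k + (2 ^ w) ^ N := fun k => by
    change 2 ^ (w * k) + 2 ^ (w * N) = _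
    rw [pow_mul, pow_mul]
  rw [digit_eq]
  rw [Nat.shiftRight_eq_div_pow, pow_mul] at h
  rw [hT (binWeight w N)] at h ⊢
  simp only [hpow] at h ⊢
  exact sum_weights_div_mod h hi

theorem eq_zero_of_digitCheck {w N : ℕ} {S T : (ℕ → ℕ) → ℕ} (hS : IsFunctional N S)
    (hT : IsFunctional N T) {n : ℕ} (hn : n ≤ N)
    (h : digitCheck w N (S (binWeight w N)) (T (binWeight w N)) n = true) {m : ℕ → ℕ}
    (hm : ∀ k, n ≤ k → m k = 0) (hle : T m ≤ S m) (k : ℕ) : m k = 0 := by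
  rw [digitCheck, cond_false_eq_true, cond_false_eq_true, Nat.blt_eq, Nat.blt_eq,
    nall_eq_true] at h
  obtain ⟨h1, h2, h3⟩ := h
  by_contra hk
  have hkn : k < n := by by_contra h; exact hk (hm k (by omega))
  rw [hS m, hT m] at hle
  have hlt : ∀ i < n, S (fun j => if j = i then 1 else 0) < T fun j => if j = i then 1 else 0 := by
    intro i hi
    rw [← hS.digit h1 (hi.trans_le hn), ← hT.digit h2 (hi.trans_le hn)]
    simpa using h3 i hi
  refine hle.not_gt (sum_lt_sum (fun i _ => ?_) ⟨k, mem_range.2 (by omega), ?_⟩)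
  · by_cases hi : i < n
    · exact Nat.mul_le_mul_right _ (hlt i hi).le
    · simp [hm i (by omega)]
  · exact Nat.mul_lt_mul_of_pos_right (hlt k hkn) (Nat.pos_of_ne_zero hk)

/-! ### The data of the proof -/

def certs : List Cert := [
  ⟨0,
  19871979088013428637972218055952362191793186789324866408020843737487297197764848197530181212739249762347268222355619603994371605025863359213808431327834745934272257874354390386358647667268938484586490987114683518740380654057922248335875240853636548608,
  [],
  [⟨⟨0, 1, 2, false, 1⟩, [], [(17411639, 15), (1053294, 31)]⟩,
    ⟨⟨0, 1, 2, true, 3⟩, [], [(122832380, 1), (2848830, 3), (3967344, 7), (104879263, 9), (111775604, 15), (27769548, 27), (40223645, 31)]⟩]⟩,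
  ⟨1,
  18377674485377774271344378833786411347817346447279395463183273049933101324632093563145332176774778154103492623857570997148269342961698618349105104573334025301217126743272724308182399191585206069194487606251565285573995047374016496885246138503859177473,
  [22232499772894023810337155542329231862615527664986302198406010556408678584182736803584756582379439060286584124636415805909069904465411082634924709707388063225290958],
  [⟨⟨0, 1, 2, false, 1⟩, [(10972222, ⟨0, 1, 2, true, 3⟩), (7164485, ⟨0, 3, 4, false, 2⟩), (1780958, ⟨2, 3, 4, true, 3⟩)], [(31082312, 11), (275117163, 12), (186741950, 15), (141687368, 31)]⟩,
    ⟨⟨0, 1, 2, true, 3⟩, [(1568382, ⟨0, 3, 4, true, 3⟩)], [(76665337, 0), (88699985, 1), (61527036, 15), (1700436, 27), (51664288, 31)]⟩,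
    ⟨⟨0, 2, 3, false, 2⟩, [(2508428, ⟨0, 2, 3, true, 3⟩)], []⟩,
    ⟨⟨0, 2, 3, true, 3⟩, [], [(111216208, 3), (247878474, 4), (7973882, 6), (31474692, 13), (47242844, 17), (25167602, 20), (5991128, 29), (47757809, 30), (72409630, 31)]⟩,
    ⟨⟨2, 3, 4, true, 3⟩, [], [(2526623, 28)]⟩]⟩,
  ⟨3,
  18022068955698794909202506982824923357994902302091106657739798639039670062056165528633928499807597002048791211995655952509489689711262647946063794675029988372011033808140950299733128772290820141066386984340823101369236618092796300012320676727436511234,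
  [20064687408918672080610365272306840338052258706170518335130878384787760409145368745026601242919987059939386069025340040633956253242116987301550863804824933810239139,
    24803118995072492968690075419460710680546265665291767863818691089277301627564241169894211946157838350228665867595084473649697769517544515131047320937874651575950614,
    31557181368652129352788738983231337059146764063953454912862465276229379097960724240238757909831957903435154429579658895859263509519560080670096081891151565782844123],
  [⟨⟨0, 1, 2, false, 1⟩, [(8331131, ⟨0, 1, 3, false, 2⟩), (2978254, ⟨0, 3, 4, false, 3⟩)], [(43940335, 1), (196255879, 3), (92378002, 7), (171095071, 9), (431164382, 10), (199572230, 11), (182676753, 14), (54527119, 15), (106565390, 25), (62160534, 26), (13907978, 27), (3612270, 30), (2519357, 31)]⟩,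
    ⟨⟨0, 1, 2, true, 3⟩, [(1655569, ⟨0, 3, 4, true, 3⟩)], [(2486159, 1)]⟩,
    ⟨⟨0, 1, 3, false, 2⟩, [(3346011, ⟨0, 1, 3, true, 3⟩)], []⟩,
    ⟨⟨0, 1, 3, true, 3⟩, [(2210515, ⟨1, 3, 4, true, 3⟩)], [(15111502, 1), (40565963, 8), (10935508, 12), (26364526, 15), (561392, 31)]⟩,
    ⟨⟨1, 2, 3, false, 2⟩, [(430147, ⟨0, 3, 4, true, 3⟩)], []⟩,
    ⟨⟨1, 2, 3, true, 3⟩, [(828408, ⟨0, 3, 4, true, 3⟩)], [(30720932, 14), (27943589, 15), (96943102, 31)]⟩,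
    ⟨⟨0, 3, 4, true, 3⟩, [], [(835024, 1), (15086990, 3), (69516076, 8), (44396618, 10), (36026143, 25), (14198844, 27), (45383931, 31)]⟩,
    ⟨⟨1, 3, 4, true, 3⟩, [], [(4039718, 7), (51875982, 13), (59745924, 26)]⟩]⟩,
  ⟨7,
  18854104861966079046624574545308362497790223112444176435989868849875949266615113259011172836397154187203461522260004941202454732404797121774540236968942401255018891339969990814386400782925778148750519688678798346755051409889120119100230148283024443395,
  [28901349831861945145205511497966410209810517106554449457224650926405962917557108795975140967748604916214555783828269210736867429652057516622170389433090044523384223,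
    33858527065898359651737090230676822236870629269542992094749486279857170020921809282618982324672529365461942855386882802686920557547954764392976950418398545003087138],
  [⟨⟨0, 1, 2, false, 1⟩, [(2038152, ⟨0, 1, 3, true, 3⟩), (2470892, ⟨0, 3, 4, false, 3⟩)], [(140559561, 3), (162217757, 9), (238301355, 11), (98302961, 15), (53560863, 25), (43556223, 27)]⟩,
    ⟨⟨0, 1, 3, false, 2⟩, [(2411167, ⟨2, 3, 4, true, 3⟩)], []⟩,
    ⟨⟨0, 1, 3, true, 3⟩, [(4235051, ⟨2, 3, 4, true, 3⟩)], [(82542612, 15), (10277886, 31)]⟩,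
    ⟨⟨0, 3, 4, true, 3⟩, [], [(50584521, 27), (71504330, 31)]⟩]⟩,
  ⟨11,
  18082480099578482973472015490324336874228934183010958715949369244707462466471637678776229289397352942064244758237612803202848653665329347872698301318875069744312895090449742892613071043229509246281283323139699215220370097687970992345724980549785126916,
  [24541283468088072945425627881065852224335728303414813392447642603732809265415197811931406093231907676781840279864606448394529759950911949088388299613725568558520761,
    25354941903637955231367309939333303817174600816460392602925276360231563831965132984350930729090196433453879049811837303708233664451844092154147028305310299600255149],
  [⟨⟨0, 1, 2, false, 2⟩, [(5113038, ⟨0, 1, 2, true, 3⟩), (5728520, ⟨0, 1, 3, false, 2⟩), (709151, ⟨0, 1, 4, false, 3⟩)], [(27663069, 1), (74538509, 3), (39478626, 6), (28581604, 19), (2076123, 24)]⟩,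
    ⟨⟨0, 1, 2, true, 3⟩, [(159433, ⟨1, 2, 3, true, 2⟩)], []⟩,
    ⟨⟨1, 2, 3, false, 2⟩, [(1365545, ⟨1, 2, 3, true, 2⟩)], []⟩,
    ⟨⟨1, 2, 3, true, 2⟩, [(4260681, ⟨0, 1, 4, true, 3⟩), (2117526, ⟨1, 2, 4, true, 3⟩)], [(47037171, 30)]⟩,
    ⟨⟨0, 1, 4, true, 3⟩, [(503709, ⟨2, 3, 4, true, 3⟩)], [(5295951, 1)]⟩]⟩,
  ⟨12,
  18871696879324812057279720197101088278990880679993825933311320634945007827040198748303856403170861042014367718205136397538534019022890344784267404703585662183811322347650156482738180521921063848203405298986341253487610917604271486977925071624118634501,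
  [26462949313994855375633214694710777857483623384361813668898403866779867747450219452319761724483793285566703357987988447438616364989983376384289102612780513495975790,
    30240912924341793692912041425681098129099356184101009806371585404764311557005940415963171710115457418401646789255002647437889542157713401952491651987810028268475572],
  [⟨⟨0, 1, 2, false, 2⟩, [(3722855, ⟨0, 1, 2, true, 3⟩)], []⟩,
    ⟨⟨0, 1, 2, true, 3⟩, [(609866, ⟨1, 2, 3, true, 3⟩), (243732, ⟨1, 3, 4, true, 3⟩)], []⟩,
    ⟨⟨0, 1, 4, true, 3⟩, [(1391045, ⟨0, 2, 4, true, 3⟩)], [(62521039, 16), (51857097, 28), (44005314, 31)]⟩,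
    ⟨⟨1, 2, 4, false, 1⟩, [], [(9373985, 15)]⟩,
    ⟨⟨1, 2, 4, true, 3⟩, [(547324, ⟨0, 3, 4, true, 3⟩)], []⟩]⟩,
  ⟨13,
  17978477845628538336586112142859155772801935960141630461639521209963689740376631567776962551686349273376284057435476288139491814017130563001731598937655960940778317938417489316833374020362366438056373360167341731928057227805890700617050734752277366790,
  [32750044449116767220359437020791732251573894878770300528542981184920026333670118262330156387179934342254144940106538291921067844939907629929339837764849891968224661,
    33164785687999131263603955032104835873497981195791067434535695887583718465457202507223220375047997058351130892322529370402065426452120916178612772743565022246924095,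
    21176690275563158931878800402346992060789993203863715757099486068600291185649842143036580659223098415996724527001125555306495430878653537105464196213286047335944663],
  [⟨⟨0, 1, 2, false, 2⟩, [(28431, ⟨0, 2, 3, false, 2⟩), (1272880, ⟨1, 2, 3, false, 2⟩), (298273, ⟨0, 3, 4, true, 3⟩)], [(32225386, 20), (20141721, 24)]⟩,
    ⟨⟨0, 2, 3, false, 2⟩, [(4079233, ⟨0, 2, 3, true, 3⟩), (793588, ⟨1, 3, 4, true, 3⟩)], []⟩,
    ⟨⟨0, 2, 3, true, 3⟩, [(845929, ⟨2, 3, 4, true, 3⟩)], []⟩,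
    ⟨⟨0, 1, 4, false, 3⟩, [(622871, ⟨0, 1, 4, true, 3⟩)], []⟩,
    ⟨⟨0, 1, 4, true, 3⟩, [], [(8170175, 3), (34563575, 23)]⟩,
    ⟨⟨0, 2, 4, true, 3⟩, [(980612, ⟨1, 3, 4, true, 3⟩)], [(22594196, 29), (30039778, 31)]⟩,
    ⟨⟨1, 2, 4, false, 2⟩, [(1487573, ⟨1, 2, 4, true, 3⟩)], []⟩,
    ⟨⟨2, 3, 4, true, 3⟩, [], [(77148333, 19), (23597418, 31)]⟩]⟩,
  ⟨15,
  18021299093424575625693255742913387333910627682487119231417232850604978722540826515209870480541543727514918081985179668919532358865887484570218076166861007986912624973157790248253061071061302521535978529155272911371404703411119316021178808253001664519,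
  [22577825304145672009009072689660576698458789906933003991381002258341711577600610035157214464120491863183293543205225485443193071843050405890675409526954497306724696,
    32373547805778937866196202886015091771273756136064194313075282315602504582432599022521693216007271986041253000287151042777979464795409192080053132394451079093994249,
    22482927175500993590423233866618720427634649137351499020140879885440315893035875000624824130403748801432083171414582919362300723265181047559452655424173022458758620,
    27507266683960687877338805044369102524988107496007022852581525948670123767253554030475427041684072702891174926966902016757867961481891479295384838440222674510755173],
  [⟨⟨0, 1, 2, false, 2⟩, [(12304864, ⟨0, 1, 3, false, 2⟩), (1104456, ⟨1, 2, 3, false, 2⟩), (2346483, ⟨1, 2, 4, false, 2⟩), (1129552, ⟨1, 2, 4, true, 3⟩), (289021, ⟨0, 3, 4, true, 3⟩)], [(33911990, 1), (13287179, 3), (135018812, 6), (110680980, 14), (215484409, 24)]⟩,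
    ⟨⟨0, 1, 3, false, 2⟩, [(6140026, ⟨0, 1, 3, true, 3⟩), (4062915, ⟨1, 3, 4, true, 3⟩)], [(105727055, 3), (78423756, 19)]⟩,
    ⟨⟨1, 2, 3, false, 2⟩, [(4982834, ⟨1, 2, 3, true, 2⟩)], []⟩,
    ⟨⟨1, 2, 3, true, 2⟩, [(7505479, ⟨0, 3, 4, true, 3⟩)], [(30146096, 14)]⟩,
    ⟨⟨0, 1, 4, true, 3⟩, [(828336, ⟨1, 3, 4, true, 3⟩), (177007, ⟨2, 3, 4, true, 3⟩)], []⟩,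
    ⟨⟨1, 2, 4, true, 3⟩, [(94419, ⟨0, 3, 4, true, 3⟩)], []⟩]⟩,
  ⟨30,
  18529090304566251435585925768286967566047244616286878790834805380497853390232694488284942836626424460968341454183574849458470401583146988671985854598682035315564110133128315774594266978589350980736527732169757832612970702247238569177000555179065903112,
  [29196149248931023441094083170414781563483660008619277185344948958618275225808581623676033978469964057123767293650507907975945777867923808280857382577929136374743737,
    19795835820743351756121169079342385849114901452023055620241245568587155497789325640916123790710952919104174401886177485364184108678037652118008906221250234073437224],
  [⟨⟨0, 1, 2, false, 2⟩, [(2243874, ⟨0, 1, 3, false, 2⟩), (1528107, ⟨0, 3, 4, true, 3⟩)], [(3297028, 11), (21870130, 19)]⟩,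
    ⟨⟨0, 2, 4, false, 3⟩, [(663301, ⟨0, 2, 4, true, 3⟩)], []⟩,
    ⟨⟨0, 2, 4, true, 3⟩, [(276343, ⟨1, 2, 4, true, 3⟩)], [(42603073, 26)]⟩]⟩,
  ⟨31,
  18370019245764187425115361452025964270827655968860045269459274258373387757257363438110635505304711610071616767065961751185104574665970287560673935494508100357101781315299507031757278789901447092505722306814934692806888577560841142601626297968689055753,
  [24662076427723366630235166012494160354923782130066863284238044580534432510554892735335398632466647114791121363824389784629301545918213224253707037792591164746833592,
    29190897357088302821411449199953787280433350819195329664930323319677933104032158066112719283252476904971175283711770068256024554364630808849553513909079019050964099,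
    29793230990837607675787314601173341205539107137873127206475845528204227790971271662622241844829112592914340484644313942121241926671473420970403273629960033358642722],
  [⟨⟨0, 1, 2, false, 2⟩, [(2444588, ⟨0, 1, 2, true, 3⟩), (2824631, ⟨0, 1, 3, false, 2⟩), (6161419, ⟨0, 2, 3, false, 2⟩), (1043741, ⟨0, 2, 4, true, 3⟩), (695831, ⟨2, 3, 4, true, 3⟩)], [(89656175, 24)]⟩,
    ⟨⟨0, 2, 3, false, 2⟩, [(1357815, ⟨0, 2, 3, true, 2⟩), (76473, ⟨1, 2, 3, false, 2⟩), (3293763, ⟨0, 1, 4, false, 3⟩)], []⟩,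
    ⟨⟨0, 1, 4, false, 3⟩, [(415524, ⟨2, 3, 4, true, 3⟩)], []⟩,
    ⟨⟨0, 1, 4, true, 3⟩, [(110642, ⟨2, 3, 4, true, 3⟩)], []⟩,
    ⟨⟨0, 2, 4, true, 3⟩, [(3650668, ⟨1, 2, 4, true, 3⟩)], []⟩,
    ⟨⟨2, 3, 4, true, 3⟩, [], [(3912893, 16)]⟩]⟩,
  ⟨63,
  19361122696939513462270363811253114978180058786190141997312129369499212006379738250933648747687426876495955855783596478892276490872129313139663716801138138910653702473283284475887382138055719230202464213448852330127124125168005716086449882318663747594,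
  [30113959134198791888868208228808766951864995882409294828829896010227606957460984935644800138818048821126837972562243718960972577516008213539539129746219772026880517,
    28827532555306904749427085213958362640108861220919341303695149469273529531297911439906983747291824211132951040969572958087321852643975879186517075603880192964098962],
  [⟨⟨0, 1, 2, false, 2⟩, [(2255284, ⟨0, 1, 2, true, 2⟩), (739076, ⟨0, 1, 3, false, 2⟩), (223410, ⟨0, 3, 4, false, 3⟩), (1243812, ⟨0, 3, 4, true, 3⟩)], []⟩,
    ⟨⟨0, 1, 4, false, 3⟩, [(305212, ⟨2, 3, 4, true, 3⟩)], []⟩,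
    ⟨⟨0, 1, 4, true, 3⟩, [(449283, ⟨2, 3, 4, true, 3⟩)], []⟩]⟩,
  ⟨76,
  18145956655896025820218613726060643312473069974976504363368866335747458640999317491401527479956583041777557879274433145978477025437585683781530238613461982141408593568264729417320237227318209605541141649408982123575392888186501698378314466646592751628,
  [28100797106245249532295198290326662992104102320628277623722781305060702681087871436463494413623114972324565109586071653806279724674713480467115199182001937116933828,
    22040435833531095268814548169644940807051328801481307303121676755478540957777292535663830263043877308084212616279029074806424275976793812008607021746976082735992214,
    27098723901342318832982070371284069684766449840972223298631893957331215331675166624179182738628583128379202919445131556770049929183000276333102571008369579138944345],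
  [⟨⟨0, 1, 2, false, 3⟩, [(9262496, ⟨0, 3, 4, false, 1⟩)], []⟩,
    ⟨⟨0, 1, 2, true, 3⟩, [(18189, ⟨1, 2, 3, false, 2⟩), (728004, ⟨0, 3, 4, false, 1⟩), (703216, ⟨0, 3, 4, true, 3⟩), (3343349, ⟨1, 3, 4, true, 3⟩)], []⟩,
    ⟨⟨0, 1, 3, true, 3⟩, [], [(2806159, 11)]⟩,
    ⟨⟨1, 2, 3, false, 2⟩, [(3323521, ⟨1, 2, 3, true, 3⟩)], []⟩,
    ⟨⟨1, 2, 3, true, 3⟩, [(506962, ⟨0, 3, 4, false, 1⟩)], [(2455929, 25)]⟩,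
    ⟨⟨0, 3, 4, false, 1⟩, [(2821684, ⟨1, 3, 4, true, 3⟩)], []⟩,
    ⟨⟨1, 3, 4, true, 3⟩, [], [(9164839, 26)]⟩]⟩,
  ⟨77,
  17986122317028989129908612226676944566898939073586427004886714237099175644147221287994969495767425143098199326169932047798041821678348193892528059004245482216117268858184804881413978822897763209850193902050061707206211362509853181694029616939690002445,
  [17444851251016818224083603548004856444386216861828939361091166352755869519542209399851204097577034433995987287420400142885841145854167114868842270265152371087873765,
    22681931803724617949099994836108595868724294412464419855462418391086778705702249880284826267726091181444999186088905504646423588546496872452702606613959100212370124,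
    24183168973367335549937886798951830360101905695685129960598648937530907868561151895428923797903101739886925536341582988419426097121315334333228509850068878522766924],
  [⟨⟨0, 1, 2, false, 3⟩, [(561315, ⟨0, 3, 4, false, 2⟩), (423422, ⟨1, 3, 4, true, 2⟩), (2402424, ⟨2, 3, 4, true, 3⟩)], []⟩,
    ⟨⟨0, 1, 2, true, 3⟩, [(3371231, ⟨2, 3, 4, true, 3⟩)], []⟩,
    ⟨⟨1, 2, 3, true, 3⟩, [(2965859, ⟨1, 3, 4, true, 2⟩)], []⟩,
    ⟨⟨0, 3, 4, false, 2⟩, [(7686459, ⟨1, 3, 4, true, 2⟩)], []⟩,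
    ⟨⟨1, 3, 4, true, 2⟩, [(1529052, ⟨2, 3, 4, true, 3⟩)], []⟩]⟩,
  ⟨86,
  18805162744722194141657857116463190300341354626839270111462533664594562598689576659071140092816300828728489815952921521483638081484662398060382211057807590480784633262261920061366871964952616846258549756133702667975910211133721831933058305023543773199,
  [33416484325131632753208352475549481375724485998189518499987980011526350456089283103406645416107377666403566408383611076620166029827381548660593353321266134426011046,
    21758807261157793407289931965047415632160984952553891313868615366071107259313372676382765209397684593961181485033276382282088008314967360238514659567738599096388141],
  [⟨⟨0, 1, 2, false, 3⟩, [(830133, ⟨0, 1, 2, true, 3⟩)], []⟩,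
    ⟨⟨0, 1, 3, true, 3⟩, [(268473, ⟨1, 2, 4, true, 3⟩), (516605, ⟨1, 3, 4, true, 3⟩)], []⟩,
    ⟨⟨0, 2, 3, true, 3⟩, [(1128464, ⟨1, 2, 3, false, 2⟩)], []⟩,
    ⟨⟨1, 2, 3, false, 2⟩, [(3894665, ⟨1, 2, 3, true, 3⟩)], []⟩]⟩,
  ⟨87,
  17973119395355393089838119324957083025619923510843360089293282872983261116054962707210090800517108227169923713745115116395173593917786032532085709234899743640537252580715633600675864512005853002931295889994536207897421633002641379533657079626315761680,
  [21918759855805527304694968010628710756793066986729708792876284720409714799274598548743815340665644754839309526308428541915078369104424143914899554106735009465187506,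
    27167204722574914792513346187178973479339619947280115275337222608463855436252619150034164302669702271528665255373520252070813790608228076633528662267911482836840453,
    27913244515761787951384953551526269832695804612690088795678969603679146560370512315452080623765094319969779382484174408014568206231637873493128518886853762832205778],
  [⟨⟨0, 1, 2, false, 3⟩, [(4296685, ⟨1, 2, 3, false, 2⟩)], [(17895823, 24)]⟩,
    ⟨⟨0, 1, 3, false, 3⟩, [(679790, ⟨0, 1, 3, true, 3⟩), (1551861, ⟨1, 2, 3, false, 2⟩)], []⟩,
    ⟨⟨0, 2, 3, true, 2⟩, [(3392423, ⟨1, 2, 3, false, 2⟩)], []⟩]⟩,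
  ⟨94,
  18084773510781036088537980590980653218450840680677969450048320441318030527822423888025171693615112853950226493543018144371839040231291312967334718118867825165866676472598963906839357051643999576674492170502680014057857150189129447775059657028106881041,
  [20028706389459542063498876051930894953258760228879812663436839977328706340902866333804611026780278708915788446136448681092347921903179005112192592355440484435313511,
    23177535421937515264404394455074569949566540640804735230214464235157309343703511766415943801101582918281585673433385949757726866617252247374893839568338491770733229,
    33266717086232319560593627778486432420288875394060122544727834853407151021900313982293339310389791812018403775001876867499517065876496006652739461061596309946578653,
    29069627012330183366004175294853021411985879259806330043198955435577320314136460295184945177316124120006216533430533403561170903288741044072566319883332393764320284],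
  [⟨⟨0, 2, 3, false, 3⟩, [(4160743, ⟨1, 2, 3, false, 2⟩), (635861, ⟨0, 1, 4, false, 3⟩), (4427989, ⟨1, 2, 4, true, 3⟩)], []⟩,
    ⟨⟨1, 2, 3, false, 2⟩, [(939565, ⟨1, 2, 3, true, 3⟩), (689486, ⟨0, 1, 4, false, 3⟩), (2111467, ⟨2, 3, 4, true, 2⟩)], []⟩,
    ⟨⟨0, 1, 4, false, 3⟩, [(1370903, ⟨2, 3, 4, true, 2⟩)], []⟩,
    ⟨⟨1, 2, 4, false, 3⟩, [(420928, ⟨2, 3, 4, true, 2⟩)], []⟩]⟩,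
  ⟨116,
  19364186896750430416505018616798954221092385838609195146232480851266680617770934267993271060995059633053334260963572783595239704979448178872691901480975238776578268375408397142157722208396584546865157669215998211330241649159316994945391793497727993875,
  [23763150917088825062866456905592426055077290362071548070544456845277475084052622208318300086708606060187757249213609156561378030366498100661502926166403268828008218,
    31266770648791394473898558815739908402049812900984987415841761445472899299067228370969433804166410825229533298902190055118042498634387100499100003485985625181850629],
  [⟨⟨0, 1, 2, false, 3⟩, [(756562, ⟨0, 3, 4, true, 3⟩)], []⟩,
    ⟨⟨0, 1, 2, true, 3⟩, [(1484452, ⟨1, 2, 4, true, 3⟩), (3028859, ⟨0, 3, 4, true, 3⟩)], []⟩,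
    ⟨⟨1, 2, 3, false, 1⟩, [(34660, ⟨0, 1, 4, false, 3⟩), (623210, ⟨0, 1, 4, true, 3⟩)], []⟩,
    ⟨⟨0, 1, 4, true, 3⟩, [(705690, ⟨0, 2, 4, true, 3⟩)], []⟩]⟩,
  ⟨236,
  18489324186238543760695957758712734249905897515839383687032388000265519545859438410661763306557672988034508547767937448089236616521831620986895018891949851336996854177445299396108265890081940516309115036868792060816062077549425589245160847493497784346,
  [],
  []⟩]

/-- Codes of representatives of the patterns on six vertices. -/
def reps6 : List ℕ := [
  0, 1, 3, 7, 11, 12, 13, 15, 30, 31, 63, 75, 76, 77, 79, 86, 87, 94, 95, 116, 117, 119, 127,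
  222, 223, 235, 236, 237, 239, 254, 255, 507, 511, 1023, 1100, 1101, 1108, 1109, 1110, 1111,
  1118, 1140, 1141, 1143, 1182, 1183, 1184, 1185, 1187, 1191, 1194, 1195, 1196, 1197, 1198, 1199,
  1214, 1246, 1260, 1261, 1268, 1269, 1270, 1278, 1456, 1457, 1459, 1460, 1465, 1468, 1532, 1972,
  3308, 3440, 3441, 3448, 3576, 3873]

/-- Codes of representatives of the patterns on seven vertices. -/
def reps7 : List ℕ := [
  75, 77, 79, 86, 87, 94, 95, 117, 119, 127, 222, 223, 235, 236, 237, 239, 254, 255, 507, 511,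
  1023, 1099, 1101, 1103, 1109, 1110, 1111, 1118, 1119, 1141, 1143, 1151, 1182, 1183, 1187, 1191,
  1195, 1196, 1197, 1198, 1199, 1214, 1215, 1246, 1247, 1259, 1260, 1261, 1263, 1268, 1269, 1270,
  1271, 1278, 1279, 1457, 1459, 1461, 1463, 1465, 1467, 1468, 1469, 1471, 1531, 1532, 1533, 1535,
  1973, 1975, 1983, 2047, 3294, 3295, 3306, 3307, 3308, 3309, 3310, 3311, 3326, 3327, 3440, 3441,
  3443, 3447, 3448, 3449, 3451, 3452, 3453, 3455, 3576, 3577, 3578, 3579, 3582, 3583, 3875, 3879,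
  3885, 3887, 3903, 3947, 3948, 3949, 3950, 3951, 3958, 3959, 3966, 3967, 4094, 4095, 7672, 7673,
  7675, 7679, 7902, 7903, 7915, 7916, 7917, 7919, 7934, 7935, 8185, 8187, 8191, 16350, 16351,
  16383, 32767, 33868, 33869, 33877, 33878, 33879, 33886, 33909, 33911, 33942, 33943, 33950,
  33951, 33953, 33955, 33957, 33959, 33962, 33963, 33964, 33965, 33966, 33967, 33973, 33974,
  33975, 33982, 33983, 34014, 34028, 34029, 34036, 34037, 34038, 34039, 34046, 34225, 34227,
  34229, 34231, 34233, 34235, 34236, 34237, 34239, 34300, 34301, 34741, 34743, 34751, 35038,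
  35039, 35040, 35041, 35042, 35043, 35046, 35047, 35050, 35051, 35052, 35053, 35054, 35055,
  35070, 35071, 35128, 35129, 35131, 35135, 35176, 35177, 35178, 35179, 35180, 35181, 35182,
  35183, 35184, 35185, 35186, 35187, 35190, 35191, 35192, 35193, 35194, 35195, 35196, 35197,
  35198, 35199, 35320, 35321, 35322, 35323, 35326, 35618, 35619, 35622, 35623, 35626, 35627,
  35628, 35629, 35630, 35631, 35646, 35647, 35690, 35691, 35692, 35693, 35694, 35695, 35702,
  35703, 35710, 35711, 35838, 36062, 36074, 36076, 36077, 36078, 36084, 36085, 36086, 36094,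
  36208, 36209, 36211, 36212, 36213, 36215, 36216, 36217, 36220, 36221, 36272, 36273, 36274,
  36275, 36276, 36277, 36278, 36279, 36280, 36281, 36282, 36283, 36284, 36285, 36286, 36344,
  36345, 36346, 36348, 36350, 36643, 36644, 36645, 36646, 36647, 36651, 36652, 36653, 36654,
  36655, 36660, 36661, 36662, 36663, 36670, 36716, 36717, 36718, 36724, 36725, 36726, 36727,
  36734, 36788, 36789, 36790, 36798, 36862, 39344, 39345, 39347, 39348, 39352, 39353, 39355,
  39356, 39416, 39417, 39419, 39420, 39572, 39573, 39574, 39575, 39582, 39583, 39584, 39585,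
  39587, 39588, 39589, 39591, 39594, 39595, 39596, 39597, 39598, 39599, 39604, 39605, 39606,
  39614, 39644, 39646, 39657, 39659, 39660, 39661, 39664, 39665, 39666, 39667, 39668, 39669,
  39670, 39673, 39674, 39676, 39678, 39856, 39857, 39859, 39860, 39864, 39865, 39867, 39868,
  39928, 39929, 39932, 40440, 40444, 40670, 40684, 40692, 40694, 40880, 40881, 40883, 40884,
  40888, 40889, 40892, 40952, 40956, 48020, 48022, 48030, 48052, 48086, 48094, 48116, 49140,
  64436, 101612, 101736, 101740, 101744, 101745, 101746, 101750, 101752, 101756, 101880, 102178,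
  102179, 102182, 102183, 102186, 102188, 102189, 102190, 102252, 102262, 103864, 103865, 103928,
  103932, 104012, 104020, 104021, 104022, 104052, 104053, 104082, 104083, 104086, 104094, 104096,
  104097, 104099, 104100, 104101, 104103, 104106, 104108, 104109, 104110, 104114, 104115, 104118,
  104156, 104168, 104172, 104176, 104177, 104178, 104180, 104182, 104184, 104368, 104369, 104371,
  104376, 105976, 106208, 106210, 106214, 106220, 106273, 106274, 106280, 106281, 106284, 106296,
  106344, 106348, 106352, 111564, 111585, 112468, 112481, 112524, 112545]

/-- For each pattern on five vertices, packed: the code of its certificate and a renaming. -/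
def table5 : List ℕ := [
  855479807908913784117331922951751163558439803877726080644865919771311486933842836788452745786718852985231029990221660684877587907636906512021002886074276100693731773619229373818543028630625390300325818773080252941454667631215579136,
  855482765899748208749106863573281889726227855108901885468812019458337857446546496455318175816982139728567750428512336147031222554402954035637980059483743182422298615243158493103270194317543814824863658637845853431399474161867043841,
  34327591329062889765261899437360242327499816294158794977097898618502533078169948064458804167570002599380194373913850077947214495134626624192464539779611051937112133783519490190464086948496791357047936980918153283685077986088370177,
  79432103565982905706296604723310979899932086235607098186129462092639450606212509737706487048988918675078426274527170303483113501358003508706746818112892134187584330676707687361282086317107567372060680309036599286253541534674821132,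
  204134257654682821772599990046139302884976624892595005658189262032218023153321809703257252972428545138367190681115194621773446225992508869492608646031834535833253811970116044248466386041651343052325383557960300912757238693959844353,
  273117832524337013803144225386227743289774151436093588107877516565833106987838959203157162260164681166548048454901102070941271548496601540575704379791804749994893817688456998681261117858650451439847936109294077076245910667356381708,
  207450020777467888892153694094897279382763099329491587373624491124462069798089625952979446360814329123839191516422192139676891783463884882274388158257384288195522912898459571832018056914201530845692161028757580724968529202155915267,
  204133134023201360158140194791921532205937779053849630143600934216438535802556238561928411572372343331278835165155228220220443432198709949760124439403642516042609936023585808034340340821803787755957812741136527676337464492851046476,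
  201486762622315103555005938328399959080495707426304649158334958431650494469932028533876416542713917917853855666739226961834446986634362709265080861056446842668033148570357325073538366359930737622504444706090389789105984023659037697,
  464150322041294016676596011486062550555224592756806818271458671960088373022570006977224231038064662670162948104118788362379237644256078713957005536687691039244698376240970864588693635817176888975593733164814580561703513823251674115,
  53231616727524187278051406098753954273654841751094652974852883974950360935521817375018824926692428421144505365772192700751632241408528007309474138905822130500381334624566108088132465704017581093450535203776853524344542048341526531,
  397818848807484560416329244396880412560866089109946962022307401820684067591880033395309125066095935943867918817749696076415136631022567749366084143389131178628610417812119812576637102189335037731382617742511785775391258961624450061,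
  244264127930426078471100044870169214967198793570676819603134578645808877997049427376220842612799557601316654082946958113181124183855821131521289711597703056052915254154670828743012905620499626920582732406521332017112340915317446659,
  421697912705374890394680988382727248369848177972880524646923300753260365850391901755200379025018235858548006955935375948921616109652970807052065076402129454854112279287642416788271372403399307119896646335723064856069024128105759757,
  207118028394391089787500992984753396856816525755822836969806930249036364641692944246607809309872023644718657514599890055602668287090435904593182016392580303687518113426056609941817216974691684802916245608952508907480924132248946699,
  414069693949201049760843104116940472734420341160376541068196312153736207072628750159033908754845790446673912347718283064746965079219998579993273288316983465690810042274839599708488036107128626023870851905969323799537631373408970829,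
  204139991764194501609399160617321702462227628767048956050214126320378252095134603386219433962761796815386399287482351131049061500023667636144382532203121114279555812375750211960624170232054057254086416140434961547478127007255250433,
  633956998507950084448420082346669467617238332515555294884415986325394685378225269332398939300557887374989364307400263890598562422356284540110573775550906876254249902530838118920258073876129472674503985743157559317508633424310707715,
  77442334250855497371829845704816489689988863416741656526203355832411595850163449064451184674614118046701314149151229318866038229169976674841688537637842031730075009048369555158618572832320493582463805026366620350316557562521421827,
  588851359832472544756751477494247410568089260733030340498769295645193622896129071649529766471906027851919193780986249508414471131123234281270248767236750411988137154265206436968751569398377984063445136929428027480648942091770545677,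
  268474845453755359581202229941540864742513238843700281070131066430186477099527987972965937864068118747075445379132921288823670577368486090457009881060530565784614597942249271221149545367527395937389037481589225858766633871649904643,
  612730423730364267469510455096313275248626350682401434735236560198284308865393304278188804746536944650884071838069812434608923195312070808453185353129458427711548460738021027258650286825757612157558414547492745478765325678251918861,
  207449683482668392524032708410130425113495815318378108883730000502292121875090514331797875987084474763507810077627493208643335746177588163103886784532462845657052858448131429907031545917478189336559898352908984024526701804284315659,
  608087087939187756032683049876889367101606706798678850669000014616713752256567151160817886278146562302567421757003868206014001709215954439472462726347685705648504672957886197289310382076574774363062800651467310503309860077205272653,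
  204139892131691808262861220294643680597406825385136076519230807022071351120335985158139625558399313331736807034895322818189229638320038123415573206740363143909268555092584223161639932982713536611537650640720320372772982622217414659,
  633956258763097583651892596236655592912536422194063609043881150321544405462182741212913343366876072385643199298402065787040296296139929477411034972433801486116095543248565741463416690417547607967363632400387206248287112775254291463,
  106959457887053088727779735416557688682914692962834344553852574714382195169703309639837385118745037363225646867962833821659486527718090624872097005650675007063892949041523638844558732518329802069518868031657240820362062084308797451,
  632297805442699454101057325040707924864924285717851743097396638115112657606866222187040191994488151280113611415942395772201561608861649208035318507626547918410233966855510193434125762594435218720756165573205594924692676194355750927,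
  300976841775539531707048310280119000479852312923689760156179624390245833746405878407874828012353977706751045791067839099658390845652033518420712798546759234431287847920958394197188958814077232044223255941366165370881196443688572939,
  635282688269320026266634746377930810662692082208285205713487360200717728187880400293215327170021251465461258710752341779192542413781771273003182469860590365333993381119239385040371577098263535824957817229808905525022570410198542351,
  801772828125823230354283091398135742338369611913864539476058519998069150572684901685392603913422988125356941628916869731307285838660958303025850652006880654834683511458986853274994137868211141881510928446444993630337978532323201343,
  855500628800280668367998582264296286899807652282245183554469139999245007960889211832757052348411413299624979886754343872725466702362159658313454590344802240710378119375510728987299731973760961439729908413310769903185626921826062623]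

/-- For each entry of `reps6`, packed: the classes of its 64 extensions. -/
def classes7 : List ℕ := [
  63784721130519591556617688656597112902816698725435810206553432370734581691277849292762665871376050708415064462813302340171522325726955042684188977588462095510531278147931109,
  63408477088667629965712378971315327794974327067727994475684432793045439111190430914108843755525980447052981479105927959906758938358147218597403510579448234261666057166506981,
  61963055019826580693071871352314261970057398788199037145385360310918067154764371490716372947927380184450145537148257928256524119081665768730533811120100660785363387361512421,
  56651208445974055035835922733460916003942596784579371200890551921865306474872076745791701766624352724595893241982729713864226569993211514743504471779000973071074150504188901,
  54737816882034591884399500059605037557492302875994786012036586572229894349280121136821929083128057938585792882577136911232137478509851802099063984900123953026617572101194213,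
  62940535279754365283288846884210972734664490367288127132926040728366939763184911530284884771809655989499020409785842679055951100732905331330186396984836528570557180820311013,
  60536543382219292611513129458154235754291559559904175261753259419646825854727280731954453273918740993114246856492167782238927933892001052061024611448991578027733290670359525,
  47015386890191333867868508056578949027523771777177678213303998684979177856041550377882987451397147405374131475414771897602222560395377468421960710923676303254523525546903013,
  57648538935857485676183276385909471866345208964012113352576823567487336058483004389832340925962261986000621134162380441296131396456319228037706767265282823697851357274049509,
  39296712397146164903072588268815847501894872509581728025240201629010003482944979159833294483813950326870509526817814985759966059244619229166872972134783089541171918371556837,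
  35435010885045403102311737104247068387437290141125602143339408854636578602379587588608352327055858650470227402438191622255431847442730722315261118701356679016535417568891877,
  34535868030054199033746926773758042943313862715265031735373616174962479009958463543526599323074357944287274817108193467008650045178487004548324728049254966917176125438831104,
  61588614798129890063146394563501066836315961618542173393809274415175171204776220441451297244053802350315982125398857592575698540529057071008177303691922129839932803418409957,
  53862462545252357828863750762127360637210560937426035859538414474558610893982859624186914953880436885543314828965171655758087700415996215719911701943875390380132320216624129,
  32611270935591389375469812271107607093513803429921270203688598063736572581179118944659821580726120377235873530600545621536824364211829965275859294099194095183594908002299394,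
  59670614720037939046908341211614311141143251123710964635948154800028091112508583468935029208615429381250435127301386710128575471899772669300358797887698729549313757422039555,
  44214355301910888927660907756161716444223196240414475974741829430839815524421795082855513739540012731322867736926307391678294541371638154319122074948699829366849689535132676,
  51960444566991557243523825183584801993739878211932461436248386653923636894806813554424210673667591738545313516681175449341812207331126698989851364405285439457269869849884165,
  26359694915638635957286892688718442121111334718624852893298036256831993987985701804875538950426688255846118163558873798444474835451866242754745617929557245798627677256824838,
  56264665110239292247479933339186408187010481373519850809849105077648718436466074103852214752395020366350966329739005656497750242830969279450396946130227578203622549008927717,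
  46182545021800982610610874187724659320120012121755567475955967595439538133191467866424028741880556736835568182266208632094354016713616256188078637698487173353795840124140039,
  38458196660653118961754610003515596964432145446401652563656042420854531707229985698140431109390741244654832994599318654132789656981643782290243975171413759503101213219503112,
  21555372667580169442569559956721667037498509586966961954871276087514314188865757801163501677140292650012502279960241326418268033427393029808835277021430759659084981538930185,
  50053701991241484280032540727116995572355515437995947418215240218981577754632620461748752076467787454576525875545182843950336600547930442931115801939791191480647854301402634,
  15203854951115410101769589199182276589860222362181137158107349366067665536096688868718869070555145505297199182153383239824242255203126407336185748150394949892652893129955339,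
  31278076667413179338299282698936103998759653306739413607640717833037059474084903056166462275039032908123030682600906576104896643668360508499504391874539816555549308379224588,
  58304602762488449107400102680156737789475380477232078409131724088538062661667616083554192482623700524126651374771898044927786897707640763096451248864720588181090238952135693,
  42854015480769141849613285866261743465331356584169673956000561181403630234223350473773373861032934212024179773826322159325667842539228512778755187954075869140319797541363214,
  23517851804449559577458723978659242627942468729503003291033648821793295633164186824784601441485542982639014600691452410615599913813673276141501476509983347631275302464806927,
  36490952706415282135499655498163377627108826430611970381660145413090850575270106072463075462599825799658603894956390831294308509608818590617328133570453905565236575977368080,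
  13719676092369005350041764163479181104992170615470014023876190287699774982371544299185963637143910627992059497930848069357139899253710607854688990607961635938634074324233233,
  22051615859054206296782611375145563156103080903128463783977862601754206141951799102311274759746012925518286098764504307052969750169119935782291872878188561935422619050868754,
  11252346294507027604920672308200670202749496835183424060324832229056349953204882501294618095357387075895300129808232378094592545495285703076497107553629544465885407640061459,
  10271086165957858992223498306513060634146858298935796014223724758613615558655515698414454838079970832519641318824638395841971634499767814844141410239460415632539045196500500,
  54484339186622816309609618019370490540463674082511114559293427853604273223741399761732353192518745861233839815476964341898145690116943959387042348104029387888602219556441061,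
  34194450540548061123951351654296862468597795974482237716641635597747819991439746481182163947892439611637535575568357136585339090041300827839131814199298794467584101771447318,
  61239874128424691750284933697507375409961599696412187313963141219573323868603080135826523224980981328135293622166698304346025847657305758944433779173995518753938273228803045,
  49632081562566699916898726530969525618634416285774032673009437348287277812691053513540884111718680228657636478082238479065925527828969891306679719794076570579329287743933976,
  53508768388601453625787941058785582304447248538654004373732077529467489510411760686874994692232051464637938892888659830037659624021333486240323893382172755874468612726394905,
  30789389286451674153653356933022078313923059614564285433211031580742677947345678670904652241940615065327174139214766327332725069108398791199745389385825777630865124937503258,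
  33699930660156483831541217879077154961962162509846772554754887872304394018783001834671628023546070004754987930860966884119713230966210630988406938151888607786271078751212571,
  55913867861260414005226852266270611807058774480375918959434991206788320923736704675653788878782834282907485077835735040165603792681890265553321839772557266418109129338375141,
  45237298691129764867545052962937137164726654194563405017955158005206917224059007067692490324931528661961958276889833773455103085415340054419414758602407715727212277484295709,
  28325916925682100884825372505428518607518448295022359467348041364788466581744773043819943132833378259940911339339036377481268633414739162551766252879153443540815404793665566,
  51503849061555721015869472719615206180850829862556192149789134645178715816048676757160072590434143447297448075155985194546079914872228648491555419872954377016267487934488096,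
  20520430211204093950242649496395073561377741661912336578510343712377244431085797975287827206749490172114291729962884612637486076854430186724374372275576421269789676230746145,
  62629519068339698548836074562495494750110296374817626412892122278483233262616436174772379023382211356806927221030458770882509197797404929797468961365375392713026160515599333,
  60279411831139300788012162012757937527531100485594891713080685493737519044069895500995432933486613227852837728143025946494892147531385925369862542728456692563442595749241829,
  53032401527645054591359976499147235129121511350405571150646006693320750875067305719366643404175190284655243457983221995172960965993543395668855615006546383162410935874561058,
  41393470089737674111253435697819678540371221082152564026735070573725071403996907653305348717653851800994896584644369935820635303434993708370089782916943693681551101769361443,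
  46750495274379749858189994346184602594651270963412706448422905433030224083063049824098004410018051195254365791772179102660572267630374355504366788977432820937585541241973733,
  32257422112273075841173942055712509481383227263102320525589744782463334794494369269792598756516379684251911930938936308885973172054753071759776859150412236991345395738946596,
  59299097536641341034363065222376066480555287021807153156107073213273337256518397986085411141444985866543198027293585027958147888573827801445088883716889435431760709770096165,
  49137670541198301923287880331345414920918667486409538170788128682950079020259583704883564147741903312939427101571159740927225937554171996397380784359229071235790501335609382,
  43820948048652487191022280917372825296396574891625857620134816208317119216873142935263273538721237784558861011526226185583418913811053372244823647911546606655266603175850535,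
  25451069836903401426774208703290470612228074915221323329111048776528196687068304744804722085951053114593135845231656426908091293851858000534296520848849197860474279800681512,
  37458032517764437099306196652019369826804869894199276807389694048849901150536928209827992227356404842912589869086483503044594507608178770936777401458283970529456471649369129,
  33145156524480397531914384024727871694610829412481340724768906889038764580137063779313657359517756732249930058567968661265290805784302366808423679883784457317914556688318507,
  52535075223941934848991365748081356181575202161996127395153620197546520938084838839695420450901584502198916145573933922995738086085521011044600179781421555449651518804935214,
  30293109743172658805785460619527296797107764302837789085053500318135875813447629004488693823181500890507031934934300357107812122163488998958874855845475806023172281078203439,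
  45681706913623813336009798767985398803894809219833777297126912331580803701448550292315048513436929764355498854336522280908536322280925361298253365379077555816526397958604337,
  29197951208379568984205907490055158460714447809061102582544148180602572984150607057286303051552992972056750311890897537977836658329153206848625615436051044281670338262943794,
  42294413464087072238628341986986876384503820568858395593050296757843526256685522548122520037635703094704342214749747534232242770503931615986737285759967936121855451826047539,
  27794604535480420964135525057211364454276684721636538761297486257136808950460552609600556538361647691443226874554979563600765075961621091428734645165522419986222538472640053,
  57364003547225977867991791808801235927271276161300520373392559958655324522616924044624484064368545199709352831814669735242978017563952492544257172051132864999798977894009829,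
  51056767372144272133785898375146544559579565925435935439832338257271028824503199507181653753322155599916985825329628691577940971381482631484633801146112400838521624669802551,
  48157262208294146377419605074597140928197603678602246553900782585048143129960222208140480985473463673627884917880648948599897814394811145928678938040078964502313724085621304,
  38891369724155033119902452227025152853067562691958066355350699668095809479587030893225272636368333850230987597185135868362788683855793186870248953076822035380976992721816549,
  40894354488633464505569495883385962949685724706647842929724816837291220536616736211472680820921648836063872189985418672487346566410865847576503333816447732211265351140595771,
  37924244088544333599639912304857108429679164463694458378950633810212596404829435712700453620976091418112460274335152266252205480346919668154810171113794377280915726131616829,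
  35989992518593917856134412506836406712674495332875928656433771057665457921237138393149184039342657034645990284515961250063898511204118479259603130949992617176375707667358273,
  35019190313415744012789024820396265545495604012473743512557936159028355703906830573555628326100614734578120096207923962081182938162105244005184636008556436423715857466117093,
  50531097552001527068919375243505460749374633505438705302168629402742175996444530954492258718953807100421426942633390244665587760545210935742416138179030694343141997577632844,
  58814139719076086280469139907781007860585384081279581534134206189558757048734597193310372184011329441523679920492999470125646510710382791650553304181966413025244456580155986,
  43334247009276593040683424268085800984980539600101294734295651059736459349362175102911048341383328883933895389345522804203452162646999532833087806613998048627513073545645139,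
  48644096029638236853655368058594625957106800425012316758687290275623954212726681115718005281271031644802267748664157915343376971169366406149284314057123325661455926045840982,
  47617569025463943685820319410810202485447147205994262649790503501864755586581777744394610053137311418647003951456146475428028284639171905873309606923554283170763867648834652,
  55429833389930360820320959011979522136258083877941125175650066230135717934716246699366460606441517800418768706220595930423084913686308361716510865504118505521761083868040165]

/-- For each entry of `reps6`, packed: renamings that witness `classes7`. -/
def renamings7 : List ℕ := [
  5926821483850153460081964592416063487056178088117277940419963937659332149866282164461727538654431376093201820707287888511378215883786223792792909960918753707490055300858461941796845871024041206907442321631424704662372067202582653747493643506519709167291575860513734926631802939491306340789907389250393139697149971946725425097896709193365119482762792126984146075459215587625082892918547815894468225563703341738285449757429008,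
  5432731727999190058676991263739236219959038980610744714807651015710416380237730094356270523265767853103989985370432528792128356327222655415146526018400523906722701686633161499632091155101850955281143467183759338857568856638552208094424292599014709115151165676022293089639079059487807446164500890934167711155298553511096254460856420412823258275944862338096357765167549830113290750624272313385568862593778809440057715246599440,
  5343053943908795753159235879539663740745522708426947823219889441305834393827345690578951079307305861675911669643234027465072122982103232437813103915593916467284925447711654099877006820542146465127175876825644960725799950075859206324373609413316011940191629605198292730736426598092995419403517064829502237444561939221585911190571968454063501469081120953705012149112945895939819942010726848685407962364172567480204835304082704,
  5548842351556437710347190562439744888768972430235117450565021849646015479816272838625557131197891911457553265708638386116515637188326126570004549625942675656181757211529301283438849474822279468447833412600238320303827825390098017843727911673412117891556604198891430889232342943341062547793936592380484850239541084594934980235574220848098774921628134159262821107531857758579081985966209000844768114791660491014417075257314576,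
  5357783514042306115477311107259060579091560219670913637366014818781348489025295426726048296076602716249081094266107848277251246544711170336451173369678971422727189211503361165023775298062655223744528942307575677395012771648122465570574459887727229952070870171796445125587457867948858600371388559881699953013941858659590010281729056707259181653593729921121433895453133199922126687634642725784937734435932546770901600109732696,
  5552979862147592993404178449030560646206745428634058838271053700088355584321520419769388251116635047757737159690865916436306374472168152103691393805201926659248344313530243422822401890653319832725392146983681252908700054479030392145780007795146559580732738847508995702563701907693749961751312264932073644101937918707585333670378843367740096352386845899321564715966330291169506983152996647562844389305957490076050100369835568,
  5332059960059324550156654394898546536119796769700923545934477018360106037082088702798691768241608033147334090843145250488799203902328525474491757110674804995254643861821412448459815109714082942165849196933518327950692255540708512281804577858042427548043299228650805450063732315527330315974815209655853700425742794447607207586811072676407221057553137863870265984555345173782816805036520189880775696056033238116788760284373848,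
  5342652013423611644724490696297447174435531249486640584992371951954030035876775631939888508109235026423179967938111321641957592248800533233627941363812444985066466724626589358829789744985278735571677843049412975991494730136787035945733933968784505585459252225798508581240926877852446037173496279159998902642883631680640125748804636008739892805643980748077720140107930687244539430962593714562950139525791285158622197716755288,
  5468243458367228290664089279368017340788043730472313104009106874125439132107755049325442074010422342779224375434292589087799501291496405505427671657613053134415487681004113944364518103152279114546121078174171360360756853623970360771125666676278675829006041822407916628412637343443591872326218533441090557184644613147919455375712556771470454724899618865702534258007888436851861676284565299659254650002500361453565638642115416,
  5428901566905082672416478349213830154495901538355928646682219849223715720023749133729673235570530872531371166784918337076390654609343922000874085047873215559520184348956594511963294555532341753807261464131570250231365043553944333178438383596989918913266900766298552022352463493788661907997114685531727801760105540783664526645322197025171758552113689186044658096592727335297613422974130103119305686859639620852799317521081176,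
  5674031867548113650196221099604561113450228518699773159412498743711401529925066035740014137391491644157761945993050351734730711837147215405979238060430216950472815078337088868721636993812449002572582603297894632636886873688730707497243831200989276219898566126238952703783917097186819290341450345219018510959800063307323746985572955181147377112847192764878998556598112410236434203042100369129077209191823618828407032965112664,
  5373458802964293684175126768844261455898479379239354995868332320982652730894485450658278732035253768158854165975887133505195025517994716291403513557125672900231486662126339850445694754307775988312953318175205159307767341126416410191025588209190611560014184813260449891933171299973739300543885032733616241713693097939917940558549767480364805013327659266037519207613265257517818152197609775393613371958759576976665433980898576,
  5373458802964469808501703996207016354186271584240364580002290099034546177384493871658627981134946512479488846222313359714057467412141761210297468594732053829891871695155833968613531771514356667188362805314333673139650901777457550766119572311247892230344715169221552033385477825081800882215826460098356134838339081721578403952296901637100519636985728857994963221485728372562303807507452821029020507838328210747055447196649008,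
  5333927757598144906477076756021455107880108513746709649801694347536518926115829344405976391018413522148494126043134553403004720077555064023842231621027018501895711635759045575913578475024659741226868171377783603370050682522721268176522977030027937281144631547414052502718304728859947955111164404648626636703758481090274251563439569400251762049823433073817033798288607886259769069330672915235693922848120913623209980120632592,
  5342817514211389086836102072791258995007109962831616361876881719609540929156009753735977396379604183421469751011748110227362969679249581475619271165740569644237571556453007712787378495642082124742921427721311162523554859124813591615397792865761929254947040403788016337361784444389368538423303417400433350939258351344838385977635168501421220891826878546752159931037519500644390918343490140587354844758944370450107437210242320,
  5536500698997002557647033386281449001542779224646343886854442204154084436731707731878364062336062676650031333950880276591025830294089379773823786640115532828598578858688391698293227686334940002464113571499738552866328408956811783459044369539319998468635541326792043564783917498684063727794259854399435671881247812190594158232939000159402266570714878604376071050442073251852206866260633920820870524712288995444911973059628304,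
  5330712290582739039057499566266567050827152269895979907052567376272290112393564863244382297851183887631150892763726324640446008770095023526999174470556693832274000123998633283124813799488277317133845321506352062523456272047551279356334603174776406978883684249702880259080734246064759415129780237461708057222617347985435278056972229227105666967824960955046741886224043510481409521486247385690644868677666307712192928554519824,
  5358327302345791959692196115822449224849674293719465252029228726442692325888702362012305396366970165337773939761205014004917581395646836142052182274838550637783025189084204534001027885635438572747031487091747358282473331104566067469406185398696809137145508866193585057315958669569841396040396137099664276910458946670664219859110330353150028571962245159363960779633978661892582539766748778025672865231405530533960158255877392,
  5332036320020568897968964086186775336061007132070274898347044713025678955226752203013224005496208876459146087399012123305218074647453098618330711914915177249469476758489630370827858785779273762698264616885999279945467584526602370047191438537257390830931803151883844136547386282266043908558312647985440878163806749372176752171848910076376456348685057058147260288100853431224726861492372391538440584198714542475223881376697616,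
  5674764703511064239291635600506958966899537294250194570209450664138966233109681540321423123599251250914484484304098487689420448697187426839032309431934570533210415122651631610298278594399625152302325761869220506718727818546789291424044134663275405678636075522752966153982122838314041645172578133161078714877642447315430304571267396059118935652676288096935629321937651834533494254369338423268211688449890925024169827033630400,
  5468219825589070548203702686988484531252044937754356311096222545375893155337655464801389889232206791732664525467571341283311486457355076686580431525167576230103648036546303748221896315953440402267568950016295174523888434158447372166146649337616853873344082668898875629367097987575826701528285406259149950996562327927359674335674436532625943807287670433162178591219529453549608915593704549112281166767909950329613900192255248,
  5548416778868158451053157152592198738897629294890181227812010840654864174236289693099498202969565900581831038884146009379178175186511689108326561703892686308517663312686454499479105761262930047247577595320730551250912391032432883677498942817951678060049314519371390969643787271302725155305084544219517023806448189053327816030189023860259509328565453071998294547410707414871482028493201734537908542597749452140282508385553680,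
  5357759871072351837792307194642683794016954441574834172279083773713393157206834934134178825918873479239782883552712719019245690398727101610391356428603271747484139811739472437055877835150972519769545399511545936382251464866729084677986332349871779474263811891048693427773121581924331613524750401067900375967898492482233052097943875053600479247774318052927354802697605740538255330100951957179846270195175088249371379151244560,
  5484108036964967801073886010379654137095715681241332678149220713680733536155831717178372391740274738887181843480256277447903845812047005277295493116173384938399090711038699228284150520300294032033038984032702399870795974881350795668832293651526897564768561930797750561995083313836154345890910698335371874132881308675446642595518181941459524656426364856393924301179085466017984573618794974224673633524485543460143704929832208,
  5430768573702111529103497855885158052900178999401353624380633931798308023965987853163412027389538085139390399425332329960719416329708819148205640384810637615597667329168340781753542670764045464126311018089493547436291410923761382481079124674258328888545535529558849056597636665653958048061424058692810422762222007894168353200114003683208914532053861335452678315364672655024726545651049476008759797651764716004291034180062480,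
  5358327302345552932048981508494267839042624477898667763619545560696804233201892952655537678823084154070401523149549603182504111214116284854933973585171717950104523224391820919651430715695979798190483905669879403184886116702036124342707821290557231413104290908464318227892512575836139957949645829918364130470942678533188458647719876888702276116896521489854040930876971734702010401069897237768179917841478562330774726252006672,
  5458384241101160568537556079030009818457482403400859726485560823407709496731264915112246239129254925259435938483105931611972124254551906224260494296273930695709467948550657121956692088249764256200972282421769640241793118595761785550359484052547284032664316553426117993597689973840528082842654901492630788361205179047903532865084604572840186298545735551877859096245811112971935509038348063395535359031217722418995439527628048,
  5333927887191438340730817450343682056120931083209062716976838821192818090249758222918728920361893428912598408526987574134074320494286726277950229422901819167948363116443659043333807225718645149331638773279875882568142430468716439457872828360642917685435431891543596904144394691854024669603872396142925438366621994366021258051229788256834199851384614492544726995736695453101604621286140422890801235221610763695149251590196496,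
  5330712443309700376972368938883409123568421200617098692993799486422095530512567423075579612096949104062932625273679437985249751556317799392407683259383799718281495809652124177123199924609728920646172269908201068825538907455737959443877323050070710904719731890254084424418864688255560283367143488841063583641073781836978705549413768718827923281080228051587720411784164086931381528283319287444870432290138623079019630858439952,
  5674008366121968943050446056607650650408176435927249295541355186109832180222252217283392456099281333018883445403360998423510288313800743654087288853832999584991138744717524907298804848088518076735231853024649077233909148659985315014092861265977245587798343467979443614228297015169571444802082316090136696333537312243548216295084414205742885557470568020487134001545641002927090496347815583158714690926999099483594735758970128,
  5428877132517142810924003401340422241612697157139811731281961731280850682812415229946994025750693570146372852209826003056997464800381098828661769670026447549859978043214554206206654673540400209565233683526203355068131138544877160100884446577734229111893516482363116198259243943122591636114172598014976547330795552666431248455442333968760042209377056440955926555865623681929641989678849885227703999649376976948472848718335248,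
  5347735413974411185461091217743463109576512670883974689500351672925708582665728728270172355812517819248061186897016869935884344534596041748967311186476726123413990607268079103903714520253383117696142620221147891642259225364730503423457684660003257596284844828935487277765457925567064796729896195261410960562449172963378648914522611371712466389376783922646574380958256514063009751264005965286877076027522670286106519642934544,
  5548605220992647997399806934962695586939560594849525495830820987514519392747663041982112086110825761066307637315798241099081617007217476786078936471484352070086882078962444455582666527540726615137832330949251464100556906582906450184140886221689608446652937721284321414351148205856778111180789642323077445900559824074002158430541687028171907819299608982974089756422829428318058785476362972111393431689616180426038107190955280,
  5800356023230779198552083902878116285883404966332990636811867228968191128663218395028352708891441534889622257573116605513455254932347249147415609466307260490686161625155183000061078198692318391833959970231050977333968337146283280724059625793519809502420675158287279926568493819214810263099739316589897597145733184920090114486241285151844568838957050716346787441046539622933225769197400250691800648625250344929785548046175504,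
  5389252459868338085220905687617741662721547081361130451607027988805978190982468963151857043206086294005100352537017721386553999555175103223437276235630379870892101620883231094215986804880267155324038321277801877470503870181248788108223876074633651095572195129206175586821942818460585347864255215103581365550673675847430764337447902521803167679191467585091307787393497947878208027005471804687141552226183549906726503882449698,
  5335890254128880898512718093901426610697273903623978054987592869039056892372991931768435719875563145037544445163193393713078874694214578530764762976764587899186101440742548146224411672881730332760865211350296801363341971859910961307179280953297058239441427075000512221952371173059114323641541594761387370357064514744720596565381149711634497854815560278052677622000012781455312292006000200668607844590266912589057075065490704,
  5388850508413799503201159547566367183197571121623542370106430973814996735090485598065480502683375654708277437447190182151170297231758560346620468829482389697011117523621954310432439307495427432650725353096645798524608511995904362745692677079394643970889748712108719937978675409018948771443151048587158554630720562228153060140732215480119847624589336656652786908402590443753585526530769049727876957050328280243319425104824000,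
  5335890256248364038858264814474301975292814184739257522363301422521887901621110608807820803822592589547110526613868261103077277642068188808963094844959724303661533006829137763180974967620941769710456790921731544432325396108377549328903205872453496414616516058046966945032180601584514050735493038210526248619271759708810082841834519638949816616255213598326227050389325817572027951784778149568384089630496711887833886115597584,
  5349674104707100338117065952387669565411848648861182977492191135359195463999024700226875597910862300174928017144382916223228707495700661005330450354289601030665269098083569767058455621970464387098551038026828652826793682468773414715994541670987637010925552206552522833351781302025503825342486152326495953363968516205304087971063331321928211519065594602225249121624383514362578938294427537458012660512581514885607566779714832,
  5330948872691199994045081933390156185537840221293670565806988536364284703955703035728534178896320508701769687037200361873388242859397995643070711307332109440532974985202772444993338239416349037105414616301944917863499436862553966852591901355596008642654913712553071477226814963406617973200189434975944327740237812431123706463991772007693863459428387441355315955250046798863269379906783097462572222313317457517196297062681872,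
  5358611150146122779796192268606001865419763382274009945879632464799445903864322702062000209978936732156440356554607277621080473312047285183540505734678047908746366134437388871899725836903879169119396083698282463990767636150919196394297946442943622169123819150548698108720141930504305735471740448111493776956075467812624297669195286459754121542642211922861790382658761610504319155481695241383509271185755797474235897982848272,
  5674032058200562723483688794257760919243001824525293444246645723455406616126729894498300204299172364823849198095883245945923340338191318535016905000069302431032864715968081534575548497371745853713555806218403908887498819765772971499300444397227492090016871231877164536868410032402232911790114431974613635593650166640241515680439360572497148667213115075333557903224332836185213947849735035741074438289180187149817480479983296,
  5468243600722519275193766929964336415063799309532599852248360653598789418191396804549799567165029330518888275397867018468194604696661518799711919436659753697151215806395356447306891664696630760772428898007098439635799934377909682589826394659346527023486132971509276945733863843244739497481925892971320573097528659357810192491384704553024758824587702828593005640206312900950177667731223435701124487848529218280777860710239504,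
  5343054096275258519050674667272675545582516411714213343908949117525761859208088282635060897165073645445633250089863038467734965064194366036211153738354509689140039720712860198765960081504165165105163437216769541208091392874164613530929688430396106528026577000693596668709114901700877159659044081011661893532480922204914132242314437719827664816564798387351808852476664890853339953812622729376139386147499760777172886391983376,
  5358540221191877257048789783714019564398945389945638412227430534936419917795662518566301334704009815790098834560457758538899818386685634284413638903252797303032700923433118300223968587861504563946640963217514506416844300510038002753264213732984567686598707325800129366734119134666738439771441196131264464862455923218781272567179962439579323806887020433133148300429502563870140474295699611169934316935396614276263731893996816,
  5332059171527206114767674057972645726432660711324975633531492787545708543399750476228079928578393830269526013610772645719477764597783404984970292893273924833506583710276614321561826432642960603535415175266791661440459221339987114084979651414332842484774905725725386181172976902921542648879048106724411906673602531387050045419758541454057790789169433048990886793988569782338721346613134910852677124069481380834028770601307408,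
  5679421418616394560681035028319010618604096871606706100529820062542341959645700329271238386092785020317230593533493132027658193047373112538398950962730173924574227466471145011012947755299720536847468687678433106177884309649378981983600043331552334065906605878422091254240775380660587607472194999504909517627162849844860749337276365896850834378628473502671597644889624578924121172594544961528705703150675568767570393428084560,
  5335890259810899422561565582118070968477810405488101547894072923396884031849920273857143201591695163391051844548229321481108031218892715765622378047041257652251559091906161975460472382050295607771432697345830190186827815177208127659669194609701843659939144366035673535277448268235783285231312974365253622007540069635052487250995160397465500911760429468409865422611292090966463219269020521464727906739837327295452548332004148,
  5330948878779341322004996696340654023020883533236211792526947978166186073129135442297385363324015384325053004852870091773047593921435799172450218110034790440139023213025558803997175831335192168593154463995317683980030872335991340772602494468640913152715378742536565726967908491738651385312478978966899899343950242619364856971864678335135486120924360258338590896928998163852931508617915088270022339163899742589623199566499088,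
  5330948873007131918489788080787599103999074330065498990464972699307404955072637981930595709255544001584710456472868176953134685396593514332075652640560476714695324331823368045679462241827081185922148938335834276477304952261695937223264740204013531717707618333577339918265061985574342190498575425654354785598204153485865159819103862126862652618862366993013342628218113478486261626772801347532174052469076102098331703845424400,
  5358611200247096586640792848634932946255857004218453815229000549104107615423975876250268644935270352515049598399721908524752517608507542737098999254967197966932157305962024942729453362939397724672131867005741504960442785035213590531091771597679145633804280108677425816645941383526268956617132747090746594538802168142978216132224688320541561025552128740191076840576355982366586427259244763729160459470853688860178969197757250,
  5357783695224722394397281695734645756978165726076271869531682681941864517611782771611086845314702306892359309009676103517646826318865059522128350292623463210848519429582992485931820107948891938753167528120149232004963837689720843276705525969020450319003368438691894815180395432634727158731288776930950977652575389573825961810942673139790353847786152100164550990370863972558491461904007657515490848688399077553798195226971408,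
  5672518879232565508020666176859957501273349460740275463235041096927070547112423059246465999860976685939194337213300734112839588856261921562788251845989080862771527772625440781912398033572971286440282620396125436370594984108574215935697885358205969145940018297418164164129180176046536920109660165384054885855010052198075784528247559630244740225861960304926549721304321905330635029768087453622791518300763400696888411190299920,
  5332627523857019263147313057606392998393997667589428919042525805436902557880468312141228474507162323951029200539428139159436682855123092226038123869972281801646148230701773851064694970359559343531884970886519213748729383336881970043776822984205044391761423179114138675135460371894281520415938167298148285152501295284128550125549951240817590972401880545608532452605809765937287608007490165218089701978630915334368587769285904,
  5539361673788024852291120483012564703716231546250145731447078991246827068266291235089195103422653774936102574323992495191940597802139665076144476835714681513012129052164648053955379203894975191901260603079604104798418660881788139599444286618443483580168101962720772836557672607210026777902742681749414767522894451032610801814036410130259638931918547946647089397241195527446816664420546854266705395719862505805370805565361424,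
  5342652165744714607023669755849943524767406063897962817112821902204433120303111037465452839497332226198126414043266884304462965158147567094052386064602466381890211581672028471139059403271683658980814884455366463282407590341785045506973152950553228052689253247893024835091887935530265051117937121383327501637681472166892178447365301668359258338481643484116636918614951285489240220613440672007069851772449304949381591586934032,
  5672518859029816081340898415137889390814155280116985691650401328795338072784789342179567758330272672677788483452348693364288556849920013546855032363020897478445100911748202309431326329160462062288829863940921254031716591423745918758426710799072045305861832284511570275206822120640646458160525039244353996048864198932535846467087540455766856536256826523576837169347385463723009863295150004881793373577836796312807740739521808,
  5373553510569621269258095179730426972985403255777920446243889359094294400675292179179447913468368988468306829476977046865399532796035197159848618689074518555628216477975635950329656508101973021052013614369495919023047383504564002261489049613946905846279898150699615528921933164375577995597521220501128866657625427312729467751615471740607489502852577525653840566328914946816707249518966143568109621401016193402187879839796496,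
  5362015735214892538894646131804728079528663081616376112683892808252057387109663337545659614232966388312449043785136645890660420740845677873483222558598196358040677253209781653075644062661200256950919396996419754517539935480564702038044695224947783792688086099331737633522234378902510999612594082461923281996093850200157608749307244477707037489415305449292974288160508565184942016171946606869443235955492623607156195187854608,
  5333998816100588509766822045852590018442096292761187049008508938720776018015226271110739517904674486810690081531962111096734408207843773548022202755274318655742163603722633954138395771186898094285171783216160216688681997938326520579506282933529347062238648587631766814532584383556190550564739578877326005965255009353292132642201224351255089927568003558840681452139646525149626473706161165168347583546436664405475696758328592,
  5468976532738641281214874605685555814624829351276638897264118055892223785375052200236982770067391448632725086861643667054781390186277213778341619719812630351454788639855245953483565755986417825021759038294346756762736190352070108939089150473913139211450495247072195902175194202207278003685976153561261807433309946541972057305951639195846460028059536429931282080477536781702920810502726648866411672389335790534448065067453712,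
  5430768570094745092352525657889771467519048415430478335657669964891027723642645183758396279008657125086347619427146616022577351939135856445876782587467554557031572589769293150398952388767569147435292342947630515267491940411654052445245010972704102605427718958961080521053671460054883152155928393433913186771123056891739316238879049834880068383002757191529873637889656922246273031427657896220649797915342165687868046366313744,
  5552956358286296885040277007085816117164147700777653782306704051953982561907249456995728586763118695010594256221848554950877021296343595710960344229930475677262258204854559896278933436596767050686360733863189287434608396356465706922246848004639633357398727075081025239451311390201994201131105105867932597469378136219533742043817189827012176307054540804254026740308964862572556641752829899331133440814226651946533569091177744,
  5358422006343293684966393226097688143082223855974999685765913014710334059002454458807108387878126042064095746712035942408145397784517950686835628904117349638884827098337997064741945383640911199955146450642461709157818697085565250315885512672319197639469415284883113709524031735009699105524708640246451704060741804611212398120802520029687586459655558746861179191055015365806038110791732850783528147662079533529344439221587216,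
  5594686232665749060129085020063579318650126997242705244982791407518365428721882387340286756386610218713520725016369023082699635127835348520622444298562640177481209206909032673641186077608989424708292114816555107942950266329240284869061904646591534843467956925695351209893304166059634712249961909095539520108693027921184534110762762147631227488161223802783837599041185983054312000154859883535097482751133418694817189613225808,
  5483729749449512962752154453881367068419230615248815222611437201669363439501594366265154267189997584471219519392366561439097314934920217156216012550296961280977164574550194381612629025058567747063975679841010795657218609105143365227211571467166138964845388326805625531362590440943613306759961164590305674737801550937112895682093529780420956062518132931725315156733965620969086884270270946821135556703877505392314079530814736,
  5343054105970777403549839196509280887445229730062487877494666911550321150153994350356465361874558901254292615739307670766668735814174028336870198618187833178116980099593412245644335179462985910379857470609888466022094414412934316409172848081466765494313102973264669296665608725288001624505204755591604136787522740204703496801848247712648440161780159969770593641733780905528539761423756236234031382877474366295931318045084944,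
  5555344321677299577372285406624493099058379189769476001736612534090161082716700213886410203826619040985186907363936264192652365850581182927877187308603652062730945094071913843503236364042656182913081640075887545645222855262198347992127052828490232545446004832586591179814460424533094071494184932169360703526345372336379277953120968719343197462013688447570482948042757135590772494709525680388477331248914967696900339070617424,
  5465571945820976351864750329834236401176941387407725774200446365481775539776025860451983127083572548500247367806996926751029272125846555191801837375000778081536104656818899619502438321183286046933106574887128553446391213393861051347623421340536846358278301369194021612566929076246367650440506619437949613358383187089107107356251168272986761849816704624906286490888660771998377597760984333436697143379100139383332742700043536,
  5553712956406087762579599644220984394228479923003496640188030518244640792470065116615482082307062079275807536751567945155940891166546592853281170069001677312658588990613811127788253607053944974347196625699522610686161241226435319909348688134850444702181469326078749838168378042637782089610762980427803174602238069377726774904083710059818762466161150427400527642278687458914500251421220519348818311015615052601286731287072016,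
  5555226106828703436749088594467778377265425414160327337207184123834496246555841987307106780540303908625605243152974086991780471099139875028028652579214543333852143093836090808665230788957136889595359466611894055653783388007536774890851254293059302891042090466990355368948469342074533525638143860647238850618368792530097911249480361039880757538779558751817130471592910276965658711742985839110106726297876864469087206870715664,
  5800474690143804206136751496959754206718864537985541398576460948149294061755406167472186197697053511623758875944210772057234928558793112246452780579441045277098895119822782761550744270479075189278739084165331527988153452881085317599986770937431214963769516218772272606446519406012867131245148692795177022678305783997945607579831164975995165261470204400900282794693008799877147119499221662410371433067577881021902270339696464,
  5389228793809782296824001066814546705218132240701069835095632989145469447009555631379883704365767303260142324531181035699155278598119230423935512552287133322350817186587907770929755170291214375664558730444350949269800780833945380148483286777826560859844192371394951903825837550283847034274969556583679290034458326433505674227344899019834804323522150361252115921072330581819461229796184129671637217631212033536742950241144080,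
  5662967145487057745937927103932361258763248604693451777027982536684790182939692332159494074300027105504496739844080593603027243967281492974363029291740291320505190432321311303683137860318313749437331316051369633508927117994331717563773872671684980782980568858206325229596579561753976150252528729661077167789399364273880909964294208265457362521871142117794062027655604369274684422329483837357621062273848338159771781327850768,
  5335890257330652603169926511295598105989927639800760508240821087450077786213596575104521429141631163921025850879277352579418946315193639846697352826514736147433683717619214813045225905378578203982216969262241371291886387969071065046455393780675691728155636363634537358792697633213465459077255145753371135015516434776237108388733432706084338632598360358786488855998770947392426929785950048917843929913657878559639010270350608,
  5362015783963004766852184484189097327745550565501533419264232987111856946266956659606761284278721384754719229684882450444235433285093762190714228001662520428162664807882376123630190513889152379329976405326441143835239577776583549645579866740124680032995081119068506054808357830572020011899464537684635796517802007579691267304868031096925514380299838115034191449992357904569245523599935483209175465675599201682154796166253840,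
  5484746397282605222275656192792673835365920841202380481163695168810459601498144922523030945952264525697361864644646820247653365858684799878174488213176874209004394596057180503258808863834873747969206605632279128294593553078689314809505525506694948919983343946301142039725653067374822650078684333430002190317551365471009625891440571088449622252130760932783488072635668977186271329208432706472099133984791219632549185778453776,
  5801231265355120542419593953337480504186399121687185263299107663864621326553264390570727184456569573725624008440923009188046926881313054921244975056194637292237669881634353294258352168682832247858576238688242615679742180760711912394388596205449021102955124662768711725864706448847361517236866801340733933266125096245700526914218424947640962330519399304156262272314877962368490059268144609478184349526331665793909383637527184]

/-! ### Reading the tables -/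

def permute (s i : ℕ) : ℕ := digit (nat_lit 3) s i

def gatherBits (s₀ s₁ s₂ s₃ s₄ s₅ P : ℕ) : ℕ :=
  Nat.add (Nat.land (nat_lit 1) (Nat.shiftRight P s₀)) (Nat.mul (nat_lit 2)
    (Nat.add (Nat.land (nat_lit 1) (Nat.shiftRight P s₁)) (Nat.mul (nat_lit 2)
      (Nat.add (Nat.land (nat_lit 1) (Nat.shiftRight P s₂)) (Nat.mul (nat_lit 2)
        (Nat.add (Nat.land (nat_lit 1) (Nat.shiftRight P s₃)) (Nat.mul (nat_lit 2)
          (Nat.add (Nat.land (nat_lit 1) (Nat.shiftRight P s₄)) (Nat.mul (nat_lit 2)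
            (Nat.land (nat_lit 1) (Nat.shiftRight P s₅)))))))))))

theorem gatherBits_spec (σ : ℕ → ℕ) (P : ℕ) :
    gatherBits (σ 0) (σ 1) (σ 2) (σ 3) (σ 4) (σ 5) P < 64 ∧ ∀ i < 6,
      (gatherBits (σ 0) (σ 1) (σ 2) (σ 3) (σ 4) (σ 5) P).testBit i = P.testBit (σ i) := by
  have hbit : ∀ i, Nat.land 1 (Nat.shiftRight P (σ i)) = (P.testBit (σ i)).toNat := fun i => by
    rw [← bit_eq]
    have h : Nat.land 1 (Nat.shiftRight P (σ i)) = P >>> σ i % 2 := Nat.one_and_eq_mod_two _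
    change _ = (Nat.beq (Nat.land 1 (Nat.shiftRight P (σ i))) 1).toNat
    rw [h]
    rcases Nat.mod_two_eq_zero_or_one (P >>> σ i) with h | h <;> rw [h] <;> rfl
  have h : gatherBits (σ 0) (σ 1) (σ 2) (σ 3) (σ 4) (σ 5) P =
      ∑ i ∈ range 6, (P.testBit (σ i)).toNat * 2 ^ i := by
    simp only [gatherBits, hbit, sum_range_succ, sum_range_zero, Nat.add_eq, Nat.mul_eq]
    ring
  have hlt : ∀ i < 6, (P.testBit (σ i)).toNat < 2 := fun i _ => Bool.toNat_lt _
  rw [h]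
  refine ⟨sum_digits_lt 6 hlt, fun i hi => ?_⟩
  rw [Nat.testBit_eq_decide_div_mod_eq,
    sum_digits_div_mod (w := fun i => (P.testBit (σ i)).toNat) hlt hi]
  cases P.testBit (σ i) <;> rfl

def Cert.entry (F : Cert) (p : ℕ) : ℕ := digit (nat_lit 26) F.classes p

def entryIndex (r : ℕ) : ℕ := Nat.mod r (nat_lit 128)

def entryFlip (r : ℕ) : Bool := bit r (nat_lit 7)

def entryPerm (r : ℕ) : ℕ := Nat.shiftRight r (nat_lit 8)

def class7 (c m s₀ s₁ s₂ s₃ s₄ s₅ P : ℕ) : ℕ :=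
  force (Nat.xor P m) fun Q => digit (nat_lit 9) c (gatherBits s₀ s₁ s₂ s₃ s₄ s₅ Q)

/-- The class of the pattern on seven vertices that extends, according to the bits of `P`, the
pattern on six vertices with entry `r`. -/
def classOf (r P : ℕ) : ℕ :=
  class7 (lget classes7 (entryIndex r)) (cond (entryFlip r) (nat_lit 63) (nat_lit 0))
    (permute (entryPerm r) (nat_lit 0)) (permute (entryPerm r) (nat_lit 1))
    (permute (entryPerm r) (nat_lit 2)) (permute (entryPerm r) (nat_lit 3))
    (permute (entryPerm r) (nat_lit 4)) (permute (entryPerm r) (nat_lit 5)) P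

/-- `f (classOf r)`, with shared evaluation of the data that depend on `r` only. -/
def withClassOf (r : ℕ) (f : (ℕ → ℕ) → ℕ) : ℕ :=
  force (lget classes7 (entryIndex r)) fun c =>
    force (cond (entryFlip r) (nat_lit 63) (nat_lit 0)) fun m =>
      force (permute (entryPerm r) (nat_lit 0)) fun s₀ =>
        force (permute (entryPerm r) (nat_lit 1)) fun s₁ =>
          force (permute (entryPerm r) (nat_lit 2)) fun s₂ =>
            force (permute (entryPerm r) (nat_lit 3)) fun s₃ =>
              force (permute (entryPerm r) (nat_lit 4)) fun s₄ =>
                force (permute (entryPerm r) (nat_lit 5)) fun s₅ =>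
                  f (class7 c m s₀ s₁ s₂ s₃ s₄ s₅)

theorem withClassOf_eq (r : ℕ) (f : (ℕ → ℕ) → ℕ) : withClassOf r f = f (classOf r) := by
  simp only [withClassOf, force_eq]
  rfl

def Cert.check6 (F : Cert) : Bool :=
  nall (nat_lit 32) fun p => force (F.entry p) fun r =>
    cond (Nat.blt (entryIndex r) (nat_lit 78))
      (force (lget reps6 (entryIndex r)) fun code =>
        renameCheck (nat_lit 6) (permute (entryPerm r)) (entryFlip r)
          (extend (nat_lit 5) (pairBit F.code) p) (pairBit code)) false

/-- The vertices numbered `σ 0, σ 1, σ 2` are joined to `σ 3, …, σ 6` by pairs of colour `b`. -/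
def bipartiteCheck (σ : ℕ → ℕ) (b : Bool) (g : ℕ → ℕ → Bool) : Bool :=
  nall (nat_lit 7) fun i => cond (Nat.blt (σ i) (nat_lit 7))
    (nall i fun j => cond (Nat.beq (σ j) (σ i)) false
      (cond (Nat.blt j (nat_lit 3)) (cond (Nat.blt i (nat_lit 3)) true
        (beqBool (g (σ j) (σ i)) b)) true)) false

/-- The pattern `g` on seven vertices is of class `k`, as witnessed by the renaming `r`. -/
def classCheck (g : ℕ → ℕ → Bool) (k r : ℕ) : Bool :=
  force (Nat.shiftRight r (nat_lit 1)) fun s =>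
    cond (Nat.beq k (nat_lit 485))
      (bipartiteCheck (permute s) (bit r (nat_lit 0)) g)
      (cond (Nat.blt k (nat_lit 485))
        (force (lget reps7 k) fun code =>
          renameCheck (nat_lit 7) (permute s) (bit r (nat_lit 0)) g (pairBit code)) false)

def check7 : Bool :=
  nall (nat_lit 78) fun i => force (lget reps6 i) fun code => force (lget classes7 i) fun c =>
    force (lget renamings7 i) fun r => nall (nat_lit 64) fun P =>
      force (digit (nat_lit 9) c P) fun k => force (digit (nat_lit 22) r P) fun t =>
        classCheck (extend (nat_lit 6) (pairBit code) P) k t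

def grow (a b c d : ℕ) : ℕ → ℕ → Bool :=
  extend (nat_lit 4) (extend (nat_lit 3) (extend (nat_lit 2) (extend (nat_lit 1)
    (fun _ _ => false) a) b) c) d

def entry5 (a b c d : ℕ) : ℕ :=
  digit (nat_lit 24) (lget table5 (Nat.add (Nat.shiftRight c (nat_lit 2)) (Nat.mul (nat_lit 2) d)))
    (Nat.add a (Nat.add (Nat.mul (nat_lit 2) b) (Nat.mul (nat_lit 8) (Nat.mod c (nat_lit 4)))))

def check5 : Bool :=
  nall (nat_lit 2) fun a => nall (nat_lit 4) fun b => nall (nat_lit 8) fun c =>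
    nall (nat_lit 16) fun d => force (entry5 a b c d) fun t =>
      force (Nat.shiftRight t (nat_lit 9)) fun s => lany certs fun F =>
        cond (Nat.beq F.code (Nat.mod t (nat_lit 256)))
          (renameCheck (nat_lit 5) (permute s) (bit t (nat_lit 8)) (grow a b c d)
            (pairBit F.code)) false

def weightedTotal (f : Cert → ℕ → ℕ → ℕ) (β : ℕ → ℕ) : ℕ :=
  lsum certs fun F => nsum (nat_lit 32) fun p => withClassOf (F.entry p) fun cls =>
    nsum (nat_lit 32) fun q =>
      Nat.mul (Nat.add (Nat.mul (nat_lit 19) (f F p q)) (f F p p))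
        (Nat.add (β (cls q)) (β (cls (Nat.add q (nat_lit 32)))))

theorem valid_certs : lall certs Cert.valid = true := by decide +kernel

theorem check6_certs : lall certs Cert.check6 = true := by decide +kernel

theorem check7_eq_true : check7 = true := by decide +kernel

theorem check5_eq_true : check5 = true := by decide +kernel

theorem digitCheck_weightedTotal :
    digitCheck 64 512 (weightedTotal Cert.formPos (binWeight 64 512))
      (weightedTotal Cert.formNeg (binWeight 64 512)) 485 = true := by
  decide +kernel

/-! ### All patterns on seven vertices have count zero -/

section Main

variable {V : Type} [Fintype V] {e : V → V → Bool}

theorem card_copies_eq_zero (h : Sparse e) {σ : ℕ → ℕ} {b : Bool} {g : ℕ → ℕ → Bool}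
    (hg : bipartiteCheck σ b g = true) : (copies e 7 g).card = 0 := by
  classical
  have hσ : ∀ i < 7, σ i < 7 ∧ ∀ j < i, σ j ≠ σ i ∧ (j < 3 → 3 ≤ i → g (σ j) (σ i) = b) := by
    intro i hi
    have h1 := nall_eq_true.1 hg i hi
    rw [cond_false_eq_true, Nat.blt_eq] at h1
    refine ⟨h1.1, fun j hj => ?_⟩
    have h2 := nall_eq_true.1 h1.2 j hj
    cases h3 : Nat.beq (σ j) (σ i) <;> simp only [h3, cond_true, cond_false] at h2
    · refine ⟨by simpa [Bool.eq_false_iff] using h3, fun hj3 hi3 => ?_⟩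
      have h4 : Nat.blt j 3 = true := by simpa using hj3
      have h5 : Nat.blt i 3 = false := by simpa [Bool.eq_false_iff] using hi3
      simp only [h4, h5, cond_true, cond_false] at h2
      exact beqBool_eq_true.1 h2
    · simp at h2
  rw [card_eq_zero, eq_empty_iff_forall_notMem]
  intro x hx
  have hx := mem_copies.1 hx
  let τ : Fin 7 → Fin 7 := fun i => ⟨σ i, (hσ i i.2).1⟩
  have hτ : ∀ i j : Fin 7, j < i → τ j ≠ τ i := fun i j hij heq =>
    ((hσ i i.2).2 j hij).1 (Fin.mk.inj_iff.1 heq)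
  have hinj : Function.Injective (x ∘ τ) := hx.injective.comp fun i j hij => by
    rcases lt_trichotomy i j with h' | h' | h'
    · exact absurd hij (hτ j i h')
    · exact h'
    · exact absurd hij.symm (hτ i j h')
  have hadj : ∀ i j : Fin 7, j < 3 → 3 ≤ i → e (x (τ j)) (x (τ i)) = b := fun i j hj hi => by
    have hji : j < i := hj.trans_le hi
    rw [hx.eq _ _ (hτ i j hji)]
    exact ((hσ i i.2).2 j hji).2 hj hi
  have := h b (x (τ 0)) (x (τ 1)) (x (τ 2)) (hinj.ne (by decide)) (hinj.ne (by decide))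
    (hinj.ne (by decide)) ((univ.filter fun i : Fin 7 => 3 ≤ i).image (x ∘ τ)) fun u hu => by
      obtain ⟨i, hi, rfl⟩ := mem_image.1 hu
      have hi : 3 ≤ i := (mem_filter.1 hi).2
      have hne : ∀ j : Fin 7, j < 3 → (x ∘ τ) i ≠ x (τ j) := fun j hj =>
        hinj.ne (hj.trans_le hi).ne'
      exact ⟨⟨hne 0 (by decide), hne 1 (by decide), hne 2 (by decide)⟩,
        hadj i 0 (by decide) hi, hadj i 1 (by decide) hi, hadj i 2 (by decide) hi⟩
  rw [card_image_of_injective _ hinj] at this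
  exact absurd this (by decide)

/-- The count of the representative of class `k`. -/
noncomputable def classTotal (e : V → V → Bool) (k : ℕ) : ℕ :=
  if k < 485 then total e 7 (pairBit (lget reps7 k)) else 0

theorem total_eq_of_classCheck (h : Sparse e) {g : ℕ → ℕ → Bool} (hg : Symmetric g) {k r : ℕ}
    (hk : classCheck g k r = true) : total e 7 g = classTotal e k := by
  rw [classCheck, force_eq] at hk
  rw [classTotal]
  cases h1 : Nat.beq k 485 <;> simp only [h1, cond_true, cond_false] at hk
  · rw [cond_false_eq_true, Nat.blt_eq, force_eq] at hk
    rw [if_pos hk.1]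
    exact (renames_of_check hk.2).total hg (symmetric_pairBit _) e
  · have h2 : k = 485 := by simpa using h1
    rw [if_neg (by omega), total, card_copies_eq_zero h hk, card_copies_eq_zero h.not hk]

theorem total_extend_eq_classTotal (he : Sparse e) {F : Cert} (hF : F ∈ certs) {p : ℕ}
    (hp : p < 32) (P : ℕ) :
    total e 7 (extend 6 (extend 5 (pairBit F.code) p) P) =
      classTotal e (classOf (F.entry p) P) := by
  have h1 := nall_eq_true.1 (lall_eq_true.1 check6_certs F hF) p hp
  simp only [force_eq, cond_false_eq_true, Nat.blt_eq] at h1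
  set r := F.entry p
  obtain ⟨hi, hr⟩ := h1
  have hr := renames_of_check hr
  set σ := permute (entryPerm r)
  set m := cond (entryFlip r) 63 0 with hm
  obtain ⟨hlt, hbit⟩ := gatherBits_spec σ (P ^^^ m)
  set P' := gatherBits (σ 0) (σ 1) (σ 2) (σ 3) (σ 4) (σ 5) (P ^^^ m) with hP'
  have hext := hr.extend (P := P) (P' := P') fun i hi => by
    rw [hbit i hi, Nat.testBit_xor, hm, Bool.xor_comm]
    cases entryFlip r
    · simp
    · have : Nat.testBit 63 (σ i) = true := by
        rw [show 63 = 2 ^ 6 - 1 from rfl, Nat.testBit_two_pow_sub_one]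
        exact decide_eq_true (hr.lt i hi)
      simp [this]
  rw [hext.total (((symmetric_pairBit _).extend _ _).extend _ _)
    ((symmetric_pairBit _).extend _ _) e]
  have h7 := nall_eq_true.1 check7_eq_true (entryIndex r) hi
  simp only [force_eq] at h7
  have hcls : classOf r P = digit 9 (lget classes7 (entryIndex r)) P' := by
    rw [classOf, class7, force_eq]; rfl
  rw [hcls]
  exact total_eq_of_classCheck he ((symmetric_pairBit _).extend _ _)
    (nall_eq_true.1 h7 P' hlt)

theorem classOf_lt (r P : ℕ) : classOf r P < 512 := by
  rw [classOf, class7, force_eq]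
  exact digit_lt 9 _ _

theorem isFunctional_weightedTotal (f : Cert → ℕ → ℕ → ℕ) :
    IsFunctional 512 (weightedTotal f) := by
  have hf : weightedTotal f = fun β => lsum certs fun F => nsum 32 fun p => nsum 32 fun q =>
      (19 * f F p q + f F p p) * β (classOf (F.entry p) q) +
        (19 * f F p q + f F p p) * β (classOf (F.entry p) (q + 32)) := by
    funext β
    simp only [weightedTotal, withClassOf_eq, ← mul_add]
    rfl
  rw [hf]
  refine .lsum _ fun F _ => .nsum _ fun p _ => .nsum _ fun q _ => .add ?_ ?_
  · exact .eval _ (classOf_lt _ _)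
  · exact .eval _ (classOf_lt _ _)

theorem cast_weightedTotal (f : Cert → ℕ → ℕ → ℕ) (β : ℕ → ℕ) :
    (weightedTotal f β : ℤ) = (certs.map fun F => ∑ p ∈ range 32, ∑ P ∈ range 64,
      (19 * f F p (P % 32) + f F p p : ℤ) * β (classOf (F.entry p) P)).sum := by
  have hf : weightedTotal f β = lsum certs fun F => nsum 32 fun p => nsum 32 fun q =>
      (19 * f F p q + f F p p) * (β (classOf (F.entry p) q) +
        β (classOf (F.entry p) (q + 32))) := by
    simp only [weightedTotal, withClassOf_eq]
    rfl
  rw [hf, lsum_eq]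
  refine congrArg List.sum (List.map_congr_left fun F _ => ?_)
  simp only [nsum_eq, Nat.cast_sum]
  refine sum_congr rfl fun p _ => ?_
  rw [show 64 = 32 + 32 from rfl, sum_range_add, ← sum_add_distrib]
  refine sum_congr rfl fun q hq => ?_
  have hq := mem_range.1 hq
  rw [Nat.add_mod_left, Nat.mod_eq_of_lt hq, add_comm 32 q]
  push_cast; ring

theorem total_extend_eq_zero (hV : Fintype.card V = 25) (he : ∀ u v, e u v = e v u)
    (h : Sparse e) {F : Cert} (hF : F ∈ certs) {p : ℕ} (hp : p < 32) (P : ℕ) :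
    total e 7 (extend 6 (extend 5 (pairBit F.code) p) P) = 0 := by
  rw [total_extend_eq_classTotal h hF hp P]
  refine eq_zero_of_digitCheck (isFunctional_weightedTotal _) (isFunctional_weightedTotal _)
    (by norm_num) digitCheck_weightedTotal (m := classTotal e)
    (fun k hk => if_neg (not_lt.2 hk)) ?_ _
  rw [← Int.ofNat_le, cast_weightedTotal, cast_weightedTotal]
  refine List.sum_le_sum fun F hF => sub_nonneg.1 ?_
  refine (F.sum_total_nonneg hV he h (lall_eq_true.1 valid_certs F hF)).trans_eq ?_
  simp only [← sum_sub_distrib]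
  refine sum_congr rfl fun p hp => sum_congr rfl fun P _ => ?_
  rw [total_extend_eq_classTotal h hF (mem_range.1 hp), Cert.form, Cert.form]
  ring

end Main

/-! ### The upper bound -/

section UpperBound

variable {V : Type} [Fintype V] {e : V → V → Bool}

theorem IsCopy.exists_extend (he : ∀ u v, e u v = e v u) {n : ℕ} {g : ℕ → ℕ → Bool}
    {x : Fin n → V} (hx : IsCopy e n g x) (hn : n < Fintype.card V) :
    ∃ P < 2 ^ n, ∃ y, IsCopy e (n + 1) (extend n g P) y := by
  have hns : ¬ Function.Surjective x := fun h => by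
    have := Fintype.card_le_of_surjective x h
    rw [Fintype.card_fin] at this
    omega
  obtain ⟨u, hu⟩ : ∃ u, u ∉ Set.range x := by
    by_contra! h
    exact hns h
  have hP : profile e x u < 2 ^ n := Nat.ofBits_lt_two_pow _
  exact ⟨profile e x u, hP, _, (isCopy_snoc he hP).2 ⟨hx, hu, rfl⟩⟩

theorem total_ne_zero {n : ℕ} {g : ℕ → ℕ → Bool} {x : Fin n → V} (hx : IsCopy e n g x) :
    total e n g ≠ 0 := by
  have : (copies e n g).card ≠ 0 := (card_pos.2 ⟨x, mem_copies.2 hx⟩).ne'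
  rw [total]
  omega

theorem total_not (n : ℕ) (g : ℕ → ℕ → Bool) : total (fun a b => !e a b) n g = total e n g := by
  simp only [total, Bool.not_not, add_comm]

theorem exists_cert_total_ne_zero (hV : Fintype.card V = 25) (he : ∀ u v, e u v = e v u) :
    ∃ F ∈ certs, total e 5 (pairBit F.code) ≠ 0 := by
  obtain ⟨v⟩ : Nonempty V := Fintype.card_pos_iff.1 (by omega)
  have h1 : IsCopy e 1 (fun _ _ => false) fun _ => v :=
    ⟨Function.injective_of_subsingleton _, fun i j hij => absurd (Subsingleton.elim i j) hij⟩
  obtain ⟨a, ha, _, h2⟩ := h1.exists_extend he (by omega)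
  obtain ⟨b, hb, _, h3⟩ := h2.exists_extend he (by omega)
  obtain ⟨c, hc, _, h4⟩ := h3.exists_extend he (by omega)
  obtain ⟨d, hd, x, h5⟩ := h4.exists_extend he (by omega)
  have h := nall_eq_true.1 (nall_eq_true.1 (nall_eq_true.1 (nall_eq_true.1
    check5_eq_true a ha) b hb) c hc) d hd
  simp only [force_eq] at h
  obtain ⟨F, hF, h⟩ := lany_eq_true.1 h
  have h := renames_of_check (cond_false_eq_true.1 h).2
  have h0 : Symmetric fun _ _ => false := fun _ _ _ => rfl
  refine ⟨F, hF, ?_⟩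
  rw [← h.total ((((h0.extend _ _).extend _ _).extend _ _).extend _ _) (symmetric_pairBit _) e]
  exact total_ne_zero h5

theorem exists_total_extend_ne_zero (hV : Fintype.card V = 25) (he : ∀ u v, e u v = e v u)
    {g : ℕ → ℕ → Bool} {x : Fin 5 → V} (hx : IsCopy e 5 g x) :
    ∃ p < 32, ∃ P, total e 7 (extend 6 (extend 5 g p) P) ≠ 0 := by
  obtain ⟨p, hp, _, h6⟩ := hx.exists_extend he (by omega)
  obtain ⟨P, -, _, h7⟩ := h6.exists_extend he (by omega)
  exact ⟨p, hp, P, total_ne_zero h7⟩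

theorem not_sparse (hV : Fintype.card V = 25) (he : ∀ u v, e u v = e v u) : ¬ Sparse e := by
  intro h
  obtain ⟨F, hF, h5⟩ := exists_cert_total_ne_zero hV he
  have key : ∃ p < 32, ∃ P, total e 7 (extend 6 (extend 5 (pairBit F.code) p) P) ≠ 0 := by
    rcases (copies e 5 (pairBit F.code)).eq_empty_or_nonempty with h1 | ⟨x, hx⟩
    · rcases (copies (fun a b => !e a b) 5 (pairBit F.code)).eq_empty_or_nonempty with
        h2 | ⟨x, hx⟩
      · simp [total, h1, h2] at h5
      · simpa only [total_not] using
          exists_total_extend_ne_zero hV (fun u v => by rw [he]) (mem_copies.1 hx)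
    · exact exists_total_extend_ne_zero hV he (mem_copies.1 hx)
  obtain ⟨p, hp, P, h7⟩ := key
  exact h7 (total_extend_eq_zero hV he h hF hp P)

end UpperBound

theorem containsCopy_of_common {V : Type} {G : SimpleGraph V} {a b d : V} (hab : a ≠ b)
    (had : a ≠ d) (hbd : b ≠ d) {s : Finset V} (hs : 4 ≤ s.card)
    (h : ∀ u ∈ s, G.Adj a u ∧ G.Adj b u ∧ G.Adj d u) :
    containsCopy (completeBipartiteGraph (Fin 3) (Fin 4)) G := by
  obtain ⟨t, hts, ht⟩ := exists_subset_card_eq hs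
  have hr : Function.Injective ![a, b, d] := by
    intro i j
    fin_cases i <;> fin_cases j <;> simp [hab, had, hbd, hab.symm, had.symm, hbd.symm]
  let y : Fin 4 ↪ V := (t.equivFinOfCardEq ht).symm.toEmbedding.trans (.subtype _)
  have hadj : ∀ i j, G.Adj (![a, b, d] i) (y j) := fun i j => by
    obtain ⟨h1, h2, h3⟩ := h (y j) (hts (Subtype.prop _))
    fin_cases i <;> assumption
  refine ⟨⟨Sum.elim ![a, b, d] y, hr.sumElim y.injective fun i j => (hadj i j).ne⟩, ?_⟩
  rintro (i | i) (j | j) hij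
  · simp at hij
  · exact hadj i j
  · exact (hadj j i).symm
  · simp at hij

theorem containsCopy_or_compl (G : SimpleGraph (Fin 25)) :
    containsCopy (completeBipartiteGraph (Fin 3) (Fin 4)) G ∨
      containsCopy (completeBipartiteGraph (Fin 3) (Fin 4)) Gᶜ := by
  classical
  by_contra! hG
  refine not_sparse (e := fun u v => decide (G.Adj u v)) (by simp)
    (fun u v => by simp [G.adj_comm]) fun c a b d hab had hbd s hs => ?_
  by_contra! hcard
  cases c
  · refine hG.2 (containsCopy_of_common hab had hbd hcard fun u hu => ?_)
    obtain ⟨⟨h1, h2, h3⟩, h4⟩ := hs u hu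
    simp only [decide_eq_false_iff_not] at h4
    simpa only [SimpleGraph.compl_adj] using
      ⟨⟨h1.symm, h4.1⟩, ⟨h2.symm, h4.2.1⟩, ⟨h3.symm, h4.2.2⟩⟩
  · refine hG.1 (containsCopy_of_common hab had hbd hcard fun u hu => ?_)
    simpa only [decide_eq_true_eq] using (hs u hu).2

/-! ### The lower bound -/

def extremalRows : List ℕ := [
  3393944, 10054860, 13383266, 6722355, 9855849, 12794140, 6921366, 3982915,
  13421625, 6710428, 3355590, 10064227, 3574892, 9684534, 13181843, 7092681,
  6450275, 3749433, 9999260, 13027782, 8797331, 12818121, 2737004, 3959094]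

def extremalAdj (i j : ℕ) : Bool := bit (lget extremalRows i) j

def extremalNonadj (i j : ℕ) : Bool :=
  cond (Nat.beq i j) false (not (extremalAdj i j))

/-- A graph on 24 vertices without copies of `K₃,₄` in it or in its complement. -/
def extremalGraph : SimpleGraph (Fin 24) where
  Adj i j := extremalAdj i j = true
  symm := ⟨by decide +kernel⟩
  loopless := ⟨by decide +kernel⟩

/-- No three of the first 24 vertices have four common neighbours. -/
def commonCheck (e : ℕ → ℕ → Bool) : Bool :=
  nall (nat_lit 24) fun i => nall i fun j => nall j fun k =>
    Nat.blt (nsum (nat_lit 24) fun v => cond (e i v) (cond (e j v) (cond (e k v)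
      (nat_lit 1) (nat_lit 0)) (nat_lit 0)) (nat_lit 0)) (nat_lit 4)

theorem commonCheck_extremalAdj : commonCheck extremalAdj = true := by decide +kernel

theorem commonCheck_extremalNonadj : commonCheck extremalNonadj = true := by decide +kernel

theorem not_containsCopy_of_commonCheck {G : SimpleGraph (Fin 24)} {e : ℕ → ℕ → Bool}
    (he : commonCheck e = true) (hG : ∀ i j : Fin 24, G.Adj i j → e i j = true) :
    ¬ containsCopy (completeBipartiteGraph (Fin 3) (Fin 4)) G := by
  rintro ⟨f, hf⟩
  have hs : (univ.map (Function.Embedding.inl.trans f)).card = 3 := by simp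
  let x := (univ.map (Function.Embedding.inl.trans f)).orderEmbOfFin hs
  have hx : ∀ i j, e (x i) (f (.inr j)) = true := fun i j => by
    obtain ⟨k, -, hk⟩ := mem_map.1 (orderEmbOfFin_mem _ hs i)
    refine hG _ _ ?_
    rw [show x i = f (.inl k) from hk.symm]
    exact hf (by simp)
  have hlt : ∀ i j, i < j → (x i : ℕ) < x j := fun i j hij => x.strictMono hij
  have h := nall_eq_true.1 (nall_eq_true.1 (nall_eq_true.1 he (x 2) (x 2).2)
    (x 1) (hlt 1 2 (by decide))) (x 0) (hlt 0 1 (by decide))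
  rw [Nat.blt_eq, nsum_eq, ← Fin.sum_univ_eq_sum_range (fun v => cond (e (x 2) v)
    (cond (e (x 1) v) (cond (e (x 0) v) 1 0) 0) 0)] at h
  refine h.not_ge ?_
  calc
    4 = ∑ v ∈ univ.map (Function.Embedding.inr.trans f), 1 := by simp
    _ ≤ ∑ v ∈ univ.map (Function.Embedding.inr.trans f),
        cond (e (x 2) v) (cond (e (x 1) v) (cond (e (x 0) v) 1 0) 0) 0 := by
      refine sum_le_sum fun v hv => ?_
      obtain ⟨j, -, rfl⟩ := mem_map.1 hv
      have : ∀ i, e (x i) ((Function.Embedding.inr.trans f) j) = true := fun i => hx i j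
      simp only [this, cond_true, le_refl]
    _ ≤ _ := sum_le_sum_of_subset (subset_univ _)

theorem exists_not_containsCopy :
    ∃ G : SimpleGraph (Fin 24),
      ¬ containsCopy (completeBipartiteGraph (Fin 3) (Fin 4)) G ∧
      ¬ containsCopy (completeBipartiteGraph (Fin 3) (Fin 4)) Gᶜ := by
  refine ⟨extremalGraph, not_containsCopy_of_commonCheck commonCheck_extremalAdj fun _ _ h => h,
    not_containsCopy_of_commonCheck commonCheck_extremalNonadj fun i j h => ?_⟩
  obtain ⟨h1, h2⟩ := h
  have h3 : Nat.beq i j = false := by simpa [Bool.eq_false_iff, Fin.ext_iff] using h1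
  have h4 : extremalAdj i j = false := Bool.eq_false_iff.2 h2
  rw [extremalNonadj, h3, h4]
  rfl

end RamseyK34

/-- R(K₃,₄, K₃,₄) = 25. -/
theorem ramsey_K34_K34_eq_25 :
    (∀ G : SimpleGraph (Fin 25),
      containsCopy (completeBipartiteGraph (Fin 3) (Fin 4)) G ∨
      containsCopy (completeBipartiteGraph (Fin 3) (Fin 4)) Gᶜ) ∧
    (∃ G : SimpleGraph (Fin 24),
      ¬ containsCopy (completeBipartiteGraph (Fin 3) (Fin 4)) G ∧
      ¬ containsCopy (completeBipartiteGraph (Fin 3) (Fin 4)) Gᶜ) :=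
  ⟨RamseyK34.containsCopy_or_compl, RamseyK34.exists_not_containsCopy⟩
end
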